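/- Let n ≥ 3. There exists a pinching family C(s), s ∈ [0,1), such that C(0) is the cone of 2-nonnegative curvature operators in S²_B(so(n)). -/

import Mathlib

/-!
Common setup: we identify ⋀²ℝⁿ with the Lie algebra `so n` of real skew-symmetric
`n × n` matrices, sending `eᵢ ∧ eⱼ` to the rotation by `π/2` in the plane spanned by
`eᵢ, eⱼ`; the inner product on `so n` is `⟪A, B⟫ = -(1/2)·tr (A * B)`, and under this
identification `v ∧ w` corresponds to the skew-symmetric matrix `v wᵀ - w vᵀ`, while
the wedge `A ∧ B` of two endomorphisms of `ℝⁿ` acts on a skew matrix `M` by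
`M ↦ (1/2)(A M Bᵀ + B M Aᵀ)` (the unique linear extension of
`v∧w ↦ (1/2)(Av ∧ Bw + Bv ∧ Aw)`).
-/

noncomputable section

namespace BW

open Matrix

abbrev Mat (n : ℕ) := Matrix (Fin n) (Fin n) ℝ

/-- `so n`: the space of real skew-symmetric `n × n` matrices (≅ ⋀²ℝⁿ). -/
def so (n : ℕ) : Submodule ℝ (Mat n) where
  carrier := {A | Aᵀ = -A}
  add_mem' := by
    intro A B hA hB
    simp only [Set.mem_setOf_eq] at *
    rw [Matrix.transpose_add, hA, hB, neg_add]
  zero_mem' := by simp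
  smul_mem' := by
    intro c A hA
    simp only [Set.mem_setOf_eq] at *
    rw [Matrix.transpose_smul, hA, smul_neg]

variable {n : ℕ}

lemma mem_so_iff {A : Mat n} : A ∈ so n ↔ Aᵀ = -A := Iff.rfl

/-- The inner product `⟨A,B⟩ = -(1/2)·tr(AB)` on `so n`. -/
def ip (A B : so n) : ℝ := -(1/2) * Matrix.trace ((A : Mat n) * (B : Mat n))

/-- `ip` as a linear map in the second variable. -/
def ipL (A : so n) : so n →ₗ[ℝ] ℝ where
  toFun B := ip A B
  map_add' B C := by
    simp only [ip, Submodule.coe_add, Matrix.mul_add, Matrix.trace_add]; ring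
  map_smul' c B := by
    simp only [ip, SetLike.val_smul, Matrix.mul_smul, Matrix.trace_smul, smul_eq_mul,
      RingHom.id_apply]; ring

/-- The Lie bracket (matrix commutator) on `so n`. -/
def brk (A B : so n) : so n :=
  ⟨(A : Mat n) * (B : Mat n) - (B : Mat n) * (A : Mat n), by
    have hA : (A : Mat n)ᵀ = -(A : Mat n) := A.2
    have hB : (B : Mat n)ᵀ = -(B : Mat n) := B.2
    rw [mem_so_iff, Matrix.transpose_sub, Matrix.transpose_mul, Matrix.transpose_mul, hA, hB]
    noncomm_ring⟩

/-- Auxiliary linear map underlying `A ∧ B`. -/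
def wedgeAux (A B : Mat n) : Mat n →ₗ[ℝ] Mat n where
  toFun M := (1/2 : ℝ) • (A * M * Bᵀ + B * M * Aᵀ)
  map_add' M N := by
    simp only [mul_add, add_mul, smul_add]
    module
  map_smul' c M := by
    simp only [mul_smul_comm, smul_mul_assoc, RingHom.id_apply]
    module

lemma wedgeAux_mem (A B : Mat n) : ∀ M ∈ so n, wedgeAux A B M ∈ so n := by
  intro M hM
  rw [mem_so_iff] at hM ⊢
  show ((1/2 : ℝ) • (A * M * Bᵀ + B * M * Aᵀ))ᵀ = -((1/2 : ℝ) • (A * M * Bᵀ + B * M * Aᵀ))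
  rw [Matrix.transpose_smul, Matrix.transpose_add, Matrix.transpose_mul, Matrix.transpose_mul,
    Matrix.transpose_mul, Matrix.transpose_mul, Matrix.transpose_transpose,
    Matrix.transpose_transpose, hM]
  simp only [Matrix.neg_mul, Matrix.mul_neg, Matrix.mul_assoc, smul_neg, neg_add, smul_add]
  abel

/-- The wedge `A ∧ B` of two endomorphisms of ℝⁿ, as an endomorphism of `so n ≅ ⋀²ℝⁿ`:
the unique linear map with `(A ∧ B)(v ∧ w) = (1/2)(Av ∧ Bw + Bv ∧ Aw)`. -/
def wedge (A B : Mat n) : Module.End ℝ (so n) :=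
  (wedgeAux A B).restrict (p := so n) (q := so n) (wedgeAux_mem A B)

/-- The index set of pairs `i < j`. -/
def pairs (n : ℕ) : Finset (Fin n × Fin n) := Finset.univ.filter fun p => p.1 < p.2

/-- The standard basis vector `eᵢ` of ℝⁿ. -/
def evec (i : Fin n) : Fin n → ℝ := fun k => if k = i then 1 else 0

/-- `v ∧ w`, as an element of `so n ≅ ⋀²ℝⁿ`. -/
def vwedge (v w : Fin n → ℝ) : so n :=
  ⟨Matrix.of fun i j => v i * w j - w i * v j, by
    rw [mem_so_iff]
    ext i j
    simp only [Matrix.transpose_apply, Matrix.of_apply, Matrix.neg_apply]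
    ring⟩

/-- The orthonormal basis vector `eᵢ ∧ eⱼ` of `so n ≅ ⋀²ℝⁿ`. -/
def bvec (i j : Fin n) : so n := vwedge (evec i) (evec j)

/-- Hamilton's sharp product `R # S`: the self-adjoint endomorphism of `so n` determined by
`⟨(R#S)h, h⟩ = (1/2)·Σ_{α,β} ⟨[R(b_α), S(b_β)], h⟩·⟨[b_α, b_β], h⟩`,
where `(b_α)` is the orthonormal basis `(eᵢ ∧ eⱼ)_{i<j}` of `so n`. -/
def sharp (R S : Module.End ℝ (so n)) : Module.End ℝ (so n) :=
  (1/4 : ℝ) • ∑ p ∈ pairs n, ∑ q ∈ pairs n,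
    ((ipL (brk (R (bvec p.1 p.2)) (S (bvec q.1 q.2)))).smulRight
        (brk (bvec p.1 p.2) (bvec q.1 q.2))
      + (ipL (brk (bvec p.1 p.2) (bvec q.1 q.2))).smulRight
        (brk (R (bvec p.1 p.2)) (S (bvec q.1 q.2))))

/-- The right-hand side `R² + R^#` of Hamilton's ODE. -/
def Qode (R : Module.End ℝ (so n)) : Module.End ℝ (so n) := R * R + sharp R R

/-- The coordinates `R_{ijkl} = ⟨R(eᵢ∧eⱼ), e_k∧e_l⟩` of an endomorphism of `so n`. -/
def Rcoord (R : Module.End ℝ (so n)) (i j k l : Fin n) : ℝ := ip (R (bvec i j)) (bvec k l)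

/-- Self-adjointness with respect to the inner product `ip`. -/
def selfAdjEnd (R : Module.End ℝ (so n)) : Prop := ∀ X Y : so n, ip (R X) Y = ip X (R Y)

/-- A curvature operator: a self-adjoint endomorphism of `so n ≅ ⋀²ℝⁿ` satisfying the
first Bianchi identity.  (`isCurvOp` carves out `S²_B(so n)`.) -/
def isCurvOp (R : Module.End ℝ (so n)) : Prop :=
  selfAdjEnd R ∧
    ∀ i j k l : Fin n, Rcoord R i j k l + Rcoord R j k i l + Rcoord R k i j l = 0

/-- The Ricci tensor `Ric_{ij} = Σ_k R_{ikjk}` of `R`. -/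
def RicM (R : Module.End ℝ (so n)) : Mat n := Matrix.of fun i j => ∑ k, Rcoord R i k j k

/-- `λ̄ = tr(Ric)/n`. -/
def lamb (R : Module.End ℝ (so n)) : ℝ := Matrix.trace (RicM R) / (n : ℝ)

/-- The traceless Ricci tensor `Ric₀ = Ric - (tr Ric / n)·id`. -/
def Ric0 (R : Module.End ℝ (so n)) : Mat n := RicM R - lamb R • (1 : Mat n)

/-- `σ = tr(Ric₀²)/n`. -/
def sigmaR (R : Module.End ℝ (so n)) : ℝ := Matrix.trace (Ric0 R * Ric0 R) / (n : ℝ)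

/-- `R_I = (λ̄/(n-1))·(id ∧ id)`, the projection of `R` onto `⟨I⟩`. -/
def RI (R : Module.End ℝ (so n)) : Module.End ℝ (so n) :=
  (lamb R / ((n : ℝ) - 1)) • wedge (1 : Mat n) (1 : Mat n)

/-- `R_{Ric₀} = (2/(n-2))·(Ric₀ ∧ id)`, the projection of `R` onto `⟨Ric₀⟩`. -/
def RRic0 (R : Module.End ℝ (so n)) : Module.End ℝ (so n) :=
  (2 / ((n : ℝ) - 2)) • wedge (Ric0 R) (1 : Mat n)

/-- The linear map `ℓ_{a,b}(R) = R + 2(n-1)a·R_I + (n-2)b·R_{Ric₀}`. -/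
def lab (a b : ℝ) (R : Module.End ℝ (so n)) : Module.End ℝ (so n) :=
  R + (2 * ((n : ℝ) - 1) * a) • RI R + (((n : ℝ) - 2) * b) • RRic0 R

/-- Positive semidefiniteness of the quadratic form of an endomorphism of `so n`. -/
def posSemidefEnd (R : Module.End ℝ (so n)) : Prop := ∀ X : so n, 0 ≤ ip (R X) X

/-- Positive definiteness of the quadratic form of an endomorphism of `so n`. -/
def posDefEnd (R : Module.End ℝ (so n)) : Prop := ∀ X : so n, X ≠ 0 → 0 < ip (R X) X

/-- `R` is 2-nonnegative: the sum of its two smallest eigenvalues is nonnegative;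
equivalently (Ky Fan), `q_R(X) + q_R(Y) ≥ 0` for all orthonormal pairs `X, Y`. -/
def twoNonneg (R : Module.End ℝ (so n)) : Prop :=
  ∀ X Y : so n, ip X X = 1 → ip Y Y = 1 → ip X Y = 0 → 0 ≤ ip (R X) X + ip (R Y) Y

/-- The (Frobenius) norm of an endomorphism of `so n`, computed in the orthonormal
basis `(eᵢ ∧ eⱼ)_{i<j}`. -/
def endNorm (R : Module.End ℝ (so n)) : ℝ :=
  Real.sqrt (∑ p ∈ pairs n, ip (R (bvec p.1 p.2)) (R (bvec p.1 p.2)))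

/-- The tangent cone `T_R C`: the closure of `{t·(S - R) : S ∈ C, t ≥ 0}`. -/
def tangCone (C : Set (Module.End ℝ (so n))) (R : Module.End ℝ (so n)) :
    Set (Module.End ℝ (so n)) :=
  {X | ∀ ε > 0, ∃ S ∈ C, ∃ t : ℝ, 0 ≤ t ∧ endNorm (X - t • (S - R)) < ε}

/-- `C` is a closed subset of the space of endomorphisms of `so n`. -/
def isClosedSet (C : Set (Module.End ℝ (so n))) : Prop :=
  ∀ X, (∀ ε > 0, ∃ Y ∈ C, endNorm (X - Y) < ε) → X ∈ C

/-- The interior of `C` relative to the subspace `S²_B(so n)` of curvature operators. -/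
def interiorCurv (C : Set (Module.End ℝ (so n))) : Set (Module.End ℝ (so n)) :=
  {X | isCurvOp X ∧ ∃ ε > 0, ∀ Y, isCurvOp Y → endNorm (Y - X) < ε → Y ∈ C}

/-- Auxiliary linear map `M ↦ g M gᵀ` on matrices. -/
def conjAux (g : Mat n) : Mat n →ₗ[ℝ] Mat n where
  toFun M := g * M * gᵀ
  map_add' M N := by simp only [mul_add, add_mul]
  map_smul' c M := by simp only [mul_smul_comm, smul_mul_assoc, RingHom.id_apply]

/-- `⋀²g` : the action `M ↦ g M gᵀ` of `g` on `so n ≅ ⋀²ℝⁿ` (for `g` orthogonal this is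
the second exterior power of `g`). -/
def conjSo (g : Mat n) : Module.End ℝ (so n) :=
  (conjAux g).restrict (p := so n) (q := so n) (fun M hM => by
    rw [mem_so_iff] at hM ⊢
    show (g * M * gᵀ)ᵀ = -(g * M * gᵀ)
    rw [Matrix.transpose_mul, Matrix.transpose_mul, Matrix.transpose_transpose, hM]
    simp only [Matrix.neg_mul, Matrix.mul_neg, Matrix.mul_assoc])

/-- The action `g · R = (⋀²g) ∘ R ∘ (⋀²g)⁻¹` of an orthogonal matrix `g`
(whose inverse is `gᵀ`) on endomorphisms of `so n`. -/
def onAct (g : Mat n) (R : Module.End ℝ (so n)) : Module.End ℝ (so n) :=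
  conjSo g * R * conjSo gᵀ

/-- Two sets are at Hausdorff distance at most `ε` from each other. -/
def hdClose (A B : Set (Module.End ℝ (so n))) (ε : ℝ) : Prop :=
  (∀ X ∈ A, ∃ Y ∈ B, endNorm (X - Y) ≤ ε) ∧ ∀ Y ∈ B, ∃ X ∈ A, endNorm (X - Y) ≤ ε

/-- The truncation `C ∩ {‖R‖ ≤ 1}`. -/
def truncSet (C : Set (Module.End ℝ (so n))) : Set (Module.End ℝ (so n)) :=
  {R ∈ C | endNorm R ≤ 1}


/-- A pinching family of closed convex O(n)-invariant full-dimensional cones `C(s)`,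
`s ∈ [0,1)`, in the space `S²_B(so n)` of curvature operators. -/
structure PinchingFamily (n : ℕ) (C : ℝ → Set (Module.End ℝ (so n))) : Prop where
  curv : ∀ s ∈ Set.Ico (0 : ℝ) 1, ∀ R ∈ C s, isCurvOp R
  closed : ∀ s ∈ Set.Ico (0 : ℝ) 1, isClosedSet (C s)
  convex : ∀ s ∈ Set.Ico (0 : ℝ) 1, Convex ℝ (C s)
  cone : ∀ s ∈ Set.Ico (0 : ℝ) 1, ∀ R ∈ C s, ∀ t : ℝ, 0 ≤ t → t • R ∈ C s
  oInv : ∀ s ∈ Set.Ico (0 : ℝ) 1, ∀ g : Mat n, g * gᵀ = 1 → ∀ R ∈ C s, onAct g R ∈ C s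
  fullDim : ∀ s ∈ Set.Ico (0 : ℝ) 1, ∃ R, R ∈ interiorCurv (C s)
  cont : ∀ s₀ ∈ Set.Ico (0 : ℝ) 1, ∀ ε > (0 : ℝ), ∃ δ > (0 : ℝ), ∀ s ∈ Set.Ico (0 : ℝ) 1,
    |s - s₀| < δ → hdClose (truncSet (C s)) (truncSet (C s₀)) ε
  posScal : ∀ s ∈ Set.Ico (0 : ℝ) 1, ∀ R ∈ C s, R ≠ 0 → 0 < Matrix.trace (RicM R)
  odeInterior : ∀ s ∈ Set.Ioo (0 : ℝ) 1, ∀ R ∈ C s, R ≠ 0 →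
    Qode R ∈ interiorCurv (tangCone (C s) R)
  limit : ∀ ε > (0 : ℝ), ∃ s₀ ∈ Set.Ico (0 : ℝ) 1, ∀ s ∈ Set.Ico s₀ 1,
    hdClose (truncSet (C s))
      (truncSet {R | ∃ t : ℝ, 0 ≤ t ∧ R = t • wedge (1 : Mat n) (1 : Mat n)}) ε

lemma so_apply_swap (X : so n) (i j : Fin n) : (X : Mat n) i j = -(X : Mat n) j i := by
  have h := congrFun (congrFun (mem_so_iff.1 X.2) j) i
  simpa [Matrix.transpose_apply] using h

lemma ip_eq_sum (X Y : so n) :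
    ip X Y = (1/2) * ∑ i, ∑ j, (X : Mat n) i j * (Y : Mat n) i j := by
  simp only [ip, Matrix.trace, Matrix.diag_apply, Matrix.mul_apply, Finset.mul_sum]
  refine Finset.sum_congr rfl fun i _ => Finset.sum_congr rfl fun j _ => ?_
  rw [so_apply_swap Y j i]
  ring

lemma ip_comm (X Y : so n) : ip X Y = ip Y X := by
  simp only [ip_eq_sum, mul_comm]

lemma ip_add_left (X Y Z : so n) : ip (X + Y) Z = ip X Z + ip Y Z := by
  rw [ip_comm, ip_comm X, ip_comm Y]
  exact (ipL Z).map_add X Y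

lemma ip_smul_left (c : ℝ) (X Z : so n) : ip (c • X) Z = c * ip X Z := by
  rw [ip_comm, ip_comm X]
  exact (ipL Z).map_smul c X

lemma ip_add_right (X Y Z : so n) : ip X (Y + Z) = ip X Y + ip X Z := (ipL X).map_add Y Z

lemma ip_smul_right (c : ℝ) (X Z : so n) : ip X (c • Z) = c * ip X Z := (ipL X).map_smul c Z

lemma ip_zero_left (X : so n) : ip 0 X = 0 := by
  rw [ip_comm]
  exact (ipL X).map_zero

lemma ip_sub_left (X Y Z : so n) : ip (X - Y) Z = ip X Z - ip Y Z := by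
  rw [ip_comm, ip_comm X, ip_comm Y]
  exact (ipL Z).map_sub X Y

lemma ip_sub_right (X Y Z : so n) : ip X (Y - Z) = ip X Y - ip X Z := (ipL X).map_sub Y Z

lemma ip_self_nonneg (X : so n) : 0 ≤ ip X X := by
  rw [ip_eq_sum]
  have : ∀ i j, 0 ≤ (X : Mat n) i j * (X : Mat n) i j := fun i j => mul_self_nonneg _
  have := Finset.sum_nonneg fun i (_ : i ∈ Finset.univ) =>
    Finset.sum_nonneg fun j (_ : j ∈ Finset.univ) => this i j
  linarith

lemma ip_self_pos {X : so n} (h : X ≠ 0) : 0 < ip X X := by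
  refine lt_of_le_of_ne (ip_self_nonneg X) fun h0 => h ?_
  rw [ip_eq_sum] at h0
  have h1 : ∑ i, ∑ j, (X : Mat n) i j * (X : Mat n) i j = 0 := by linarith
  ext i j
  have h2 := (Finset.sum_eq_zero_iff_of_nonneg
    fun i _ => Finset.sum_nonneg fun j _ => mul_self_nonneg _).1 h1 i (Finset.mem_univ _)
  have h3 := (Finset.sum_eq_zero_iff_of_nonneg
    fun j _ => mul_self_nonneg _).1 h2 j (Finset.mem_univ _)
  exact mul_self_eq_zero.1 h3

lemma bvec_apply (i j k l : Fin n) : (bvec i j : Mat n) k l =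
    (if k = i then 1 else 0) * (if l = j then 1 else 0)
      - (if k = j then 1 else 0) * (if l = i then 1 else 0) := rfl

lemma bvec_swap (i j : Fin n) : (bvec j i : so n) = -bvec i j := by
  ext k l
  simp only [bvec_apply, NegMemClass.coe_neg, Matrix.neg_apply]
  ring

lemma bvec_self (i : Fin n) : (bvec i i : so n) = 0 := by
  ext k l
  simp [bvec_apply]

lemma ip_bvec (X : so n) (i j : Fin n) : ip X (bvec i j) = (X : Mat n) i j := by
  rw [ip_eq_sum]
  simp only [bvec_apply, mul_sub, Finset.sum_sub_distrib, mul_ite, mul_one, mul_zero, Finset.sum_ite_eq', Finset.mem_univ, if_true]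
  rw [so_apply_swap X j i]
  ring

lemma so_eq_sum (X : so n) : X = (1/2 : ℝ) • ∑ i, ∑ j, (X : Mat n) i j • bvec i j := by
  ext k l
  simp only [SetLike.val_smul, AddSubmonoidClass.coe_finsetSum, Matrix.smul_apply, Matrix.sum_apply,
    smul_eq_mul, bvec_apply, mul_sub, Finset.sum_sub_distrib, mul_ite, mul_one, mul_zero, Finset.sum_ite_eq, Finset.mem_univ, if_true,
    Finset.sum_ite_irrel, Finset.sum_const_zero]
  rw [so_apply_swap X l k]
  ring

lemma Rcoord_eq (R : Module.End ℝ (so n)) (i j k l : Fin n) :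
    Rcoord R i j k l = (R (bvec i j) : Mat n) k l := ip_bvec _ _ _

lemma End_apply (R : Module.End ℝ (so n)) (X : so n) (k l : Fin n) :
    (R X : Mat n) k l = (1/2) * ∑ i, ∑ j, (X : Mat n) i j * Rcoord R i j k l := by
  conv_lhs => rw [so_eq_sum X]
  simp only [map_smul, map_sum, SetLike.val_smul, AddSubmonoidClass.coe_finsetSum,
    Matrix.smul_apply, Matrix.sum_apply, smul_eq_mul, Rcoord_eq]

lemma End_ext {R S : Module.End ℝ (so n)} (h : ∀ i j k l, Rcoord R i j k l = Rcoord S i j k l) :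
    R = S := by
  refine LinearMap.ext fun X => ?_
  ext k l
  simp only [End_apply, h]

lemma ip_apply_eq_sum (R : Module.End ℝ (so n)) (X Y : so n) : ip (R X) Y =
    (1/4) * ∑ i, ∑ j, ∑ k, ∑ l, (X : Mat n) i j * (Y : Mat n) k l * Rcoord R i j k l := by
  rw [ip_eq_sum]
  simp only [End_apply, Finset.mul_sum, Finset.sum_mul]
  calc _ = ∑ k, ∑ i, ∑ l, ∑ j, 1 / 2 * (1 / 2 * ((X : Mat n) i j * Rcoord R i j k l)
        * (Y : Mat n) k l) := Finset.sum_congr rfl fun k _ => Finset.sum_comm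
    _ = ∑ i, ∑ k, ∑ l, ∑ j, 1 / 2 * (1 / 2 * ((X : Mat n) i j * Rcoord R i j k l)
        * (Y : Mat n) k l) := Finset.sum_comm
    _ = ∑ i, ∑ k, ∑ j, ∑ l, 1 / 2 * (1 / 2 * ((X : Mat n) i j * Rcoord R i j k l)
        * (Y : Mat n) k l) :=
          Finset.sum_congr rfl fun i _ => Finset.sum_congr rfl fun k _ => Finset.sum_comm
    _ = ∑ i, ∑ j, ∑ k, ∑ l, 1 / 2 * (1 / 2 * ((X : Mat n) i j * Rcoord R i j k l)
        * (Y : Mat n) k l) := Finset.sum_congr rfl fun i _ => Finset.sum_comm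
    _ = _ := by
      refine Finset.sum_congr rfl fun i _ => Finset.sum_congr rfl fun j _ =>
        Finset.sum_congr rfl fun k _ => Finset.sum_congr rfl fun l _ => ?_
      ring

section linearity

variable (R S : Module.End ℝ (so n)) (i j k l : Fin n)

lemma Rcoord_add : Rcoord (R + S) i j k l = Rcoord R i j k l + Rcoord S i j k l := by
  simp [Rcoord_eq]

lemma Rcoord_sub : Rcoord (R - S) i j k l = Rcoord R i j k l - Rcoord S i j k l := by
  simp [Rcoord_eq]

lemma Rcoord_smul (c : ℝ) : Rcoord (c • R) i j k l = c * Rcoord R i j k l := by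
  simp [Rcoord_eq]

lemma Rcoord_zero : Rcoord (0 : Module.End ℝ (so n)) i j k l = 0 := by
  simp [Rcoord_eq]

lemma Rcoord_swap_left : Rcoord R j i k l = -Rcoord R i j k l := by
  simp [Rcoord_eq, bvec_swap i j]

lemma Rcoord_swap_right : Rcoord R i j l k = -Rcoord R i j k l := by
  rw [Rcoord_eq, Rcoord_eq, so_apply_swap]

lemma Rcoord_self_left : Rcoord R i i k l = 0 := by
  have := Rcoord_swap_left R i i k l
  linarith

lemma Rcoord_mul : Rcoord (R * S) i j k l =
    (1/2) * ∑ p, ∑ q, Rcoord S i j p q * Rcoord R p q k l := by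
  rw [Rcoord_eq, Module.End.mul_apply, End_apply]
  simp only [Rcoord_eq]

lemma Rcoord_wedge (A B : Mat n) : Rcoord (wedge A B) i j k l =
    (1/2) * (A k i * B l j + B k i * A l j - A k j * B l i - B k j * A l i) := by
  rw [Rcoord_eq]
  change ((1/2 : ℝ) • (A * (bvec i j : Mat n) * Bᵀ + B * (bvec i j : Mat n) * Aᵀ)) k l = _
  simp only [Matrix.smul_apply, Matrix.add_apply, Matrix.mul_apply, bvec_apply, smul_eq_mul,
    Matrix.transpose_apply, mul_sub, sub_mul, Finset.sum_sub_distrib, mul_ite, ite_mul, mul_one,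
    mul_zero, zero_mul, Finset.sum_ite_eq', Finset.mem_univ, if_true,
    Finset.sum_ite_irrel, Finset.sum_const_zero]
  ring

end linearity

lemma selfAdjEnd_iff {R : Module.End ℝ (so n)} :
    selfAdjEnd R ↔ ∀ i j k l, Rcoord R i j k l = Rcoord R k l i j := by
  constructor
  · intro h i j k l
    rw [Rcoord, h, ip_comm]
    rfl
  · intro h X Y
    rw [ip_comm X, ip_apply_eq_sum, ip_apply_eq_sum]
    congr 1
    calc _ = ∑ i, ∑ k, ∑ j, ∑ l, (X : Mat n) i j * (Y : Mat n) k l * Rcoord R i j k l :=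
          Finset.sum_congr rfl fun i _ => Finset.sum_comm
      _ = ∑ k, ∑ i, ∑ j, ∑ l, (X : Mat n) i j * (Y : Mat n) k l * Rcoord R i j k l :=
          Finset.sum_comm
      _ = ∑ k, ∑ i, ∑ l, ∑ j, (X : Mat n) i j * (Y : Mat n) k l * Rcoord R i j k l :=
          Finset.sum_congr rfl fun k _ => Finset.sum_congr rfl fun i _ => Finset.sum_comm
      _ = ∑ k, ∑ l, ∑ i, ∑ j, (X : Mat n) i j * (Y : Mat n) k l * Rcoord R i j k l :=
          Finset.sum_congr rfl fun k _ => Finset.sum_comm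
      _ = _ := by
        refine Finset.sum_congr rfl fun k _ => Finset.sum_congr rfl fun l _ =>
          Finset.sum_congr rfl fun i _ => Finset.sum_congr rfl fun j _ => ?_
        rw [h i j k l]
        ring

/-- Summation over `pairs` of a symmetric function vanishing on the diagonal. -/
lemma sum_pairs (f : Fin n → Fin n → ℝ) (hs : ∀ i j, f i j = f j i) (hd : ∀ i, f i i = 0) :
    ∑ p ∈ pairs n, f p.1 p.2 = (1/2) * ∑ i, ∑ j, f i j := by
  have h1 : ∑ p ∈ pairs n, f p.1 p.2 = ∑ i, ∑ j, if i < j then f i j else 0 := by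
    rw [pairs, Finset.sum_filter, ← Finset.univ_product_univ, Finset.sum_product]
  have h2 : ∑ i, ∑ j, (if i < j then f i j else 0) = ∑ i, ∑ j, if j < i then f i j else 0 := by
    rw [Finset.sum_comm]
    refine Finset.sum_congr rfl fun i _ => Finset.sum_congr rfl fun j _ => ?_
    rw [hs]
  have h3 : ∑ i, ∑ j, f i j = ∑ i, ∑ j, (if i < j then f i j else 0)
      + ∑ i, ∑ j, if j < i then f i j else 0 := by
    simp only [← Finset.sum_add_distrib]
    refine Finset.sum_congr rfl fun i _ => Finset.sum_congr rfl fun j _ => ?_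
    rcases lt_trichotomy i j with h | h | h
    · simp [h, h.not_gt]
    · simp [h, hd]
    · simp [h, h.not_gt]
  rw [h1, h3, ← h2]
  ring

lemma brk_neg_left (X Y : so n) : brk (-X) Y = -brk X Y := by
  apply Subtype.ext
  simp [brk]
  abel

lemma brk_neg_right (X Y : so n) : brk X (-Y) = -brk X Y := by
  apply Subtype.ext
  simp [brk]
  abel

lemma brk_comm (X Y : so n) : brk X Y = -brk Y X := by
  apply Subtype.ext
  simp [brk]

lemma brk_apply (X Y : so n) (i j : Fin n) : (brk X Y : Mat n) i j =
    ∑ p, ((X : Mat n) i p * (Y : Mat n) p j - (Y : Mat n) i p * (X : Mat n) p j) := by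
  simp [brk, Matrix.mul_apply]

lemma sum_mul_bvec (F : Fin n → Fin n → ℝ) (hF : ∀ a b, F a b = -F b a) (k l : Fin n) :
    ∑ a, ∑ b, F a b * (bvec a b : Mat n) k l = 2 * F k l := by
  simp only [bvec_apply, mul_sub, Finset.sum_sub_distrib, mul_ite, mul_one, mul_zero, Finset.sum_ite_eq, Finset.mem_univ, if_true,
    Finset.sum_ite_irrel, Finset.sum_const_zero]
  rw [hF l k]
  ring

lemma sum_mul_brk_bvec (F : Fin n → Fin n → ℝ) (hF : ∀ a b, F a b = -F b a) (N : so n)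
    (k l : Fin n) : ∑ a, ∑ b, F a b * (brk (bvec a b) N : Mat n) k l =
      2 * ∑ m, (F k m * (N : Mat n) m l - F m l * (N : Mat n) k m) := by
  have h : ∀ a b, F a b * (brk (bvec a b) N : Mat n) k l =
      ∑ m, (F a b * (bvec a b : Mat n) k m * (N : Mat n) m l
        - F a b * (bvec a b : Mat n) m l * (N : Mat n) k m) := by
    intro a b
    rw [brk_apply, Finset.mul_sum]
    exact Finset.sum_congr rfl fun m _ => by ring
  calc _ = ∑ m, ∑ a, ∑ b, (F a b * (bvec a b : Mat n) k m * (N : Mat n) m l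
        - F a b * (bvec a b : Mat n) m l * (N : Mat n) k m) := by
        simp only [h]
        rw [Finset.sum_comm]
        refine Eq.trans (Finset.sum_congr rfl fun b _ => Finset.sum_comm) ?_
        rw [Finset.sum_comm]
        exact Finset.sum_congr rfl fun m _ => Finset.sum_comm
    _ = _ := by
        rw [Finset.mul_sum]
        refine Finset.sum_congr rfl fun m _ => ?_
        simp only [Finset.sum_sub_distrib, ← Finset.sum_mul, sum_mul_bvec F hF]
        ring

lemma sum_brk_mul_brk (R : Module.End ℝ (so n)) (i j k l : Fin n) :
    ∑ a, ∑ b, ∑ c, ∑ d, (brk (R (bvec a b)) (R (bvec c d)) : Mat n) i j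
      * (brk (bvec a b) (bvec c d) : Mat n) k l =
    8 * ∑ m, (brk (R (bvec k m)) (R (bvec m l)) : Mat n) i j := by
  have hF : ∀ c d a b, (brk (R (bvec a b)) (R (bvec c d)) : Mat n) i j
      = -(brk (R (bvec b a)) (R (bvec c d)) : Mat n) i j := by
    intro c d a b
    rw [bvec_swap b a, map_neg, brk_neg_left]
    simp
  have hG : ∀ a b c d, (brk (R (bvec a b)) (R (bvec c d)) : Mat n) i j
      = -(brk (R (bvec a b)) (R (bvec d c)) : Mat n) i j := by
    intro a b c d
    rw [bvec_swap d c, map_neg, brk_neg_right]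
    simp
  calc _ = ∑ c, ∑ d, ∑ a, ∑ b, (brk (R (bvec a b)) (R (bvec c d)) : Mat n) i j
      * (brk (bvec a b) (bvec c d) : Mat n) k l := by
        refine Eq.trans (Finset.sum_congr rfl fun a _ => Finset.sum_comm) ?_
        rw [Finset.sum_comm]
        refine Finset.sum_congr rfl fun c _ => ?_
        refine Eq.trans (Finset.sum_congr rfl fun a _ => Finset.sum_comm) ?_
        rw [Finset.sum_comm]
    _ = ∑ c, ∑ d, 2 * ∑ m, ((brk (R (bvec k m)) (R (bvec c d)) : Mat n) i j
          * (bvec c d : Mat n) m l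
        - (brk (R (bvec m l)) (R (bvec c d)) : Mat n) i j * (bvec c d : Mat n) k m) := by
        refine Finset.sum_congr rfl fun c _ => Finset.sum_congr rfl fun d _ => ?_
        exact sum_mul_brk_bvec (fun a b => (brk (R (bvec a b)) (R (bvec c d)) : Mat n) i j)
          (hF c d) _ k l
    _ = ∑ m, 2 * ∑ c, ∑ d, ((brk (R (bvec k m)) (R (bvec c d)) : Mat n) i j
          * (bvec c d : Mat n) m l
        - (brk (R (bvec m l)) (R (bvec c d)) : Mat n) i j * (bvec c d : Mat n) k m) := by
        simp only [Finset.mul_sum]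
        refine Eq.trans (Finset.sum_congr rfl fun a _ => Finset.sum_comm) ?_
        rw [Finset.sum_comm]
    _ = _ := by
        rw [Finset.mul_sum]
        refine Finset.sum_congr rfl fun m _ => ?_
        simp only [Finset.sum_sub_distrib]
        rw [sum_mul_bvec (fun c d => (brk (R (bvec k m)) (R (bvec c d)) : Mat n) i j) (hG k m),
          sum_mul_bvec (fun c d => (brk (R (bvec m l)) (R (bvec c d)) : Mat n) i j) (hG m l)]
        rw [brk_comm (R (bvec m l))]
        simp
        ring

lemma Rcoord_sharp_eq (R : Module.End ℝ (so n)) (i j k l : Fin n) :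
    Rcoord (sharp R R) i j k l = (1/16) * ∑ a, ∑ b, ∑ c, ∑ d,
      ((brk (R (bvec a b)) (R (bvec c d)) : Mat n) i j * (brk (bvec a b) (bvec c d) : Mat n) k l
      + (brk (bvec a b) (bvec c d) : Mat n) i j
        * (brk (R (bvec a b)) (R (bvec c d)) : Mat n) k l) := by
  have h : Rcoord (sharp R R) i j k l = (1/4) * ∑ p ∈ pairs n, ∑ q ∈ pairs n,
      ((brk (R (bvec p.1 p.2)) (R (bvec q.1 q.2)) : Mat n) i j
          * (brk (bvec p.1 p.2) (bvec q.1 q.2) : Mat n) k l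
      + (brk (bvec p.1 p.2) (bvec q.1 q.2) : Mat n) i j
        * (brk (R (bvec p.1 p.2)) (R (bvec q.1 q.2)) : Mat n) k l) := by
    rw [Rcoord_eq, sharp]
    simp only [LinearMap.smul_apply, LinearMap.sum_apply, LinearMap.add_apply,
      LinearMap.smulRight_apply, SetLike.val_smul, AddSubmonoidClass.coe_finsetSum,
      Matrix.smul_apply, Matrix.sum_apply, smul_eq_mul, Submodule.coe_add, Matrix.add_apply]
    simp only [ipL, LinearMap.coe_mk, AddHom.coe_mk, ip_bvec]
  have hs2 : ∀ X : so n, ∀ a b : Fin n, brk X (R (bvec a b)) = -brk X (R (bvec b a)) := by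
    intro X a b
    rw [bvec_swap b a, map_neg, brk_neg_right]
  have hs2' : ∀ X : so n, ∀ a b : Fin n, brk X (bvec a b) = -brk X (bvec b a) := by
    intro X a b
    rw [bvec_swap b a, brk_neg_right]
  have hs1 : ∀ X : so n, ∀ a b : Fin n, brk (R (bvec a b)) X = -brk (R (bvec b a)) X := by
    intro X a b
    rw [bvec_swap b a, map_neg, brk_neg_left]
  have hs1' : ∀ X : so n, ∀ a b : Fin n, brk (bvec a b) X = -brk (bvec b a) X := by
    intro X a b
    rw [bvec_swap b a, brk_neg_left]
  have z : ∀ X : so n, brk X 0 = 0 := fun X => by apply Subtype.ext; simp [brk]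
  have z' : ∀ X : so n, brk 0 X = 0 := fun X => by apply Subtype.ext; simp [brk]
  have e : ∀ a b, ∑ q ∈ pairs n,
      ((brk (R (bvec a b)) (R (bvec q.1 q.2)) : Mat n) i j
          * (brk (bvec a b) (bvec q.1 q.2) : Mat n) k l
      + (brk (bvec a b) (bvec q.1 q.2) : Mat n) i j
        * (brk (R (bvec a b)) (R (bvec q.1 q.2)) : Mat n) k l) = (1/2) * ∑ c, ∑ d,
      ((brk (R (bvec a b)) (R (bvec c d)) : Mat n) i j * (brk (bvec a b) (bvec c d) : Mat n) k l
      + (brk (bvec a b) (bvec c d) : Mat n) i j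
        * (brk (R (bvec a b)) (R (bvec c d)) : Mat n) k l) := by
    intro a b
    refine sum_pairs (fun c d => (brk (R (bvec a b)) (R (bvec c d)) : Mat n) i j
      * (brk (bvec a b) (bvec c d) : Mat n) k l
      + (brk (bvec a b) (bvec c d) : Mat n) i j
        * (brk (R (bvec a b)) (R (bvec c d)) : Mat n) k l) ?_ ?_
    · intro c d
      rw [hs2 _ c d, hs2' _ c d]
      simp
    · intro c
      simp [bvec_self, z]
  rw [h]
  simp only [e]
  rw [sum_pairs (fun a b => (1/2) * ∑ c, ∑ d,
      ((brk (R (bvec a b)) (R (bvec c d)) : Mat n) i j * (brk (bvec a b) (bvec c d) : Mat n) k l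
      + (brk (bvec a b) (bvec c d) : Mat n) i j
        * (brk (R (bvec a b)) (R (bvec c d)) : Mat n) k l))]
  · simp only [← Finset.mul_sum]
    ring
  · intro a b
    refine congrArg _ (Finset.sum_congr rfl fun c _ => Finset.sum_congr rfl fun d _ => ?_)
    rw [hs1 _ a b, hs1' _ a b]
    simp
  · intro a
    simp [bvec_self, z']

lemma Rcoord_sharp {R : Module.End ℝ (so n)} (hR : selfAdjEnd R) (i j k l : Fin n) :
    Rcoord (sharp R R) i j k l = ∑ p, ∑ q,
      (Rcoord R i p k q * Rcoord R j p l q - Rcoord R i p l q * Rcoord R j p k q) := by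
  rw [selfAdjEnd_iff] at hR
  have h1 : ∀ i j k l : Fin n, ∑ m, (brk (R (bvec k m)) (R (bvec m l)) : Mat n) i j = ∑ p, ∑ q,
      (Rcoord R i p k q * Rcoord R j p l q - Rcoord R i p l q * Rcoord R j p k q) := by
    intro i j k l
    simp only [brk_apply, ← Rcoord_eq]
    rw [Finset.sum_comm]
    refine Finset.sum_congr rfl fun p _ => Finset.sum_congr rfl fun q _ => ?_
    rw [hR k q i p, hR q l p j, hR q l i p, hR k q p j, Rcoord_swap_right R p j l q,
      Rcoord_swap_left R j p, Rcoord_swap_right R i p l q, Rcoord_swap_left R j p k q]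
    ring
  rw [Rcoord_sharp_eq]
  simp only [Finset.sum_add_distrib]
  rw [sum_brk_mul_brk R i j k l]
  have h3 : ∑ a, ∑ b, ∑ c, ∑ d, (brk (bvec a b) (bvec c d) : Mat n) i j
        * (brk (R (bvec a b)) (R (bvec c d)) : Mat n) k l =
      ∑ a, ∑ b, ∑ c, ∑ d, (brk (R (bvec a b)) (R (bvec c d)) : Mat n) k l
        * (brk (bvec a b) (bvec c d) : Mat n) i j := by
    refine Finset.sum_congr rfl fun a _ => Finset.sum_congr rfl fun b _ =>
        Finset.sum_congr rfl fun c _ => Finset.sum_congr rfl fun d _ => ?_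
    ring
  rw [h3, sum_brk_mul_brk R k l i j, h1, h1]
  have h4 : ∑ p, ∑ q,
      (Rcoord R k p i q * Rcoord R l p j q - Rcoord R k p j q * Rcoord R l p i q) = ∑ p, ∑ q,
      (Rcoord R i p k q * Rcoord R j p l q - Rcoord R i p l q * Rcoord R j p k q) := by
    rw [Finset.sum_comm]
    refine Finset.sum_congr rfl fun p _ => Finset.sum_congr rfl fun q _ => ?_
    rw [hR k q i p, hR l q j p, hR k q j p, hR l q i p]
    ring
  rw [h4]
  ring

lemma Rcoord_Qode {R : Module.End ℝ (so n)} (hR : selfAdjEnd R) (i j k l : Fin n) :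
    Rcoord (Qode R) i j k l = (1/2) * ∑ p, ∑ q, Rcoord R i j p q * Rcoord R p q k l + ∑ p, ∑ q,
      (Rcoord R i p k q * Rcoord R j p l q - Rcoord R i p l q * Rcoord R j p k q) := by
  rw [Qode, Rcoord_add, Rcoord_mul, Rcoord_sharp hR]

/-- The contraction `(R * A)_{ij} = Σ_{kl} R_{ikjl} A_{kl}`. -/
def contr (R : Module.End ℝ (so n)) (A : Mat n) : Mat n :=
  Matrix.of fun i j => ∑ k, ∑ l, Rcoord R i k j l * A k l

lemma contr_apply (R : Module.End ℝ (so n)) (A : Mat n) (i j : Fin n) :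
    contr R A i j = ∑ k, ∑ l, Rcoord R i k j l * A k l := rfl

lemma RicM_apply (R : Module.End ℝ (so n)) (i j : Fin n) :
    RicM R i j = ∑ k, Rcoord R i k j k := rfl

lemma selfAdjEnd.Rcoord_symm {R : Module.End ℝ (so n)} (hR : selfAdjEnd R) (i j k l : Fin n) :
    Rcoord R i j k l = Rcoord R k l i j := selfAdjEnd_iff.1 hR i j k l

lemma selfAdjEnd_Qode {R : Module.End ℝ (so n)} (hR : selfAdjEnd R) : selfAdjEnd (Qode R) := by
  rw [selfAdjEnd_iff]
  intro i j k l
  rw [Rcoord_Qode hR, Rcoord_Qode hR]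
  congr 1
  · congr 1
    refine Finset.sum_congr rfl fun p _ => Finset.sum_congr rfl fun q _ => ?_
    rw [hR.Rcoord_symm i j, hR.Rcoord_symm p q k l]
    ring
  · rw [Finset.sum_comm]
    refine Finset.sum_congr rfl fun p _ => Finset.sum_congr rfl fun q _ => ?_
    rw [hR.Rcoord_symm i q k p, hR.Rcoord_symm j q l p, hR.Rcoord_symm i q l p,
      hR.Rcoord_symm j q k p]
    ring

lemma Rcoord_Qode_eq_sum {R : Module.End ℝ (so n)} (hR : isCurvOp R) (i j k l : Fin n) :
    Rcoord (Qode R) i j k l = ∑ p, ∑ q, Rcoord R i p j q * Rcoord R k p l q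
      - ∑ p, ∑ q, Rcoord R i p j q * Rcoord R l p k q
      + ∑ p, ∑ q, Rcoord R i p k q * Rcoord R j p l q
      - ∑ p, ∑ q, Rcoord R i p l q * Rcoord R j p k q := by
  obtain ⟨h, hb⟩ := hR
  have e : ∀ i j p q, Rcoord R i j p q = Rcoord R i p j q - Rcoord R i q j p := by
    intro i j p q
    have := hb i j p q
    have h1 := Rcoord_swap_left R i p j q
    have h2 := h.Rcoord_symm j p i q
    have h3 := Rcoord_swap_right R i q j p
    linarith
  rw [Rcoord_Qode h]
  simp only [Finset.sum_sub_distrib]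
  have h1 : ∑ p, ∑ q, Rcoord R i j p q * Rcoord R p q k l =
      2 * (∑ p, ∑ q, Rcoord R i p j q * Rcoord R k p l q
      - ∑ p, ∑ q, Rcoord R i p j q * Rcoord R l p k q) := by
    have h2 : ∑ p, ∑ q, Rcoord R i j p q * Rcoord R p q k l =
        ∑ p, ∑ q, (Rcoord R i p j q * Rcoord R k p l q - Rcoord R i p j q * Rcoord R l p k q)
        + ∑ p, ∑ q, (Rcoord R i q j p * Rcoord R k q l p
          - Rcoord R i q j p * Rcoord R l q k p) := by
      simp only [← Finset.sum_add_distrib]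
      refine Finset.sum_congr rfl fun p _ => Finset.sum_congr rfl fun q _ => ?_
      rw [h.Rcoord_symm p q, e i j, e k l, h.Rcoord_symm k q l p, h.Rcoord_symm l q k p]
      ring
    rw [h2, Finset.sum_comm (γ := Fin n) (f := fun p q => Rcoord R i q j p * Rcoord R k q l p
          - Rcoord R i q j p * Rcoord R l q k p)]
    simp only [Finset.sum_sub_distrib]
    ring
  rw [h1]
  ring

lemma isCurvOp_Qode {R : Module.End ℝ (so n)} (hR : isCurvOp R) : isCurvOp (Qode R) := by
  refine ⟨selfAdjEnd_Qode hR.1, fun i j k l => ?_⟩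
  have s1 : ∀ i j k l, ∑ p, ∑ q, Rcoord R i p j q * Rcoord R k p l q
      = ∑ p, ∑ q, Rcoord R k p l q * Rcoord R i p j q := fun i j k l =>
    Finset.sum_congr rfl fun p _ => Finset.sum_congr rfl fun q _ => mul_comm _ _
  have s2 : ∀ i j k l, ∑ p, ∑ q, Rcoord R i p j q * Rcoord R k p l q
      = ∑ p, ∑ q, Rcoord R j p i q * Rcoord R l p k q := by
    intro i j k l
    rw [Finset.sum_comm]
    refine Finset.sum_congr rfl fun p _ => Finset.sum_congr rfl fun q _ => ?_
    rw [hR.1.Rcoord_symm i q, hR.1.Rcoord_symm k q]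
  simp only [Rcoord_Qode_eq_sum hR]
  linarith [s1 i j k l, s1 i j l k, s1 i k j l, s1 i l j k, s1 j k i l, s1 j k l i, s1 j i k l,
    s1 j l k i, s1 k i j l, s1 k i l j, s1 k j i l, s1 k l i j,
    s2 i j k l, s2 i j l k, s2 i k j l, s2 i l j k, s2 j k i l, s2 j k l i, s2 j i k l,
    s2 j l k i, s2 k i j l, s2 k i l j, s2 k j i l, s2 k l i j]

lemma RicM_Qode {R : Module.End ℝ (so n)} (hR : isCurvOp R) :
    RicM (Qode R) = contr R (RicM R) := by
  obtain ⟨h, hb⟩ := hR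
  ext i j
  simp only [RicM_apply, contr_apply, Rcoord_Qode h, Finset.sum_add_distrib,
    Finset.sum_sub_distrib]
  have h1 : ∑ k, ∑ p, ∑ q, Rcoord R i p j q * Rcoord R k p k q =
      ∑ p, ∑ q, Rcoord R i p j q * ∑ k, Rcoord R p k q k := by
    rw [Finset.sum_comm]
    refine Finset.sum_congr rfl fun p _ => ?_
    rw [Finset.sum_comm]
    refine Finset.sum_congr rfl fun q _ => ?_
    rw [Finset.mul_sum]
    refine Finset.sum_congr rfl fun k _ => ?_
    rw [Rcoord_swap_left R p k k q, Rcoord_swap_right R p k q k]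
    ring
  have hf : ∀ i j k l, Rcoord R i j k l + Rcoord R i k l j + Rcoord R i l j k = 0 := by
    intro i j k l
    have h1 := hb j k l i
    rw [h.Rcoord_symm j k, h.Rcoord_symm k l, h.Rcoord_symm l j, Rcoord_swap_left R i l,
      Rcoord_swap_left R i j, Rcoord_swap_left R i k] at h1
    linarith
  have h2 : ∑ k, ∑ p, ∑ q, Rcoord R i p k q * Rcoord R k p j q =
      ∑ k, ∑ p, ∑ q, Rcoord R i k p q * Rcoord R j k p q
      - ∑ k, ∑ p, ∑ q, Rcoord R i k p q * Rcoord R j p k q := by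
    rw [Finset.sum_comm]
    simp only [← Finset.sum_sub_distrib]
    refine Finset.sum_congr rfl fun k _ => Finset.sum_congr rfl fun p _ =>
      Finset.sum_congr rfl fun q _ => ?_
    rw [h.Rcoord_symm p k j q]
    have := hf j k p q
    rw [Rcoord_swap_right R j p k q] at this
    rw [show Rcoord R j q p k = Rcoord R j k p q - Rcoord R j p k q by
      rw [Rcoord_swap_right R j q k p]; linarith]
    ring
  have h3 : ∑ k, ∑ p, ∑ q, Rcoord R i k p q * Rcoord R j p k q =
      ∑ k, ∑ p, ∑ q, Rcoord R i p k q * Rcoord R k p j q := by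
    rw [Finset.sum_comm (γ := Fin n) (f := fun k p => ∑ q, Rcoord R i p k q * Rcoord R k p j q)]
    refine Finset.sum_congr rfl fun k _ => ?_
    rw [Finset.sum_comm]
    refine Finset.sum_congr rfl fun p _ => Finset.sum_congr rfl fun q _ => ?_
    rw [h.Rcoord_symm p k j q, Rcoord_swap_right R i k p q, Rcoord_swap_right R j q p k]
    ring
  have h4 : ∑ k, ∑ p, ∑ q, Rcoord R i k p q * Rcoord R p q j k =
      ∑ k, ∑ p, ∑ q, Rcoord R i k p q * Rcoord R j k p q := by
    refine Finset.sum_congr rfl fun k _ => Finset.sum_congr rfl fun p _ =>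
      Finset.sum_congr rfl fun q _ => ?_
    rw [h.Rcoord_symm p q]
  rw [← Finset.mul_sum, h4, h1]
  linarith

lemma sum_mul_wedge_one_left (A : Mat n) (f : Fin n → Fin n → ℝ) (hf : ∀ p q, f p q = -f q p)
    (k l : Fin n) : ∑ p, ∑ q, f p q * Rcoord (wedge A 1) p q k l =
      ∑ p, (f p l * A k p + f k p * A l p) := by
  have e : ∀ p q, f p q * Rcoord (wedge A 1) p q k l =
      (1/2) * (f p q * A k p * (1 : Mat n) l q) + (1/2) * (f p q * A l q * (1 : Mat n) k p)
      - (1/2) * (f p q * A k q * (1 : Mat n) l p) - (1/2) * (f p q * A l p * (1 : Mat n) k q) := by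
    intro p q
    rw [Rcoord_wedge]
    ring
  simp only [e, Matrix.one_apply, mul_ite, mul_one, mul_zero, Finset.sum_sub_distrib,
    Finset.sum_add_distrib, Finset.sum_ite_eq, Finset.mem_univ, if_true,
    Finset.sum_ite_irrel, Finset.sum_const_zero]
  simp only [← Finset.sum_sub_distrib, ← Finset.sum_add_distrib]
  refine Finset.sum_congr rfl fun p _ => ?_
  rw [hf l p, hf p k]
  ring

lemma sum_mul_wedge_one_mid (A : Mat n) (f : Fin n → Fin n → ℝ) (j l : Fin n) :
    ∑ p, ∑ q, f p q * Rcoord (wedge A 1) j p l q =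
      (1/2) * (A l j * ∑ p, f p p + (1 : Mat n) l j * (∑ p, ∑ q, f p q * A q p)
        - ∑ p, (f p j * A l p + f l p * A p j)) := by
  have e : ∀ p q, f p q * Rcoord (wedge A 1) j p l q =
      (1/2) * A l j * (f p q * (1 : Mat n) q p) + (1/2) * (1 : Mat n) l j * (f p q * A q p)
      - (1/2) * (f p q * A l p * (1 : Mat n) q j)
      - (1/2) * (f p q * A q j * (1 : Mat n) l p) := by
    intro p q
    rw [Rcoord_wedge]
    ring
  simp only [e, Finset.sum_sub_distrib, Finset.sum_add_distrib, ← Finset.mul_sum]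
  simp only [Matrix.one_apply, mul_ite, mul_one, mul_zero, 
    Finset.sum_ite_eq, Finset.sum_ite_eq', Finset.mem_univ, if_true,
    Finset.sum_ite_irrel, Finset.sum_const_zero]
  split_ifs <;> ring

lemma isCurvOp_wedge_one {A : Mat n} (hA : Aᵀ = A) : isCurvOp (wedge A 1) := by
  have h : ∀ i j, A i j = A j i := fun i j => congrFun (congrFun hA j) i
  have h1 : ∀ i j, (1 : Mat n) i j = (1 : Mat n) j i := fun i j => by
    simp [Matrix.one_apply, eq_comm]
  constructor
  · rw [selfAdjEnd_iff]
    intro i j k l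
    simp only [Rcoord_wedge]
    rw [h k i, h1 l j, h1 k i, h l j, h k j, h1 l i, h1 k j, h l i]
    ring
  · intro i j k l
    simp only [Rcoord_wedge]
    rw [h k i, h1 k i, h k j, h1 k j, h i j, h1 i j]
    ring

lemma Qode_add_wedge_one {R : Module.End ℝ (so n)} (hR : isCurvOp R) {A : Mat n} (hA : Aᵀ = A) :
    Qode (R + wedge A 1) = Qode R + Qode (wedge A 1) + wedge (RicM R) A
      + wedge (contr R A) 1 := by
  obtain ⟨h, hb⟩ := hR
  have hW := isCurvOp_wedge_one hA
  have hRW : selfAdjEnd (R + wedge A 1) := by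
    rw [selfAdjEnd_iff]
    intro i j k l
    rw [Rcoord_add, Rcoord_add, h.Rcoord_symm, hW.1.Rcoord_symm]
  have hAs : ∀ i j, A i j = A j i := fun i j => congrFun (congrFun hA j) i
  refine End_ext fun i j k l => ?_
  simp only [Rcoord_add, Rcoord_Qode hRW, Rcoord_Qode h, Rcoord_Qode hW.1]
  have e1 : ∑ p, ∑ q, (Rcoord R i j p q + Rcoord (wedge A 1) i j p q)
      * (Rcoord R p q k l + Rcoord (wedge A 1) p q k l) =
      ∑ p, ∑ q, Rcoord R i j p q * Rcoord R p q k l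
      + ∑ p, ∑ q, Rcoord (wedge A 1) i j p q * Rcoord (wedge A 1) p q k l
      + ∑ p, ∑ q, Rcoord R i j p q * Rcoord (wedge A 1) p q k l
      + ∑ p, ∑ q, Rcoord R p q k l * Rcoord (wedge A 1) p q i j := by
    simp only [← Finset.sum_add_distrib]
    refine Finset.sum_congr rfl fun p _ => Finset.sum_congr rfl fun q _ => ?_
    rw [hW.1.Rcoord_symm i j p q]
    ring
  have e2 : ∑ p, ∑ q, ((Rcoord R i p k q + Rcoord (wedge A 1) i p k q)
        * (Rcoord R j p l q + Rcoord (wedge A 1) j p l q)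
        - (Rcoord R i p l q + Rcoord (wedge A 1) i p l q)
        * (Rcoord R j p k q + Rcoord (wedge A 1) j p k q)) =
      ∑ p, ∑ q, (Rcoord R i p k q * Rcoord R j p l q - Rcoord R i p l q * Rcoord R j p k q)
      + ∑ p, ∑ q, (Rcoord (wedge A 1) i p k q * Rcoord (wedge A 1) j p l q
        - Rcoord (wedge A 1) i p l q * Rcoord (wedge A 1) j p k q)
      + (∑ p, ∑ q, Rcoord R i p k q * Rcoord (wedge A 1) j p l q
        + ∑ p, ∑ q, Rcoord R j p l q * Rcoord (wedge A 1) i p k q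
        - ∑ p, ∑ q, Rcoord R i p l q * Rcoord (wedge A 1) j p k q
        - ∑ p, ∑ q, Rcoord R j p k q * Rcoord (wedge A 1) i p l q) := by
    simp only [← Finset.sum_add_distrib, ← Finset.sum_sub_distrib]
    refine Finset.sum_congr rfl fun p _ => Finset.sum_congr rfl fun q _ => ?_
    ring
  rw [e1, e2, sum_mul_wedge_one_left A (fun p q => Rcoord R i j p q)
      (fun p q => Rcoord_swap_right R i j q p),
    sum_mul_wedge_one_left A (fun p q => Rcoord R p q k l) (fun p q => Rcoord_swap_left R q p k l),
    sum_mul_wedge_one_mid A (fun p q => Rcoord R i p k q),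
    sum_mul_wedge_one_mid A (fun p q => Rcoord R j p l q),
    sum_mul_wedge_one_mid A (fun p q => Rcoord R i p l q),
    sum_mul_wedge_one_mid A (fun p q => Rcoord R j p k q), Rcoord_wedge, Rcoord_wedge]
  have c : ∀ a b, ∑ p, ∑ q, Rcoord R a p b q * A q p = contr R A b a := by
    intro a b
    rw [contr_apply, Finset.sum_comm]
    refine Finset.sum_congr rfl fun p _ => Finset.sum_congr rfl fun q _ => ?_
    rw [h.Rcoord_symm]
  have cr : ∀ a b, ∑ p, Rcoord R a p b p = RicM R b a := by
    intro a b
    rw [RicM_apply]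
    refine Finset.sum_congr rfl fun p _ => ?_
    rw [h.Rcoord_symm]
  simp only [c, cr]
  have key : (1/2) * ∑ p, (Rcoord R i j p l * A k p + Rcoord R i j k p * A l p)
      + (1/2) * ∑ p, (Rcoord R p j k l * A i p + Rcoord R i p k l * A j p)
      - (1/2) * ∑ p, (Rcoord R i p k j * A l p + Rcoord R i l k p * A p j)
      - (1/2) * ∑ p, (Rcoord R j p l i * A k p + Rcoord R j k l p * A p i)
      + (1/2) * ∑ p, (Rcoord R i p l j * A k p + Rcoord R i k l p * A p j)
      + (1/2) * ∑ p, (Rcoord R j p k i * A l p + Rcoord R j l k p * A p i) = 0 := by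
    simp only [Finset.mul_sum, ← Finset.sum_add_distrib, ← Finset.sum_sub_distrib]
    refine Finset.sum_eq_zero fun p _ => ?_
    have b1 : Rcoord R i j p l - Rcoord R j p l i + Rcoord R i p l j = 0 := by
      have := hb i j p l
      linarith [Rcoord_swap_right R j p i l, Rcoord_swap_right R i p j l,
        Rcoord_swap_left R i p j l]
    have b2 : Rcoord R i j k p - Rcoord R i p k j + Rcoord R j p k i = 0 := by
      have := hb i j p k
      linarith [Rcoord_swap_right R i j k p, Rcoord_swap_right R j p k i,
        Rcoord_swap_right R i p k j, Rcoord_swap_left R i p j k]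
    have b3 : Rcoord R p j k l - Rcoord R j k l p + Rcoord R j l k p = 0 := by
      have := hb k l j p
      linarith [h.Rcoord_symm p j k l, Rcoord_swap_right R k l j p, Rcoord_swap_left R l j k p,
        Rcoord_swap_left R j k l p]
    have b4 : Rcoord R i p k l - Rcoord R i l k p + Rcoord R i k l p = 0 := by
      have := hb k l i p
      linarith [h.Rcoord_symm i p k l, Rcoord_swap_left R l i k p, Rcoord_swap_left R i k l p]
    rw [hAs p j, hAs p i]
    linear_combination (1/2) * A k p * b1 + (1/2) * A l p * b2 + (1/2) * A i p * b3
      + (1/2) * A j p * b4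
  have hRs : ∀ i j, RicM R i j = RicM R j i := by
    intro i j
    rw [← cr]; rfl
  have hCs : ∀ i j, contr R A i j = contr R A j i := by
    intro i j
    rw [← c]
    rw [contr_apply]
    refine Finset.sum_congr rfl fun p _ => Finset.sum_congr rfl fun q _ => ?_
    rw [hAs, h.Rcoord_symm]
  linear_combination key

lemma isCurvOp.add {R S : Module.End ℝ (so n)} (hR : isCurvOp R) (hS : isCurvOp S) :
    isCurvOp (R + S) := by
  refine ⟨selfAdjEnd_iff.2 fun i j k l => ?_, fun i j k l => ?_⟩
  · rw [Rcoord_add, Rcoord_add, hR.1.Rcoord_symm, hS.1.Rcoord_symm]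
  · simp only [Rcoord_add]
    linear_combination hR.2 i j k l + hS.2 i j k l

lemma isCurvOp.smul {R : Module.End ℝ (so n)} (hR : isCurvOp R) (c : ℝ) :
    isCurvOp (c • R) := by
  refine ⟨selfAdjEnd_iff.2 fun i j k l => ?_, fun i j k l => ?_⟩
  · rw [Rcoord_smul, Rcoord_smul, hR.1.Rcoord_symm]
  · simp only [Rcoord_smul]
    linear_combination c * hR.2 i j k l

lemma isCurvOp_wedge_self {A : Mat n} (hA : Aᵀ = A) : isCurvOp (wedge A A) := by
  have h : ∀ i j, A i j = A j i := fun i j => congrFun (congrFun hA j) i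
  refine ⟨selfAdjEnd_iff.2 fun i j k l => ?_, fun i j k l => ?_⟩
  · simp only [Rcoord_wedge]
    rw [h k i, h l j, h k j, h l i]
    ring
  · simp only [Rcoord_wedge]
    rw [h k i, h k j, h i j]
    ring

lemma wedge_add_left (A B C : Mat n) : wedge (A + B) C = wedge A C + wedge B C :=
  End_ext fun i j k l => by simp only [Rcoord_wedge, Rcoord_add, Matrix.add_apply]; ring

lemma wedge_smul_left (c : ℝ) (A C : Mat n) : wedge (c • A) C = c • wedge A C :=
  End_ext fun i j k l => by
    simp only [Rcoord_wedge, Rcoord_smul, Matrix.smul_apply, smul_eq_mul]; ring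

lemma RicM_add (R S : Module.End ℝ (so n)) : RicM (R + S) = RicM R + RicM S := by
  ext i j
  simp only [RicM_apply, Rcoord_add, Finset.sum_add_distrib, Matrix.add_apply]

lemma RicM_smul (c : ℝ) (R : Module.End ℝ (so n)) : RicM (c • R) = c • RicM R := by
  ext i j
  simp only [RicM_apply, Rcoord_smul, Matrix.smul_apply, Finset.mul_sum, smul_eq_mul]

lemma RicM_symm {R : Module.End ℝ (so n)} (hR : selfAdjEnd R) : (RicM R)ᵀ = RicM R := by
  ext i j
  rw [Matrix.transpose_apply, RicM_apply, RicM_apply]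
  exact Finset.sum_congr rfl fun k _ => hR.Rcoord_symm _ _ _ _

lemma RicM_wedge (A B : Mat n) (i j : Fin n) : RicM (wedge A B) i j =
    (1/2) * (B.trace * A j i + A.trace * B j i - (A * B) j i - (B * A) j i) := by
  simp only [RicM_apply, Rcoord_wedge, Matrix.mul_apply, Matrix.trace, Matrix.diag_apply,
    ← Finset.mul_sum, Finset.sum_sub_distrib, Finset.sum_add_distrib, ← Finset.sum_mul]
  ring

lemma trace_one_fin : (1 : Mat n).trace = n := by simp

lemma RicM_wedge_one {A : Mat n} (hA : Aᵀ = A) :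
    RicM (wedge A 1) = (1/2 : ℝ) • (A.trace • (1 : Mat n) + ((n : ℝ) - 2) • A) := by
  have h : ∀ i j, A i j = A j i := fun i j => congrFun (congrFun hA j) i
  ext i j
  rw [RicM_wedge, trace_one_fin]
  simp only [mul_one, one_mul, Matrix.smul_apply, Matrix.add_apply, smul_eq_mul]
  rw [h j i, Matrix.one_apply, Matrix.one_apply]
  simp only [eq_comm (a := j)]
  ring

lemma RicM_wedge_self {A : Mat n} (hA : Aᵀ = A) :
    RicM (wedge A A) = A.trace • A - A * A := by
  have h : ∀ i j, A i j = A j i := fun i j => congrFun (congrFun hA j) i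
  have h2 : (A * A)ᵀ = A * A := by rw [Matrix.transpose_mul, hA]
  ext i j
  rw [RicM_wedge]
  simp only [Matrix.smul_apply, Matrix.sub_apply, smul_eq_mul]
  rw [h j i, show (A * A) j i = (A * A) i j from congrFun (congrFun h2 i) j]
  ring

lemma contr_wedge_one {A : Mat n} (hA : Aᵀ = A) : contr (wedge A 1) A =
    (1/2 : ℝ) • (A.trace • A + (A * A).trace • (1 : Mat n) - (2 : ℝ) • (A * A)) := by
  have h : ∀ i j, A i j = A j i := fun i j => congrFun (congrFun hA j) i
  ext i j
  have e : ∀ k l, Rcoord (wedge A 1) i k j l * A k l = A k l * Rcoord (wedge A 1) i k j l :=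
    fun _ _ => mul_comm _ _
  rw [contr_apply]
  simp only [e]
  rw [sum_mul_wedge_one_mid A (fun k l => A k l)]
  simp only [Matrix.smul_apply, Matrix.sub_apply, Matrix.add_apply, smul_eq_mul,
    Matrix.mul_apply, Matrix.trace, Matrix.diag_apply]
  rw [h j i, Matrix.one_apply, Matrix.one_apply]
  simp only [eq_comm (a := j)]
  rw [show ∑ p, (A p i * A j p + A j p * A p i) = 2 * ∑ p, A i p * A p j by
    rw [Finset.mul_sum]
    refine Finset.sum_congr rfl fun p _ => ?_
    rw [h j p, h p i]; ring]
  ring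

lemma Qode_smul {R : Module.End ℝ (so n)} (hR : selfAdjEnd R) (c : ℝ) :
    Qode (c • R) = (c ^ 2) • Qode R := by
  have hc : selfAdjEnd (c • R) := by
    rw [selfAdjEnd_iff]
    intro i j k l
    rw [Rcoord_smul, Rcoord_smul, hR.Rcoord_symm]
  refine End_ext fun i j k l => ?_
  rw [Rcoord_smul, Rcoord_Qode hc, Rcoord_Qode hR]
  simp only [Rcoord_smul, mul_add, Finset.mul_sum]
  congr 1
  · refine Finset.sum_congr rfl fun p _ => Finset.sum_congr rfl fun q _ => by ring
  · refine Finset.sum_congr rfl fun p _ => Finset.sum_congr rfl fun q _ => by ring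

lemma Qode_wedge_one {A : Mat n} (hA : Aᵀ = A) : Qode (wedge A 1) =
    (1/4 : ℝ) • (((n : ℝ) - 2) • wedge A A + (2 * A.trace) • wedge A 1
      - (2 : ℝ) • wedge (A * A) 1 + (A * A).trace • wedge (1 : Mat n) 1) := by
  have hW := isCurvOp_wedge_one hA
  have h := Qode_add_wedge_one hW hA
  rw [← two_smul ℝ (wedge A 1), Qode_smul hW.1, RicM_wedge_one hA, contr_wedge_one hA] at h
  refine End_ext fun i j k l => ?_
  have h2 := congrArg (fun R => Rcoord R i j k l) h
  simp only [Rcoord_smul, Rcoord_add, Rcoord_sub, Rcoord_wedge, Matrix.smul_apply,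
    Matrix.add_apply, Matrix.sub_apply, smul_eq_mul] at h2 ⊢
  linarith

lemma Ric0_symm {R : Module.End ℝ (so n)} (hR : selfAdjEnd R) : (Ric0 R)ᵀ = Ric0 R := by
  rw [Ric0, Matrix.transpose_sub, RicM_symm hR, Matrix.transpose_smul, Matrix.transpose_one]

lemma RicM_eq (R : Module.End ℝ (so n)) : RicM R = Ric0 R + lamb R • (1 : Mat n) := by
  rw [Ric0, sub_add_cancel]

lemma trace_Ric0 (hn : 3 ≤ n) (R : Module.End ℝ (so n)) : (Ric0 R).trace = 0 := by
  have : (n : ℝ) ≠ 0 := by positivity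
  rw [Ric0, Matrix.trace_sub, Matrix.trace_smul, trace_one_fin, lamb, smul_eq_mul]
  field_simp
  ring

lemma trace_RicM (hn : 3 ≤ n) (R : Module.End ℝ (so n)) : (RicM R).trace = n * lamb R := by
  have : (n : ℝ) ≠ 0 := by positivity
  rw [lamb]
  field_simp

lemma trace_Ric0_sq (hn : 3 ≤ n) (R : Module.End ℝ (so n)) :
    (Ric0 R * Ric0 R).trace = n * sigmaR R := by
  have : (n : ℝ) ≠ 0 := by positivity
  rw [sigmaR]
  field_simp

lemma RicM_mul_self (R : Module.End ℝ (so n)) : RicM R * RicM R =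
    Ric0 R * Ric0 R + (2 * lamb R) • Ric0 R + (lamb R ^ 2) • (1 : Mat n) := by
  rw [RicM_eq]
  simp only [add_mul, mul_add, mul_one, one_mul, smul_mul_assoc, mul_smul_comm]
  module

lemma lamb_add (R S : Module.End ℝ (so n)) : lamb (R + S) = lamb R + lamb S := by
  rw [lamb, RicM_add, Matrix.trace_add, add_div]; rfl

lemma lamb_smul (c : ℝ) (R : Module.End ℝ (so n)) : lamb (c • R) = c * lamb R := by
  rw [lamb, RicM_smul, Matrix.trace_smul, smul_eq_mul, mul_div_assoc]; rfl

/-- The matrix `A` with `ℓ_{a,b}(R) = R + A ∧ id`. -/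
def labM (a b : ℝ) (R : Module.End ℝ (so n)) : Mat n :=
  (2 * b) • Ric0 R + (2 * a * lamb R) • (1 : Mat n)

lemma labM_symm {R : Module.End ℝ (so n)} (hR : selfAdjEnd R) (a b : ℝ) :
    (labM a b R)ᵀ = labM a b R := by
  simp only [labM, Matrix.transpose_add, Matrix.transpose_smul, Ric0_symm hR,
    Matrix.transpose_one]

lemma lab_eq (hn : 3 ≤ n) (a b : ℝ) (R : Module.End ℝ (so n)) :
    lab a b R = R + wedge (labM a b R) 1 := by
  have h3 : (3 : ℝ) ≤ n := by exact_mod_cast hn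
  have h1 : (n : ℝ) - 1 ≠ 0 := by linarith
  have h2 : (n : ℝ) - 2 ≠ 0 := by linarith
  rw [lab, RI, RRic0, labM, wedge_add_left, wedge_smul_left, wedge_smul_left, smul_smul,
    smul_smul]
  rw [show 2 * ((n : ℝ) - 1) * a * (lamb R / ((n : ℝ) - 1)) = 2 * a * lamb R by field_simp,
    show ((n : ℝ) - 2) * b * (2 / ((n : ℝ) - 2)) = 2 * b by field_simp]
  abel

lemma isCurvOp.lab (hn : 3 ≤ n) {R : Module.End ℝ (so n)} (hR : isCurvOp R) (a b : ℝ) :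
    isCurvOp (lab a b R) := by
  rw [lab_eq hn]
  exact hR.add (isCurvOp_wedge_one (labM_symm hR.1 a b))

lemma lab_add (hn : 3 ≤ n) (a b : ℝ) (R S : Module.End ℝ (so n)) :
    lab a b (R + S) = lab a b R + lab a b S := by
  simp only [lab_eq hn, labM, Ric0, RicM_add, lamb_add]
  refine End_ext fun i j k l => ?_
  simp only [Rcoord_add, Rcoord_wedge, Matrix.smul_apply,
    Matrix.add_apply, Matrix.sub_apply, smul_eq_mul]
  ring

lemma lab_smul (hn : 3 ≤ n) (a b c : ℝ) (R : Module.End ℝ (so n)) :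
    lab a b (c • R) = c • lab a b R := by
  simp only [lab_eq hn, labM, Ric0, RicM_smul, lamb_smul]
  refine End_ext fun i j k l => ?_
  simp only [Rcoord_smul, Rcoord_add, Rcoord_wedge, Matrix.smul_apply,
    Matrix.add_apply, Matrix.sub_apply, smul_eq_mul]
  ring

lemma trace_labM (hn : 3 ≤ n) (a b : ℝ) (R : Module.End ℝ (so n)) :
    (labM a b R).trace = n * (2 * a * lamb R) := by
  rw [labM, Matrix.trace_add, Matrix.trace_smul, Matrix.trace_smul, trace_Ric0 hn, trace_one_fin]
  simp
  ring

lemma RicM_lab (hn : 3 ≤ n) {R : Module.End ℝ (so n)} (hR : selfAdjEnd R) (a b : ℝ) :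
    RicM (lab a b R) = (1 + ((n : ℝ) - 2) * b) • Ric0 R
      + ((1 + 2 * ((n : ℝ) - 1) * a) * lamb R) • (1 : Mat n) := by
  rw [lab_eq hn, RicM_add, RicM_wedge_one (labM_symm hR a b), trace_labM hn, RicM_eq, labM]
  module

lemma lamb_lab (hn : 3 ≤ n) {R : Module.End ℝ (so n)} (hR : selfAdjEnd R) (a b : ℝ) :
    lamb (lab a b R) = (1 + 2 * ((n : ℝ) - 1) * a) * lamb R := by
  have : (n : ℝ) ≠ 0 := by positivity
  rw [lamb, RicM_lab hn hR, Matrix.trace_add, Matrix.trace_smul, Matrix.trace_smul, trace_Ric0 hn,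
    trace_one_fin]
  simp
  field_simp

lemma Ric0_lab (hn : 3 ≤ n) {R : Module.End ℝ (so n)} (hR : selfAdjEnd R) (a b : ℝ) :
    Ric0 (lab a b R) = (1 + ((n : ℝ) - 2) * b) • Ric0 R := by
  rw [Ric0, lamb_lab hn hR, RicM_lab hn hR, add_sub_cancel_right]

lemma lab_lab (hn : 3 ≤ n) {R : Module.End ℝ (so n)} (hR : selfAdjEnd R) {a b a' b' : ℝ}
    (ha : (1 + 2 * ((n : ℝ) - 1) * a') * (1 + 2 * ((n : ℝ) - 1) * a) = 1)
    (hb : (1 + ((n : ℝ) - 2) * b') * (1 + ((n : ℝ) - 2) * b) = 1) :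
    lab a' b' (lab a b R) = R := by
  have h3 : (3 : ℝ) ≤ n := by exact_mod_cast hn
  have ha2 : a' * (1 + 2 * ((n : ℝ) - 1) * a) + a = 0 := by
    have h1 : (n : ℝ) - 1 ≠ 0 := by linarith
    have : ((n : ℝ) - 1) * (a' * (1 + 2 * ((n : ℝ) - 1) * a) + a) = 0 := by linarith
    exact (mul_eq_zero.1 this).resolve_left h1
  have hb2 : b' * (1 + ((n : ℝ) - 2) * b) + b = 0 := by
    have h1 : (n : ℝ) - 2 ≠ 0 := by linarith
    have : ((n : ℝ) - 2) * (b' * (1 + ((n : ℝ) - 2) * b) + b) = 0 := by linarith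
    exact (mul_eq_zero.1 this).resolve_left h1
  rw [lab_eq hn a' b', labM, Ric0_lab hn hR, lamb_lab hn hR, lab_eq hn a b, labM, smul_smul]
  have : wedge ((2 * b) • Ric0 R + (2 * a * lamb R) • (1 : Mat n)) 1
      + wedge ((2 * b' * (1 + ((n : ℝ) - 2) * b)) • Ric0 R
        + (2 * a' * ((1 + 2 * ((n : ℝ) - 1) * a) * lamb R)) • (1 : Mat n)) 1 = 0 := by
    rw [← wedge_add_left]
    have : (2 * b) • Ric0 R + (2 * a * lamb R) • (1 : Mat n)
      + ((2 * b' * (1 + ((n : ℝ) - 2) * b)) • Ric0 R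
        + (2 * a' * ((1 + 2 * ((n : ℝ) - 1) * a) * lamb R)) • (1 : Mat n)) =
        (2 * (b' * (1 + ((n : ℝ) - 2) * b) + b)) • Ric0 R
        + (2 * (a' * (1 + 2 * ((n : ℝ) - 1) * a) + a) * lamb R) • (1 : Mat n) := by module
    rw [this, ha2, hb2]
    refine End_ext fun i j k l => ?_
    simp [Rcoord_wedge, Rcoord_zero]
  rw [add_assoc, this, add_zero]

lemma contr_one {R : Module.End ℝ (so n)} : contr R 1 = RicM R := by
  ext i j
  simp [contr_apply, RicM_apply, Matrix.one_apply]

lemma contr_add (R : Module.End ℝ (so n)) (A B : Mat n) :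
    contr R (A + B) = contr R A + contr R B := by
  ext i j
  simp only [contr_apply, Matrix.add_apply, mul_add, Finset.sum_add_distrib]

lemma contr_smul (R : Module.End ℝ (so n)) (c : ℝ) (A : Mat n) :
    contr R (c • A) = c • contr R A := by
  ext i j
  simp only [contr_apply, Matrix.smul_apply, smul_eq_mul, Finset.mul_sum]
  exact Finset.sum_congr rfl fun p _ => Finset.sum_congr rfl fun q _ => by ring

lemma trace_contr {R : Module.End ℝ (so n)} (A : Mat n) (hA : Aᵀ = A) :
    (contr R A).trace = (RicM R * A).trace := by
  simp only [Matrix.trace, Matrix.diag_apply, contr_apply, RicM_apply, Matrix.mul_apply,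
    Finset.sum_mul]
  rw [Finset.sum_comm]
  refine Finset.sum_congr rfl fun k _ => ?_
  rw [Finset.sum_comm]
  refine Finset.sum_congr rfl fun l _ => Finset.sum_congr rfl fun i _ => ?_
  rw [Rcoord_swap_left R k i, Rcoord_swap_right R k i l i, show A l k = A k l from
    congrFun (congrFun hA k) l]
  ring

/-- The correction term in `Q(ℓ_{a,b}(R)) = ℓ_{a,b}(Q(R) + D)`. -/
def Dop (c a b g : ℝ) (R : Module.End ℝ (so n)) : Module.End ℝ (so n) :=
  c • wedge (Ric0 R) (Ric0 R) + (2 * a) • wedge (RicM R) (RicM R)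
    + (2 * b ^ 2) • wedge (Ric0 R * Ric0 R) 1 + g • wedge (1 : Mat n) 1

lemma Ric0_sq_symm {R : Module.End ℝ (so n)} (hR : selfAdjEnd R) :
    (Ric0 R * Ric0 R)ᵀ = Ric0 R * Ric0 R := by
  rw [Matrix.transpose_mul, Ric0_symm hR]

lemma isCurvOp_Dop {R : Module.End ℝ (so n)} (hR : selfAdjEnd R) (c a b g : ℝ) :
    isCurvOp (Dop c a b g R) :=
  ((((isCurvOp_wedge_self (Ric0_symm hR)).smul _).add
    ((isCurvOp_wedge_self (RicM_symm hR)).smul _)).add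
    ((isCurvOp_wedge_one (Ric0_sq_symm hR)).smul _)).add
    ((isCurvOp_wedge_one Matrix.transpose_one).smul _)

lemma RicM_Dop (hn : 3 ≤ n) {R : Module.End ℝ (so n)} (hR : selfAdjEnd R) (a b g : ℝ) :
    RicM (Dop (((n : ℝ) - 2) * b ^ 2 - 2 * (a - b)) a b g R) =
      (-2 * b) • (Ric0 R * Ric0 R) + (2 * a * lamb R * ((n : ℝ) - 2)) • Ric0 R
      + (2 * a * ((n : ℝ) - 1) * lamb R ^ 2 + n * b ^ 2 * sigmaR R + ((n : ℝ) - 1) * g)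
        • (1 : Mat n) := by
  simp only [Dop, RicM_add, RicM_smul, RicM_wedge_self (Ric0_symm hR),
    RicM_wedge_self (RicM_symm hR), RicM_wedge_one (Ric0_sq_symm hR),
    RicM_wedge_one (Matrix.transpose_one (α := ℝ) (n := Fin n)), trace_Ric0 hn, trace_RicM hn,
    trace_Ric0_sq hn, RicM_mul_self, trace_one_fin]
  rw [RicM_eq]
  module

lemma lamb_Dop (hn : 3 ≤ n) {R : Module.End ℝ (so n)} (hR : selfAdjEnd R) (a b g : ℝ) :
    lamb (Dop (((n : ℝ) - 2) * b ^ 2 - 2 * (a - b)) a b g R) =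
      -2 * b * sigmaR R + 2 * a * ((n : ℝ) - 1) * lamb R ^ 2 + n * b ^ 2 * sigmaR R
        + ((n : ℝ) - 1) * g := by
  have : (n : ℝ) ≠ 0 := by positivity
  rw [lamb, RicM_Dop hn hR]
  simp only [Matrix.trace_add, Matrix.trace_smul, trace_Ric0 hn, trace_Ric0_sq hn, trace_one_fin,
    smul_eq_mul]
  field_simp
  ring

lemma lamb_Qode (hn : 3 ≤ n) {R : Module.End ℝ (so n)} (hR : isCurvOp R) :
    lamb (Qode R) = lamb R ^ 2 + sigmaR R := by
  have : (n : ℝ) ≠ 0 := by positivity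
  rw [lamb, RicM_Qode hR, trace_contr _ (RicM_symm hR.1), RicM_mul_self]
  simp only [Matrix.trace_add, Matrix.trace_smul, trace_Ric0 hn, trace_Ric0_sq hn, trace_one_fin,
    smul_eq_mul]
  field_simp
  ring

lemma Qode_lab (hn : 3 ≤ n) {R : Module.End ℝ (so n)} (hR : isCurvOp R) {a b g : ℝ}
    (hg : g * (1 + 2 * ((n : ℝ) - 1) * a) =
      (n * b ^ 2 * (1 - 2 * b) - 2 * (a - b) * (1 - 2 * b + n * b ^ 2)) * sigmaR R) :
    Qode (lab a b R) =
      lab a b (Qode R + Dop (((n : ℝ) - 2) * b ^ 2 - 2 * (a - b)) a b g R) := by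
  have hA := labM_symm hR.1 a b
  have hAA : labM a b R * labM a b R = (4 * b ^ 2) • (Ric0 R * Ric0 R)
      + (8 * a * b * lamb R) • Ric0 R + (4 * a ^ 2 * lamb R ^ 2) • (1 : Mat n) := by
    rw [labM]
    simp only [add_mul, mul_add, mul_one, one_mul, smul_mul_assoc, mul_smul_comm]
    module
  have hAt : (labM a b R * labM a b R).trace =
      4 * b ^ 2 * (n * sigmaR R) + 4 * a ^ 2 * lamb R ^ 2 * n := by
    rw [hAA]
    simp only [Matrix.trace_add, Matrix.trace_smul, trace_Ric0 hn, trace_Ric0_sq hn,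
      trace_one_fin, smul_eq_mul]
    ring
  have hC : contr R (labM a b R) = (2 * b) • contr R (RicM R)
      + (2 * a * lamb R - 2 * b * lamb R) • RicM R := by
    rw [labM, contr_add, contr_smul, contr_smul, contr_one]
    have e : contr R (RicM R) = contr R (Ric0 R) + lamb R • RicM R := by
      conv_lhs => rw [RicM_eq R, contr_add, contr_smul, contr_one]
    rw [e]
    module
  rw [lab_eq hn a b R, Qode_add_wedge_one hR hA, Qode_wedge_one hA, trace_labM hn, hAt, hAA, hC,
    lab_eq hn, labM, labM, Ric0.eq_1 (Qode R + _), lamb_add, lamb_Qode hn hR, lamb_Dop hn hR.1, RicM_add,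
    RicM_Qode hR, RicM_Dop hn hR.1, Dop]
  rw [RicM_eq R]
  generalize contr R (Ric0 R + lamb R • (1 : Mat n)) = P
  refine End_ext fun i j k l => ?_
  simp only [Rcoord_smul, Rcoord_add, Rcoord_sub, Rcoord_wedge, Matrix.smul_apply,
    Matrix.add_apply, Matrix.sub_apply, smul_eq_mul]
  linear_combination (-1 : ℝ) * ((1 : Mat n) k i * (1 : Mat n) l j
    - (1 : Mat n) k j * (1 : Mat n) l i) * hg

/-- The skew part `M - Mᵀ` as an element of `so n`. -/
def skew (M : Mat n) : so n :=
  ⟨M - Mᵀ, by rw [mem_so_iff, Matrix.transpose_sub, Matrix.transpose_transpose, neg_sub]⟩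

lemma skew_apply (M : Mat n) (i j : Fin n) : (skew M : Mat n) i j = M i j - M j i := rfl

lemma sum_skew_mul (M : Mat n) (f : Fin n → Fin n → ℝ) (hf : ∀ i j, f i j = -f j i) :
    ∑ i, ∑ j, (skew M : Mat n) i j * f i j = 2 * ∑ i, ∑ j, M i j * f i j := by
  simp only [skew_apply, sub_mul, Finset.sum_sub_distrib]
  rw [Finset.sum_comm (f := fun i j => M j i * f i j)]
  have : ∑ i, ∑ j, M i j * f j i = -∑ i, ∑ j, M i j * f i j := by
    simp only [← Finset.sum_neg_distrib]
    refine Finset.sum_congr rfl fun i _ => Finset.sum_congr rfl fun j _ => ?_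
    rw [hf i j]; ring
  rw [this]
  ring

lemma sum_mul_Rcoord (R : Module.End ℝ (so n)) (M N : Mat n) :
    ∑ i, ∑ j, ∑ k, ∑ l, M i j * N k l * Rcoord R i j k l = ip (R (skew M)) (skew N) := by
  rw [ip_apply_eq_sum]
  have h1 : ∀ i j, ∑ k, ∑ l, (skew M : Mat n) i j * (skew N : Mat n) k l * Rcoord R i j k l =
      (skew M : Mat n) i j * (2 * ∑ k, ∑ l, N k l * Rcoord R i j k l) := by
    intro i j
    rw [← sum_skew_mul N (fun k l => Rcoord R i j k l) fun k l => Rcoord_swap_right R i j l k]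
    simp only [Finset.mul_sum, mul_assoc]
  simp only [h1]
  rw [sum_skew_mul M (fun i j => 2 * ∑ k, ∑ l, N k l * Rcoord R i j k l)]
  · simp only [Finset.mul_sum]
    refine Finset.sum_congr rfl fun i _ => Finset.sum_congr rfl fun j _ =>
      Finset.sum_congr rfl fun k _ => Finset.sum_congr rfl fun l _ => ?_
    ring
  · intro i j
    simp only [Rcoord_swap_left R j i, mul_neg, Finset.sum_neg_distrib]

/-- The rank one endomorphism `Z ↦ ⟨U, Z⟩ V`. -/
def rk (U V : so n) : Module.End ℝ (so n) := (ipL U).smulRight V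

lemma ip_rk (U V Z W : so n) : ip (rk U V Z) W = ip U Z * ip V W := by
  rw [rk, LinearMap.smulRight_apply, ip_smul_left]
  rfl

lemma Rcoord_rk (U V : so n) (i j k l : Fin n) :
    Rcoord (rk U V) i j k l = (U : Mat n) i j * (V : Mat n) k l := by
  rw [Rcoord, ip_rk, ip_bvec, ip_bvec]

/-- The polarised form of `X ↦ ⟨R^# X, X⟩`. -/
def sharpForm (R S : Module.End ℝ (so n)) (X : so n) : ℝ :=
  (1/2) * ∑ i, ∑ p, ∑ k, ∑ q, Rcoord R i p k q *
    ∑ j, ∑ l, (X : Mat n) i j * (X : Mat n) k l * Rcoord S j p l q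

lemma sharpForm_add_left (R R' S : Module.End ℝ (so n)) (X : so n) :
    sharpForm (R + R') S X = sharpForm R S X + sharpForm R' S X := by
  simp only [sharpForm, Rcoord_add, add_mul, Finset.sum_add_distrib, mul_add]

lemma sharpForm_smul_left (c : ℝ) (R S : Module.End ℝ (so n)) (X : so n) :
    sharpForm (c • R) S X = c * sharpForm R S X := by
  simp only [sharpForm, Rcoord_smul, mul_assoc, ← Finset.mul_sum]
  ring

lemma sharpForm_comm (R S : Module.End ℝ (so n)) (X : so n) :
    sharpForm R S X = sharpForm S R X := by
  simp only [sharpForm, Finset.mul_sum]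
  have key : ∀ f : Fin n → Fin n → Fin n → Fin n → Fin n → Fin n → ℝ,
      ∑ i, ∑ p, ∑ k, ∑ q, ∑ j, ∑ l, f i p k q j l =
      ∑ i, ∑ p, ∑ k, ∑ q, ∑ j, ∑ l, f j p l q i k := by
    intro f
    have h : ∀ g : Fin n → Fin n → Fin n → Fin n → Fin n → Fin n → ℝ,
        ∑ i, ∑ p, ∑ k, ∑ q, ∑ j, ∑ l, g i p k q j l =
        ∑ p, ∑ q, ∑ i, ∑ j, ∑ k, ∑ l, g i p k q j l := by
      intro g
      rw [Finset.sum_comm]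
      refine Finset.sum_congr rfl fun p _ => ?_
      refine Eq.trans (Finset.sum_congr rfl fun i _ => Finset.sum_comm) ?_
      rw [Finset.sum_comm]
      refine Finset.sum_congr rfl fun q _ => Finset.sum_congr rfl fun i _ => ?_
      rw [Finset.sum_comm]
    refine (h f).trans (Eq.trans ?_ (h fun i p k q j l => f j p l q i k).symm)
    refine Finset.sum_congr rfl fun p _ => Finset.sum_congr rfl fun q _ => ?_
    rw [Finset.sum_comm]
    refine Finset.sum_congr rfl fun j _ => Finset.sum_congr rfl fun i _ => ?_
    rw [Finset.sum_comm]
  rw [key]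
  refine Finset.sum_congr rfl fun i _ => Finset.sum_congr rfl fun p _ =>
    Finset.sum_congr rfl fun k _ => Finset.sum_congr rfl fun q _ =>
    Finset.sum_congr rfl fun j _ => Finset.sum_congr rfl fun l _ => ?_
  rw [so_apply_swap X j i, so_apply_swap X l k]
  ring

lemma ip_sharp {R : Module.End ℝ (so n)} (hR : selfAdjEnd R) (X : so n) :
    ip (sharp R R X) X = sharpForm R R X := by
  rw [ip_apply_eq_sum]
  simp only [Rcoord_sharp hR]
  have e1 : ∑ i, ∑ j, ∑ k, ∑ l, (X : Mat n) i j * (X : Mat n) k l * ∑ p, ∑ q,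
      (Rcoord R i p k q * Rcoord R j p l q - Rcoord R i p l q * Rcoord R j p k q) =
      ∑ i, ∑ j, ∑ k, ∑ l, (X : Mat n) i j * (X : Mat n) k l *
        ∑ p, ∑ q, Rcoord R i p k q * Rcoord R j p l q
      - ∑ i, ∑ j, ∑ k, ∑ l, (X : Mat n) i j * (X : Mat n) k l *
        ∑ p, ∑ q, Rcoord R i p l q * Rcoord R j p k q := by
    simp only [Finset.sum_sub_distrib, mul_sub]
  have e2 : ∑ i, ∑ j, ∑ k, ∑ l, (X : Mat n) i j * (X : Mat n) k l *
        ∑ p, ∑ q, Rcoord R i p l q * Rcoord R j p k q =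
      -∑ i, ∑ j, ∑ k, ∑ l, (X : Mat n) i j * (X : Mat n) k l *
        ∑ p, ∑ q, Rcoord R i p k q * Rcoord R j p l q := by
    simp only [← Finset.sum_neg_distrib]
    refine Finset.sum_congr rfl fun i _ => Finset.sum_congr rfl fun j _ => ?_
    rw [Finset.sum_comm]
    refine Finset.sum_congr rfl fun l _ => Finset.sum_congr rfl fun k _ => ?_
    rw [so_apply_swap X k l]
    simp
  have e3 : ∑ i, ∑ j, ∑ k, ∑ l, (X : Mat n) i j * (X : Mat n) k l *
        ∑ p, ∑ q, Rcoord R i p k q * Rcoord R j p l q =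
      ∑ i, ∑ p, ∑ k, ∑ q, Rcoord R i p k q *
    ∑ j, ∑ l, (X : Mat n) i j * (X : Mat n) k l * Rcoord R j p l q := by
    refine Finset.sum_congr rfl fun i _ => ?_
    have : ∀ g : Fin n → Fin n → Fin n → Fin n → Fin n → ℝ,
        ∑ j, ∑ k, ∑ l, ∑ p, ∑ q, g j k l p q = ∑ p, ∑ k, ∑ q, ∑ j, ∑ l, g j k l p q := by
      intro g
      calc _ = ∑ k, ∑ j, ∑ p, ∑ q, ∑ l, g j k l p q := by
            rw [Finset.sum_comm]
            refine Finset.sum_congr rfl fun k _ => Finset.sum_congr rfl fun j _ => ?_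
            rw [Finset.sum_comm]
            exact Finset.sum_congr rfl fun k _ => Finset.sum_comm
        _ = ∑ k, ∑ p, ∑ q, ∑ j, ∑ l, g j k l p q := by
            refine Finset.sum_congr rfl fun k _ => ?_
            rw [Finset.sum_comm]
            exact Finset.sum_congr rfl fun k _ => Finset.sum_comm
        _ = _ := Finset.sum_comm
    simp only [Finset.mul_sum]
    rw [this]
    refine Finset.sum_congr rfl fun p _ =>
      Finset.sum_congr rfl fun k _ => Finset.sum_congr rfl fun q _ =>
      Finset.sum_congr rfl fun j _ => Finset.sum_congr rfl fun l _ => ?_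
    ring
  rw [e1, e2, e3, sharpForm]
  ring

lemma sharpForm_kernel (S : Module.End ℝ (so n)) (X : so n) (B C : Mat n) :
    ∑ i, ∑ p, ∑ k, ∑ q, B i p * C k q *
      ∑ j, ∑ l, (X : Mat n) i j * (X : Mat n) k l * Rcoord S j p l q =
    ip (S (skew ((X : Mat n)ᵀ * B))) (skew ((X : Mat n)ᵀ * C)) := by
  rw [← sum_mul_Rcoord]
  simp only [Matrix.mul_apply, Matrix.transpose_apply, Finset.mul_sum, Finset.sum_mul]
  have : ∀ g : Fin n → Fin n → Fin n → Fin n → Fin n → Fin n → ℝ,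
      ∑ i, ∑ p, ∑ k, ∑ q, ∑ j, ∑ l, g i p k q j l =
      ∑ j, ∑ p, ∑ l, ∑ q, ∑ k, ∑ i, g i p k q j l := by
    intro g
    calc _ = ∑ p, ∑ i, ∑ j, ∑ k, ∑ q, ∑ l, g i p k q j l := by
          rw [Finset.sum_comm]
          refine Finset.sum_congr rfl fun p _ => Finset.sum_congr rfl fun i _ => ?_
          refine Eq.trans (Finset.sum_congr rfl fun k _ => Finset.sum_comm) ?_
          rw [Finset.sum_comm]
      _ = ∑ p, ∑ j, ∑ i, ∑ k, ∑ l, ∑ q, g i p k q j l := by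
          refine Finset.sum_congr rfl fun p _ => ?_
          rw [Finset.sum_comm]
          exact Finset.sum_congr rfl fun j _ => Finset.sum_congr rfl fun i _ =>
            Finset.sum_congr rfl fun k _ => Finset.sum_comm
      _ = ∑ p, ∑ j, ∑ l, ∑ i, ∑ k, ∑ q, g i p k q j l := by
          refine Finset.sum_congr rfl fun p _ => Finset.sum_congr rfl fun j _ => ?_
          refine Eq.trans (Finset.sum_congr rfl fun k _ => Finset.sum_comm) ?_
          rw [Finset.sum_comm]
      _ = ∑ p, ∑ j, ∑ l, ∑ q, ∑ k, ∑ i, g i p k q j l := by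
          refine Finset.sum_congr rfl fun p _ => Finset.sum_congr rfl fun j _ =>
            Finset.sum_congr rfl fun l _ => ?_
          refine Eq.trans (Finset.sum_congr rfl fun k _ => Finset.sum_comm) ?_
          rw [Finset.sum_comm]
          exact Finset.sum_congr rfl fun q _ => Finset.sum_comm
      _ = _ := Finset.sum_comm
  rw [this]
  refine Finset.sum_congr rfl fun j _ => Finset.sum_congr rfl fun p _ =>
    Finset.sum_congr rfl fun l _ => Finset.sum_congr rfl fun q _ =>
    Finset.sum_congr rfl fun k _ => Finset.sum_congr rfl fun i _ => ?_
  ring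

lemma sharpForm_rk (U V : so n) (S : Module.End ℝ (so n)) (X : so n) :
    sharpForm (rk U V) S X = (1/2) * ip (S (brk X U)) (brk X V) := by
  have h : ∀ U : so n, skew ((X : Mat n)ᵀ * (U : Mat n)) = -brk X U := by
    intro U
    apply Subtype.ext
    have hX : (X : Mat n)ᵀ = -(X : Mat n) := X.2
    have hU : (U : Mat n)ᵀ = -(U : Mat n) := U.2
    simp only [skew, brk, Matrix.transpose_mul, Matrix.transpose_transpose, hU,
      NegMemClass.coe_neg]
    rw [hX]
    noncomm_ring
  rw [sharpForm]
  simp only [Rcoord_rk]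
  rw [sharpForm_kernel, h, h, map_neg]
  congr 1
  simp [ip]

lemma exists_gram_of_posSemidef {ι : Type*} [Fintype ι] [DecidableEq ι] {M : Matrix ι ι ℝ}
    (hs : ∀ i j, M i j = M j i) (hp : ∀ v : ι → ℝ, 0 ≤ ∑ i, ∑ j, v i * v j * M i j) :
    ∃ (m : ℕ) (B : Fin m → ι → ℝ), ∀ i j, M i j = ∑ t, B t i * B t j := by
  have hM : M.PosSemidef := by
    refine Matrix.PosSemidef.of_dotProduct_mulVec_nonneg ?_ fun v => ?_
    · ext i j
      simp [hs j i]
    · refine (hp v).trans_eq ?_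
      simp only [dotProduct, Matrix.mulVec, Finset.mul_sum, Pi.star_apply, star_trivial]
      exact Finset.sum_congr rfl fun i _ => Finset.sum_congr rfl fun j _ => by ring
  obtain ⟨m, B, hB⟩ := Matrix.posSemidef_iff_eq_sum_vecMulVec.mp hM
  refine ⟨m, B, fun i j => ?_⟩
  rw [hB]
  simp [Matrix.sum_apply, Matrix.vecMulVec_apply]

lemma sharpForm_nonneg {R S : Module.End ℝ (so n)} (hR : selfAdjEnd R) (hRp : posSemidefEnd R)
    (hS : posSemidefEnd S) (X : so n) : 0 ≤ sharpForm R S X := by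
  obtain ⟨m, B, hB⟩ := exists_gram_of_posSemidef (ι := Fin n × Fin n)
    (M := Matrix.of fun x y => Rcoord R x.1 x.2 y.1 y.2) (fun x y => hR.Rcoord_symm _ _ _ _) (by
      intro v
      have := hRp (skew (Matrix.of fun i j => v (i, j)))
      rw [← sum_mul_Rcoord] at this
      simpa only [Fintype.sum_prod_type, Matrix.of_apply] using this)
  simp only [Matrix.of_apply] at hB
  have hB' : ∀ i p k q, Rcoord R i p k q = ∑ t, B t (i, p) * B t (k, q) :=
    fun i p k q => hB (i, p) (k, q)
  have : sharpForm R S X = (1/2) * ∑ t,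
      ip (S (skew ((X : Mat n)ᵀ * Matrix.of fun i p => B t (i, p))))
        (skew ((X : Mat n)ᵀ * Matrix.of fun i p => B t (i, p))) := by
    simp only [← sharpForm_kernel, sharpForm, hB', Finset.sum_mul]
    congr 1
    have push : ∀ g : Fin n → Fin m → ℝ,
        ∑ i, ∑ t, g i t = ∑ t, ∑ i, g i t := fun g => Finset.sum_comm
    simp only [Matrix.of_apply, push]
  rw [this]
  have := Finset.sum_nonneg fun t (_ : t ∈ Finset.univ) =>
    hS (skew ((X : Mat n)ᵀ * Matrix.of fun i p => B t (i, p)))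
  linarith

lemma ip_Qode {R : Module.End ℝ (so n)} (hR : selfAdjEnd R) (X : so n) :
    ip (Qode R X) X = ip (R X) (R X) + sharpForm R R X := by
  rw [← ip_sharp hR, Qode, LinearMap.add_apply, ip_add_left, Module.End.mul_apply, hR]

lemma eq_zero_of_forall_quadratic_nonneg {α β : ℝ} (h : ∀ t : ℝ, 0 ≤ α * t ^ 2 + 2 * β * t) :
    β = 0 := by
  have h1 := h (-β / (α ^ 2 + 1))
  have hp : (0 : ℝ) < α ^ 2 + 1 := by positivity
  have h2 : α * (-β / (α ^ 2 + 1)) ^ 2 + 2 * β * (-β / (α ^ 2 + 1)) =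
      β ^ 2 * (α - 2 * (α ^ 2 + 1)) / (α ^ 2 + 1) ^ 2 := by
    field_simp
    ring
  rw [h2] at h1
  have h3 : 0 ≤ β ^ 2 * (α - 2 * (α ^ 2 + 1)) := by
    by_contra hc
    push Not at hc
    exact absurd h1 (not_le.mpr (div_neg_of_neg_of_pos hc (by positivity)))
  have h4 : α - 2 * (α ^ 2 + 1) < 0 := by nlinarith [sq_nonneg (α - 1 / 4), sq_nonneg α]
  have h5 : β ^ 2 ≤ 0 := by
    by_contra hc
    push Not at hc
    nlinarith [mul_neg_of_pos_of_neg hc h4]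
  exact pow_eq_zero_iff (two_ne_zero) |>.mp (le_antisymm h5 (sq_nonneg β))

lemma ip_apply_add_smul {R : Module.End ℝ (so n)} (hR : selfAdjEnd R) (X Z : so n) (t : ℝ) :
    ip (R (X + t • Z)) (X + t • Z) =
      ip (R X) X + 2 * t * ip (R X) Z + t ^ 2 * ip (R Z) Z := by
  simp only [map_add, map_smul, ip_add_left, ip_add_right, ip_smul_left, ip_smul_right]
  rw [show ip (R Z) X = ip (R X) Z by rw [hR, ip_comm]]
  ring

lemma ip_add_smul_self (X Z : so n) (t : ℝ) :
    ip (X + t • Z) (X + t • Z) = ip X X + 2 * t * ip X Z + t ^ 2 * ip Z Z := by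
  simp only [ip_add_left, ip_add_right, ip_smul_left, ip_smul_right]
  rw [ip_comm Z X]
  ring

lemma exists_unit_smul {Z : so n} (hZ : Z ≠ 0) :
    ∃ (c : ℝ) (W : so n), 0 < c ∧ ip W W = 1 ∧ Z = c • W ∧ c ^ 2 = ip Z Z := by
  have h := ip_self_pos hZ
  have hs := Real.sqrt_pos.mpr h
  refine ⟨Real.sqrt (ip Z Z), (Real.sqrt (ip Z Z))⁻¹ • Z, hs, ?_, ?_, Real.sq_sqrt h.le⟩
  · rw [ip_smul_left, ip_smul_right]
    have := Real.mul_self_sqrt h.le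
    field_simp
    linarith
  · rw [smul_smul, mul_inv_cancel₀ hs.ne', one_smul]

lemma twoNonneg.le_of_orth {R : Module.End ℝ (so n)} (h : twoNonneg R) {X Z : so n}
    (hX : ip X X = 1) (hXZ : ip X Z = 0) :
    0 ≤ ip (R Z) Z + ip Z Z * ip (R X) X := by
  by_cases hZ : Z = 0
  · subst hZ
    simp [ip_zero_left]
  · obtain ⟨c, W, hc, hW, rfl, -⟩ := exists_unit_smul hZ
    have hXW : ip X W = 0 := by
      rw [ip_smul_right] at hXZ
      exact (mul_eq_zero.mp hXZ).resolve_left hc.ne'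
    have := h X W hX hW hXW
    simp only [map_smul, ip_smul_left, ip_smul_right, hW]
    nlinarith [mul_nonneg (mul_self_nonneg c) this]

lemma twoNonneg.ip_apply_eq_zero {R : Module.End ℝ (so n)} (hR : selfAdjEnd R)
    (h : twoNonneg R) {X Y Z : so n} (hX : ip X X = 1) (hY : ip Y Y = 1) (hXY : ip X Y = 0)
    (h0 : ip (R X) X + ip (R Y) Y = 0) (hXZ : ip X Z = 0) (hYZ : ip Y Z = 0) :
    ip (R X) Z = 0 := by
  refine eq_zero_of_forall_quadratic_nonneg (α := ip (R Z) Z + ip Z Z * ip (R Y) Y) fun t => ?_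
  have := h.le_of_orth (X := Y) (Z := X + t • Z) hY (by
    rw [ip_add_right, ip_smul_right, ip_comm Y X, hXY, hYZ]; ring)
  rw [ip_apply_add_smul hR, ip_add_smul_self, hX, hXZ] at this
  nlinarith

lemma sharpForm_split (E R' : Module.End ℝ (so n)) (Z : so n) : sharpForm (E + R') (E + R') Z =
    sharpForm E (E + R') Z + sharpForm E R' Z + sharpForm R' R' Z := by
  rw [sharpForm_add_left, sharpForm_comm R' (E + R'), sharpForm_add_left]
  ring

lemma brk_self (X : so n) : brk X X = 0 := by
  apply Subtype.ext
  simp [brk]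

lemma ip_neg_neg (X Y : so n) : ip (-X) (-Y) = ip X Y := by simp [ip]

lemma twoNonneg.Qode_pair_nonneg {R : Module.End ℝ (so n)} (hR : selfAdjEnd R)
    (h : twoNonneg R) {X Y : so n} (hX : ip X X = 1) (hY : ip Y Y = 1) (hXY : ip X Y = 0)
    (h0 : ip (R X) X + ip (R Y) Y = 0) :
    0 ≤ ip (Qode R X) X + ip (Qode R Y) Y := by
  have hYX : ip Y X = 0 := by rw [ip_comm, hXY]
  set x := ip (R X) X with hx
  set e := ip (R X) Y with he
  have hy : ip (R Y) Y = -x := by linarith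
  have he' : ip (R Y) X = e := by rw [hR, ip_comm]
  have hRX : ∀ Z, ip (R X) Z = x * ip X Z + e * ip Y Z := by
    intro Z
    have := h.ip_apply_eq_zero hR hX hY hXY h0 (Z := Z - ip X Z • X - ip Y Z • Y)
      (by simp only [ip_sub_right, ip_smul_right, hX, hXY]; ring)
      (by simp only [ip_sub_right, ip_smul_right, hY, hYX]; ring)
    simp only [ip_sub_right, ip_smul_right] at this
    rw [← hx, ← he] at this
    linarith
  have hRY : ∀ Z, ip (R Y) Z = e * ip X Z - x * ip Y Z := by
    intro Z
    have := h.ip_apply_eq_zero hR hY hX hYX (by linarith) (Z := Z - ip X Z • X - ip Y Z • Y)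
      (by simp only [ip_sub_right, ip_smul_right, hY, hYX]; ring)
      (by simp only [ip_sub_right, ip_smul_right, hX, hXY]; ring)
    simp only [ip_sub_right, ip_smul_right, he', hy] at this
    linarith
  set E : Module.End ℝ (so n) := x • rk X X + (-x) • rk Y Y + e • rk X Y + e • rk Y X with hE
  have hipE : ∀ Z W, ip (E Z) W = x * (ip X Z * ip X W) - x * (ip Y Z * ip Y W)
      + e * (ip X Z * ip Y W) + e * (ip Y Z * ip X W) := by
    intro Z W
    simp only [hE, LinearMap.add_apply, LinearMap.smul_apply, ip_add_left, ip_smul_left, ip_rk]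
    ring
  have hsE : selfAdjEnd E := by
    intro Z W
    rw [ip_comm Z, hipE, hipE]
    ring
  set R' := R - E with hR'
  have hipR' : ∀ Z W, ip (R' Z) W = ip (R Z) W - ip (E Z) W := by
    intro Z W
    rw [hR', LinearMap.sub_apply, ip_sub_left]
  have hsR' : selfAdjEnd R' := by
    intro Z W
    rw [ip_comm Z, hipR', hipR', hR Z W, hsE Z W, ip_comm Z, ip_comm Z]
  have hpR' : posSemidefEnd R' := by
    intro Z
    set t := ip X Z with ht
    set u := ip Y Z with hu
    have hXW : ip X (Z - t • X - u • Y) = 0 := by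
      simp only [ip_sub_right, ip_smul_right, hX, hXY]; linarith
    have hYW : ip Y (Z - t • X - u • Y) = 0 := by
      simp only [ip_sub_right, ip_smul_right, hY, hYX]; linarith
    have h1 := h.le_of_orth hX hXW
    have h2 := h.le_of_orth hY hYW
    have h3 : ip (R (Z - t • X - u • Y)) (Z - t • X - u • Y) = ip (R' Z) Z := by
      simp only [map_sub, map_smul, ip_sub_left, ip_sub_right, ip_smul_left, ip_smul_right,
        hipR', hipE]
      rw [show ip (R Z) X = ip (R X) Z by rw [hR, ip_comm],
        show ip (R Z) Y = ip (R Y) Z by rw [hR, ip_comm], hRX Z, hRY Z, he', hy, ← he, ← hx,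
        ← ht, ← hu]
      ring
    rw [hy] at h2
    rw [← hx] at h1
    linarith
  have hRE : R = E + R' := by rw [hR']; abel
  have hsplit : ∀ Z, sharpForm R R Z =
      sharpForm E R Z + sharpForm E R' Z + sharpForm R' R' Z := by
    intro Z
    have := sharpForm_split E R' Z
    rwa [← hRE] at this
  have hcross : ∀ S, sharpForm E S X + sharpForm E S Y = 0 := by
    intro S
    simp only [hE, sharpForm_add_left, sharpForm_smul_left, sharpForm_rk, brk_self, map_zero]
    rw [brk_comm Y X]
    simp only [map_neg, ip_neg_neg]
    simp [ip]
  rw [ip_Qode hR, ip_Qode hR, hsplit, hsplit]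
  have h1 := hcross R
  have h2 := hcross R'
  have h3 := sharpForm_nonneg hsR' hpR' hpR' X
  have h4 := sharpForm_nonneg hsR' hpR' hpR' Y
  have h5 := ip_self_nonneg (R X)
  have h6 := ip_self_nonneg (R Y)
  linarith

lemma twoNonneg.Qode_min_nonneg {R : Module.End ℝ (so n)} (hR : selfAdjEnd R)
    (h : twoNonneg R) {X : so n} (hX : ip X X = 1) (h0 : ip (R X) X ≤ 0)
    (hmin : ∀ Z, ip (R X) X * ip Z Z ≤ ip (R Z) Z) :
    0 ≤ ip (Qode R X) X := by
  set x := ip (R X) X with hx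
  have hRX : ∀ Z, ip (R X) Z = x * ip X Z := by
    intro Z
    have hW : ip X (Z - ip X Z • X) = 0 := by
      simp only [ip_sub_right, ip_smul_right, hX]; ring
    have := eq_zero_of_forall_quadratic_nonneg
      (β := ip (R X) (Z - ip X Z • X))
      (α := ip (R (Z - ip X Z • X)) (Z - ip X Z • X) - x * ip (Z - ip X Z • X) (Z - ip X Z • X))
      fun t => by
        have := hmin (X + t • (Z - ip X Z • X))
        rw [ip_apply_add_smul hR, ip_add_smul_self, hX, hW] at this
        nlinarith
    simp only [ip_sub_right, ip_smul_right] at this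
    rw [← hx] at this
    linarith
  set E : Module.End ℝ (so n) := x • rk X X with hE
  have hipE : ∀ Z W, ip (E Z) W = x * (ip X Z * ip X W) := by
    intro Z W
    simp only [hE, LinearMap.smul_apply, ip_smul_left, ip_rk]
  have hsE : selfAdjEnd E := by
    intro Z W
    rw [ip_comm Z, hipE, hipE]
    ring
  set R' := R - E with hR'
  have hipR' : ∀ Z W, ip (R' Z) W = ip (R Z) W - ip (E Z) W := by
    intro Z W
    rw [hR', LinearMap.sub_apply, ip_sub_left]
  have hsR' : selfAdjEnd R' := by
    intro Z W
    rw [ip_comm Z, hipR', hipR', hR Z W, hsE Z W, ip_comm Z, ip_comm Z]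
  have hpR' : posSemidefEnd R' := by
    intro Z
    set t := ip X Z with ht
    have hXW : ip X (Z - t • X) = 0 := by
      simp only [ip_sub_right, ip_smul_right, hX]; linarith
    have h1 := h.le_of_orth hX hXW
    have h3 : ip (R (Z - t • X)) (Z - t • X) = ip (R' Z) Z := by
      simp only [map_sub, map_smul, ip_sub_left, ip_sub_right, ip_smul_left, ip_smul_right,
        hipR', hipE]
      rw [show ip (R Z) X = ip (R X) Z by rw [hR, ip_comm], hRX Z, ← hx, ← ht]
      ring
    rw [← hx] at h1
    nlinarith [ip_self_nonneg (Z - t • X)]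
  have hRE : R = E + R' := by rw [hR']; abel
  have hsplit : sharpForm R R X =
      sharpForm E R X + sharpForm E R' X + sharpForm R' R' X := by
    have := sharpForm_split E R' X
    rwa [← hRE] at this
  have hcross : ∀ S, sharpForm E S X = 0 := by
    intro S
    simp only [hE, sharpForm_smul_left, sharpForm_rk, brk_self, map_zero]
    simp [ip]
  rw [ip_Qode hR, hsplit, hcross, hcross]
  have h3 := sharpForm_nonneg hsR' hpR' hpR' X
  have h5 := ip_self_nonneg (R X)
  linarith

/-- The quadratic form of a matrix. -/
def qf (M : Mat n) (v : Fin n → ℝ) : ℝ := ∑ i, ∑ j, v i * v j * M i j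

lemma qf_add (M N : Mat n) (v : Fin n → ℝ) : qf (M + N) v = qf M v + qf N v := by
  simp only [qf, Matrix.add_apply, mul_add, Finset.sum_add_distrib]

lemma qf_smul (c : ℝ) (M : Mat n) (v : Fin n → ℝ) : qf (c • M) v = c * qf M v := by
  simp only [qf, Matrix.smul_apply, smul_eq_mul, Finset.mul_sum]
  exact Finset.sum_congr rfl fun i _ => Finset.sum_congr rfl fun j _ => by ring

lemma qf_one (v : Fin n → ℝ) : qf (1 : Mat n) v = ∑ i, v i ^ 2 := by
  simp [qf, Matrix.one_apply, sq]

lemma qf_contr_nonneg {R : Module.End ℝ (so n)} (hR : posSemidefEnd R) {P : Mat n}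
    (hs : Pᵀ = P) (hP : ∀ v, 0 ≤ qf P v) (v : Fin n → ℝ) : 0 ≤ qf (contr R P) v := by
  obtain ⟨m, B, hB⟩ := exists_gram_of_posSemidef (M := P)
    (fun i j => by conv_lhs => rw [← hs, Matrix.transpose_apply]) hP
  have key : qf (contr R P) v =
      ∑ t, ip (R (skew (vecMulVec v (B t)))) (skew (vecMulVec v (B t))) := by
    have push : ∀ g : Fin n → Fin m → ℝ,
        ∑ i, ∑ t, g i t = ∑ t, ∑ i, g i t := fun g => Finset.sum_comm
    simp only [← sum_mul_Rcoord, qf, contr_apply, hB, Finset.mul_sum, push,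
      Matrix.vecMulVec_apply]
    refine Finset.sum_congr rfl fun t _ => Finset.sum_congr rfl fun i _ => ?_
    rw [Finset.sum_comm]
    refine Finset.sum_congr rfl fun k _ => Finset.sum_congr rfl fun j _ =>
      Finset.sum_congr rfl fun l _ => ?_
    ring
  rw [key]
  exact Finset.sum_nonneg fun t _ => hR _

lemma continuous_so_apply (i j : Fin n) : Continuous fun X : so n => (X : Mat n) i j :=
  (continuous_apply_apply i j).comp continuous_subtype_val

lemma continuous_ip : Continuous fun p : so n × so n => ip p.1 p.2 := by
  simp only [ip_eq_sum]
  refine Continuous.mul continuous_const ?_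
  refine continuous_finsetSum _ fun i _ => continuous_finsetSum _ fun j _ => ?_
  exact ((continuous_so_apply i j).comp continuous_fst).mul
    ((continuous_so_apply i j).comp continuous_snd)

lemma isCompact_unit_so : IsCompact {X : so n | ip X X = 1} := by
  have hcl : IsClosed ((so n : Set (Mat n))) := by
    show IsClosed {A : Mat n | Aᵀ = -A}
    exact isClosed_eq continuous_id.matrix_transpose continuous_neg
  have hK : IsCompact (Set.pi Set.univ fun _ : Fin n => Set.pi Set.univ fun _ : Fin n =>
      Set.Icc (-2 : ℝ) 2) :=
    isCompact_univ_pi fun _ => isCompact_univ_pi fun _ => isCompact_Icc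
  have h1 := (hcl.isClosedEmbedding_subtypeVal).isCompact_preimage hK
  refine h1.of_isClosed_subset ?_ ?_
  · exact isClosed_eq (continuous_ip.comp (continuous_id.prodMk continuous_id)) continuous_const
  · intro X hX
    have hX' : ip X X = 1 := hX
    intro i _ j _
    have h2 : (X : Mat n) i j ^ 2 ≤ 2 := by
      rw [ip_eq_sum] at hX'
      have h3 : (X : Mat n) i j * (X : Mat n) i j ≤ ∑ j, (X : Mat n) i j * (X : Mat n) i j :=
        Finset.single_le_sum (f := fun j => (X : Mat n) i j * (X : Mat n) i j)
          (fun j _ => mul_self_nonneg _) (Finset.mem_univ j)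
      have h4 : ∑ j, (X : Mat n) i j * (X : Mat n) i j ≤
          ∑ i, ∑ j, (X : Mat n) i j * (X : Mat n) i j :=
        Finset.single_le_sum (f := fun i => ∑ j, (X : Mat n) i j * (X : Mat n) i j)
          (fun i _ => Finset.sum_nonneg fun j _ => mul_self_nonneg _) (Finset.mem_univ i)
      nlinarith
    constructor <;> nlinarith

lemma continuous_quad (R : Module.End ℝ (so n)) : Continuous fun X : so n => ip (R X) X := by
  simp only [ip_apply_eq_sum]
  refine Continuous.mul continuous_const ?_
  refine continuous_finsetSum _ fun i _ => continuous_finsetSum _ fun j _ =>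
    continuous_finsetSum _ fun k _ => continuous_finsetSum _ fun l _ => ?_
  exact ((continuous_so_apply i j).mul (continuous_so_apply k l)).mul continuous_const

lemma ip_bvec_self {i j : Fin n} (h : i ≠ j) : ip (bvec i j) (bvec i j) = 1 := by
  rw [ip_bvec, bvec_apply]
  simp [h]

lemma exists_quad_min (hn : 3 ≤ n) (R : Module.End ℝ (so n)) :
    ∃ X : so n, ip X X = 1 ∧ ∀ Z, ip (R X) X * ip Z Z ≤ ip (R Z) Z := by
  obtain ⟨X, hX, hmin⟩ := isCompact_unit_so.exists_isMinOn (f := fun X => ip (R X) X)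
    ⟨bvec (⟨0, by omega⟩ : Fin n) ⟨1, by omega⟩, ip_bvec_self (by simp [Fin.ext_iff])⟩
    (continuous_quad R).continuousOn
  refine ⟨X, hX, fun Z => ?_⟩
  by_cases hZ : Z = 0
  · subst hZ
    simp [ip_zero_left]
  · obtain ⟨c, W, hc, hW, rfl, -⟩ := exists_unit_smul hZ
    have : ip (R X) X ≤ ip (R W) W := hmin hW
    simp only [map_smul, ip_smul_left, ip_smul_right, hW]
    nlinarith [mul_self_nonneg c]

lemma ip_sq_le {X : so n} (hX : ip X X = 1) (Z : so n) : ip X Z ^ 2 ≤ ip Z Z := by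
  have := ip_self_nonneg (Z - ip X Z • X)
  simp only [ip_sub_left, ip_sub_right, ip_smul_left, ip_smul_right, hX, ip_comm Z X] at this
  nlinarith

lemma twoNonneg.exists_lower_bound (hn : 3 ≤ n) {R : Module.End ℝ (so n)} (hR : selfAdjEnd R)
    (h : twoNonneg R) : ∃ X : so n, ip X X = 1 ∧ ∃ x : ℝ, 0 ≤ x ∧
      ∀ Z, x * ip Z Z - 2 * x * ip X Z ^ 2 ≤ ip (R Z) Z := by
  obtain ⟨X, hX, hmin⟩ := exists_quad_min hn R
  refine ⟨X, hX, ?_⟩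
  rcases le_or_gt 0 (ip (R X) X) with h0 | h0
  · refine ⟨0, le_rfl, fun Z => ?_⟩
    have := hmin Z
    have := mul_nonneg h0 (ip_self_nonneg Z)
    linarith
  · refine ⟨-ip (R X) X, by linarith, fun Z => ?_⟩
    set x := ip (R X) X with hx
    have hW : ip X (Z - ip X Z • X) = 0 := by
      simp only [ip_sub_right, ip_smul_right, hX]; ring
    have h1 := eq_zero_of_forall_quadratic_nonneg
      (β := ip (R X) (Z - ip X Z • X))
      (α := ip (R (Z - ip X Z • X)) (Z - ip X Z • X) - x * ip (Z - ip X Z • X) (Z - ip X Z • X))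
      fun t => by
        have := hmin (X + t • (Z - ip X Z • X))
        rw [ip_apply_add_smul hR, ip_add_smul_self, hX, hW] at this
        nlinarith
    have h2 := h.le_of_orth hX hW
    rw [← hx] at h2
    simp only [map_sub, map_smul, ip_sub_left, ip_sub_right, ip_smul_left, ip_smul_right, hX,
      ip_comm Z X] at h1 h2
    rw [show ip (R Z) X = ip (R X) Z by rw [hR, ip_comm], ← hx] at h2
    rw [← hx] at h1
    have h3 : ip (R X) Z = x * ip X Z := by linarith
    rw [h3] at h2
    nlinarith

lemma vwedge_apply (v w : Fin n → ℝ) (i j : Fin n) :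
    (vwedge v w : Mat n) i j = v i * w j - w i * v j := rfl

lemma vwedge_eq_skew (v w : Fin n → ℝ) : vwedge v w = skew (vecMulVec v w) := by
  apply Subtype.ext
  ext i j
  simp [vwedge, skew, Matrix.vecMulVec_apply, mul_comm]

lemma qf_RicM (R : Module.End ℝ (so n)) (v : Fin n → ℝ) :
    qf (RicM R) v = ∑ k, ip (R (vwedge v (evec k))) (vwedge v (evec k)) := by
  simp only [vwedge_eq_skew, ← sum_mul_Rcoord, qf, RicM_apply, vecMulVec_apply, evec,
    mul_ite, mul_one, mul_zero, ite_mul, zero_mul, Finset.sum_ite_irrel, Finset.sum_const_zero,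
    Finset.sum_ite_eq', Finset.mem_univ, if_true]
  symm
  rw [Finset.sum_comm]
  refine Finset.sum_congr rfl fun i _ => ?_
  rw [Finset.sum_comm]
  exact Finset.sum_congr rfl fun j _ => (Finset.mul_sum _ _ _).symm

lemma ip_vwedge (X : so n) (v w : Fin n → ℝ) :
    ip X (vwedge v w) = ∑ k, (∑ i, v i * (X : Mat n) i k) * w k := by
  rw [ip_eq_sum]
  simp only [vwedge_apply, mul_sub, Finset.sum_sub_distrib]
  rw [Finset.sum_comm (f := fun i j => (X : Mat n) i j * (v i * w j))]
  have h : ∑ i, ∑ j, (X : Mat n) i j * (w i * v j) =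
      -∑ k, (∑ i, v i * (X : Mat n) i k) * w k := by
    simp only [Finset.sum_mul, ← Finset.sum_neg_distrib]
    refine Finset.sum_congr rfl fun i _ => Finset.sum_congr rfl fun j _ => ?_
    rw [so_apply_swap X j i]
    ring
  have h' : ∑ k, ∑ i, (X : Mat n) i k * (v i * w k) =
      ∑ k, (∑ i, v i * (X : Mat n) i k) * w k := by
    simp only [Finset.sum_mul]
    exact Finset.sum_congr rfl fun i _ => Finset.sum_congr rfl fun j _ => by ring
  rw [h, h']
  ring

lemma ip_vwedge_self (v w : Fin n → ℝ) :
    ip (vwedge v w) (vwedge v w) = (∑ i, v i ^ 2) * (∑ i, w i ^ 2) - (∑ i, v i * w i) ^ 2 := by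
  rw [ip_vwedge]
  have h : ∀ k, (∑ i, v i * (vwedge v w : Mat n) i k) * w k =
      (∑ i, v i ^ 2) * w k ^ 2 - (∑ i, v i * w i) * (v k * w k) := by
    intro k
    simp only [vwedge_apply, Finset.sum_mul, ← Finset.sum_sub_distrib]
    exact Finset.sum_congr rfl fun i _ => by ring
  simp only [h, Finset.sum_sub_distrib, ← Finset.mul_sum]
  ring

lemma qf_RicM_nonneg (hn : 3 ≤ n) {R : Module.End ℝ (so n)} (hR : selfAdjEnd R)
    (h : twoNonneg R) (v : Fin n → ℝ) : 0 ≤ qf (RicM R) v := by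
  obtain ⟨X, hX, x, hx, hle⟩ := h.exists_lower_bound hn hR
  rw [qf_RicM]
  set w : Fin n → ℝ := fun k => ∑ i, v i * (X : Mat n) i k with hw
  have h1 : ∀ k, ip X (vwedge v (evec k)) = w k := by
    intro k
    rw [ip_vwedge]
    simp [evec, hw]
  have h2 : ∀ k, ip (vwedge v (evec k)) (vwedge v (evec k)) = (∑ i, v i ^ 2) - v k ^ 2 := by
    intro k
    rw [ip_vwedge_self]
    simp [evec]
  have h3 : (∑ k, w k ^ 2) ^ 2 ≤ (∑ i, v i ^ 2) * ∑ k, w k ^ 2 := by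
    have a1 := ip_sq_le hX (vwedge v w)
    rw [ip_vwedge_self, ip_vwedge] at a1
    have a2 : ∑ k, (∑ i, v i * (X : Mat n) i k) * w k = ∑ k, w k ^ 2 := by
      simp only [sq, hw]
    rw [a2] at a1
    nlinarith [sq_nonneg (∑ i, v i * w i)]
  have h4 : ∑ k, w k ^ 2 ≤ ∑ i, v i ^ 2 := by
    by_contra hc
    push Not at hc
    have : 0 ≤ ∑ i, v i ^ 2 := Finset.sum_nonneg fun i _ => sq_nonneg _
    nlinarith
  have h5 : ∑ k, (x * ((∑ i, v i ^ 2) - v k ^ 2) - 2 * x * w k ^ 2) ≤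
      ∑ k, ip (R (vwedge v (evec k))) (vwedge v (evec k)) :=
    Finset.sum_le_sum fun k _ => by
      have := hle (vwedge v (evec k))
      rwa [h1, h2] at this
  refine le_trans ?_ h5
  simp only [Finset.sum_sub_distrib, ← Finset.mul_sum, Finset.sum_const, Finset.card_univ,
    Fintype.card_fin, nsmul_eq_mul]
  have hn' : (3 : ℝ) ≤ n := by exact_mod_cast hn
  have h6 : 0 ≤ ∑ i, v i ^ 2 := Finset.sum_nonneg fun i _ => sq_nonneg _
  nlinarith [mul_nonneg hx h6, mul_nonneg hx (sub_nonneg.mpr h4),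
    mul_nonneg (mul_nonneg hx h6) (sub_nonneg.mpr hn')]

lemma sum_quad_bvec (hn : 3 ≤ n) (R : Module.End ℝ (so n)) :
    ∑ i, ∑ j, ip (R (bvec i j)) (bvec i j) = n * lamb R := by
  rw [← trace_RicM hn]
  rfl

lemma twoNonneg.exists_shift (hn : 3 ≤ n) {R : Module.End ℝ (so n)} (hR : selfAdjEnd R)
    (h : twoNonneg R) : ∃ x : ℝ, 0 ≤ x ∧ 2 * x ≤ n * lamb R ∧
      ∀ Z, -x * ip Z Z ≤ ip (R Z) Z := by
  obtain ⟨X, hX, x, hx, hle⟩ := h.exists_lower_bound hn hR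
  refine ⟨x, hx, ?_, fun Z => ?_⟩
  · rw [← sum_quad_bvec hn]
    have h1 : ∑ i, ∑ j, (x * (if i = j then 0 else 1) - 2 * x * (X : Mat n) i j ^ 2) ≤
        ∑ i, ∑ j, ip (R (bvec i j)) (bvec i j) :=
      Finset.sum_le_sum fun i _ => Finset.sum_le_sum fun j _ => by
        have := hle (bvec i j)
        rw [ip_bvec X] at this
        refine le_trans (le_of_eq ?_) this
        split_ifs with hij
        · subst hij
          rw [bvec_self, ip_zero_left]
        · rw [ip_bvec_self hij]
    refine le_trans ?_ h1
    have h2 : ∑ i, ∑ j, (X : Mat n) i j ^ 2 = 2 := by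
      rw [ip_eq_sum] at hX
      simp only [sq]
      linarith
    have h3 : ∑ i : Fin n, ∑ j : Fin n, (if i = j then (0 : ℝ) else 1) = n * (n - 1) := by
      have : ∀ i j : Fin n, (if i = j then (0 : ℝ) else 1) = 1 - if i = j then 1 else 0 := by
        intro i j; split_ifs <;> simp
      simp only [this, Finset.sum_sub_distrib]
      simp
      ring
    simp only [Finset.sum_sub_distrib, ← Finset.mul_sum, h2, h3]
    have hn' : (3 : ℝ) ≤ n := by exact_mod_cast hn
    have : (6 : ℝ) ≤ n * (n - 1) := by nlinarith
    nlinarith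
  · have := hle Z
    have := ip_sq_le hX Z
    nlinarith

lemma twoNonneg.lamb_nonneg (hn : 3 ≤ n) {R : Module.End ℝ (so n)} (hR : selfAdjEnd R)
    (h : twoNonneg R) : 0 ≤ lamb R := by
  obtain ⟨x, hx, h1, -⟩ := h.exists_shift hn hR
  have hn' : (3 : ℝ) ≤ n := by exact_mod_cast hn
  by_contra hc
  push Not at hc
  nlinarith

lemma twoNonneg.abs_Rcoord_le (hn : 3 ≤ n) {R : Module.End ℝ (so n)} (hR : selfAdjEnd R)
    (h : twoNonneg R) (i j k l : Fin n) : |Rcoord R i j k l| ≤ (2 * n + n ^ 3) * lamb R := by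
  obtain ⟨x, hx, h1, hle⟩ := h.exists_shift hn hR
  have hl := h.lamb_nonneg hn hR
  have hn' : (3 : ℝ) ≤ n := by exact_mod_cast hn
  have hb : ∀ i j : Fin n, 0 ≤ ip (bvec i j) (bvec i j) ∧ ip (bvec i j) (bvec i j) ≤ 1 := by
    intro i j
    refine ⟨ip_self_nonneg _, ?_⟩
    by_cases hij : i = j
    · subst hij
      rw [bvec_self, ip_zero_left]
      norm_num
    · rw [ip_bvec_self hij]
  have hS : ∀ i j, ip (R (bvec i j)) (bvec i j) + x * ip (bvec i j) (bvec i j) ≤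
      n * lamb R + x * n ^ 2 := by
    intro i j
    have hpos : ∀ i j, 0 ≤ ip (R (bvec i j)) (bvec i j) + x * ip (bvec i j) (bvec i j) := by
      intro i j
      have := hle (bvec i j)
      linarith
    have a1 : _ ≤ ∑ j, (ip (R (bvec i j)) (bvec i j) + x * ip (bvec i j) (bvec i j)) :=
      Finset.single_le_sum
        (f := fun j => ip (R (bvec i j)) (bvec i j) + x * ip (bvec i j) (bvec i j))
        (fun j _ => hpos i j) (Finset.mem_univ j)
    have a2 : _ ≤ ∑ i, ∑ j, (ip (R (bvec i j)) (bvec i j) + x * ip (bvec i j) (bvec i j)) :=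
      Finset.single_le_sum
        (f := fun i => ∑ j, (ip (R (bvec i j)) (bvec i j) + x * ip (bvec i j) (bvec i j)))
        (fun i _ => Finset.sum_nonneg fun j _ => hpos i j) (Finset.mem_univ i)
    have a3 : ∑ i : Fin n, ∑ j : Fin n, x * ip (bvec i j) (bvec i j) ≤ 
        ∑ i : Fin n, ∑ j : Fin n, x :=
      Finset.sum_le_sum fun i _ => Finset.sum_le_sum fun j _ => by nlinarith [(hb i j).2]
    simp only [Finset.sum_add_distrib] at a2
    rw [sum_quad_bvec hn] at a2
    simp only [Finset.sum_const, Finset.card_univ, Fintype.card_fin, nsmul_eq_mul] at a3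
    simp only [Finset.sum_add_distrib] at a1
    nlinarith
  have hpm : ∀ t : ℝ, t ^ 2 = 1 → t * (Rcoord R i j k l + x * ip (bvec i j) (bvec k l)) ≤
      n * lamb R + x * n ^ 2 := by
    intro t ht
    have a := hle (bvec i j + (-t) • bvec k l)
    rw [ip_apply_add_smul hR, ip_add_smul_self, neg_sq, ht] at a
    have b1 := hS i j
    have b2 := hS k l
    rw [Rcoord]
    linarith
  have hc : |ip (bvec i j) (bvec k l)| ≤ 1 := by
    rw [ip_bvec, bvec_apply]
    split_ifs <;> norm_num
  have c1 := hpm 1 (by norm_num)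
  have c2 := hpm (-1) (by norm_num)
  have d := abs_le.mp hc
  have e1 : x * n ^ 2 ≤ n * lamb R / 2 * n ^ 2 := by
    apply mul_le_mul_of_nonneg_right _ (by positivity); linarith
  have e2 : |x * ip (bvec i j) (bvec k l)| ≤ x := by
    rw [abs_mul, abs_of_nonneg hx]; nlinarith
  have e3 := abs_le.mp e2
  have e4 : 0 ≤ n * lamb R * n ^ 2 := by positivity
  rw [abs_le]
  constructor <;> nlinarith

lemma twoNonneg.eq_zero_of_lamb (hn : 3 ≤ n) {R : Module.End ℝ (so n)} (hR : selfAdjEnd R)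
    (h : twoNonneg R) (h0 : lamb R = 0) : R = 0 := by
  apply End_ext
  intro i j k l
  have := h.abs_Rcoord_le hn hR i j k l
  rw [h0, mul_zero] at this
  rw [Rcoord_zero]
  exact abs_eq_zero.mp (le_antisymm this (abs_nonneg _))

lemma exists_diagonalization {A : Mat n} (hA : Aᵀ = A) : ∃ (U : Mat n) (f : Fin n → ℝ),
    Uᵀ * U = 1 ∧ U * Uᵀ = 1 ∧ A = U * Matrix.diagonal f * Uᵀ := by
  have hH : A.IsHermitian := by
    rw [Matrix.IsHermitian, Matrix.conjTranspose_eq_transpose_of_trivial, hA]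
  have hs : ∀ M : Mat n, star M = Mᵀ := fun M => by
    rw [Matrix.star_eq_conjTranspose, Matrix.conjTranspose_eq_transpose_of_trivial]
  refine ⟨(hH.eigenvectorUnitary : Mat n), hH.eigenvalues, ?_, ?_, ?_⟩
  · rw [← hs]
    exact Unitary.coe_star_mul_self _
  · rw [← hs]
    exact Unitary.coe_mul_star_self _
  · have := hH.spectral_theorem
    rw [Unitary.conjStarAlgAut_apply] at this
    rw [← hs]
    exact this

lemma trace_diag_mul {f g : Fin n → ℝ} (Y : Mat n) :
    (Matrix.diagonal f * Y * Matrix.diagonal g * Y).trace = ∑ i, ∑ j, f i * g j * (Y i j * Y j i) := by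
  simp only [Matrix.trace, Matrix.diag_apply]
  refine Finset.sum_congr rfl fun i _ => ?_
  rw [Matrix.mul_apply]
  refine Finset.sum_congr rfl fun j _ => ?_
  rw [Matrix.mul_diagonal, Matrix.diagonal_mul]
  ring

lemma ip_wedge_diag {U : Mat n} (f g : Fin n → ℝ) (X : so n) :
    ip (wedge (U * Matrix.diagonal f * Uᵀ) (U * Matrix.diagonal g * Uᵀ) X) X =
      (1/2) * ∑ i, ∑ j, f i * g j * (Uᵀ * (X : Mat n) * U) i j ^ 2 := by
  set Y := Uᵀ * (X : Mat n) * U with hY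
  have hYs : ∀ i j, Y j i = -Y i j := by
    intro i j
    have hX : (X : Mat n)ᵀ = -(X : Mat n) := X.2
    have : Yᵀ = -Y := by
      rw [hY, Matrix.transpose_mul, Matrix.transpose_mul, Matrix.transpose_transpose, hX]
      simp [Matrix.mul_assoc]
    rw [← Matrix.transpose_apply Y, this, Matrix.neg_apply]
  have key : ∀ f g : Fin n → ℝ, ((U * Matrix.diagonal f * Uᵀ) * (X : Mat n) *
      (U * Matrix.diagonal g * Uᵀ) * (X : Mat n)).trace = -∑ i, ∑ j, f i * g j * Y i j ^ 2 := by
    intro f g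
    have : ((U * Matrix.diagonal f * Uᵀ) * (X : Mat n) * (U * Matrix.diagonal g * Uᵀ)
        * (X : Mat n)) = U * (Matrix.diagonal f * Y * Matrix.diagonal g * Uᵀ * (X : Mat n)) := by
      simp only [hY, Matrix.mul_assoc]
    rw [this, Matrix.trace_mul_comm]
    have h2 : Matrix.diagonal f * Y * Matrix.diagonal g * Uᵀ * (X : Mat n) * U =
        Matrix.diagonal f * Y * Matrix.diagonal g * Y := by
      simp only [hY, Matrix.mul_assoc]
    rw [h2, trace_diag_mul, ← Finset.sum_neg_distrib]
    refine Finset.sum_congr rfl fun i _ => ?_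
    rw [← Finset.sum_neg_distrib]
    refine Finset.sum_congr rfl fun j _ => ?_
    rw [hYs i j]
    ring
  have hT : ∀ f : Fin n → ℝ, (U * Matrix.diagonal f * Uᵀ)ᵀ = U * Matrix.diagonal f * Uᵀ := by
    intro f
    simp [Matrix.transpose_mul, Matrix.mul_assoc]
  have hw : ((wedge (U * Matrix.diagonal f * Uᵀ) (U * Matrix.diagonal g * Uᵀ) X : so n) : Mat n) =
      (1/2 : ℝ) • ((U * Matrix.diagonal f * Uᵀ) * (X : Mat n) * (U * Matrix.diagonal g * Uᵀ)ᵀ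
        + (U * Matrix.diagonal g * Uᵀ) * (X : Mat n) * (U * Matrix.diagonal f * Uᵀ)ᵀ) := rfl
  rw [ip, hw, hT, hT, Matrix.smul_mul, Matrix.add_mul, Matrix.trace_smul, Matrix.trace_add, key,
    key, smul_eq_mul]
  have : ∑ i, ∑ j, g i * f j * Y i j ^ 2 = ∑ i, ∑ j, f i * g j * Y i j ^ 2 := by
    rw [Finset.sum_comm]
    refine Finset.sum_congr rfl fun i _ => Finset.sum_congr rfl fun j _ => ?_
    rw [hYs i j]
    ring
  rw [this]
  ring

lemma qf_diag {U : Mat n} (hU : Uᵀ * U = 1) (f : Fin n → ℝ) (k : Fin n) :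
    qf (U * Matrix.diagonal f * Uᵀ) (fun i => U i k) = f k := by
  have h1 : qf (U * Matrix.diagonal f * Uᵀ) (fun i => U i k) =
      (Uᵀ * (U * Matrix.diagonal f * Uᵀ) * U) k k := by
    simp only [qf, Matrix.mul_apply (M := Uᵀ * (U * Matrix.diagonal f * Uᵀ)),
      Matrix.mul_apply (M := Uᵀ), Matrix.transpose_apply, Finset.sum_mul]
    rw [Finset.sum_comm]
    exact Finset.sum_congr rfl fun i _ => Finset.sum_congr rfl fun j _ => by ring
  rw [h1, show Uᵀ * (U * Matrix.diagonal f * Uᵀ) * U = (Uᵀ * U) * Matrix.diagonal f * (Uᵀ * U) by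
    simp only [Matrix.mul_assoc], hU, Matrix.one_mul, Matrix.mul_one, Matrix.diagonal_apply_eq]

lemma posDef_Dop (hn : 3 ≤ n) {R : Module.End ℝ (so n)} (hR : selfAdjEnd R) {c a b g q : ℝ}
    (hq : ∀ v : Fin n → ℝ, q * lamb R * ∑ i, v i ^ 2 ≤ qf (RicM R) v)
    (hd : ∀ f : Fin n → ℝ, ∑ i, f i = 0 → ∑ i, f i ^ 2 = n * sigmaR R →
      (∀ i, (q - 1) * lamb R ≤ f i) → ∀ i j,
      0 < c * (f i * f j) + 2 * a * ((f i + lamb R) * (f j + lamb R))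
        + b ^ 2 * (f i ^ 2 + f j ^ 2) + g) :
    posDefEnd (Dop c a b g R) := by
  obtain ⟨U, f, hU, hU', hA⟩ := exists_diagonalization (Ric0_symm hR)
  have hone : (1 : Mat n) = U * Matrix.diagonal (fun _ => 1) * Uᵀ := by
    rw [Matrix.diagonal_one, Matrix.mul_one, hU']
  have hric : RicM R = U * Matrix.diagonal (fun i => f i + lamb R) * Uᵀ := by
    have : Matrix.diagonal (fun i => f i + lamb R) =
        Matrix.diagonal f + lamb R • (1 : Mat n) := by
      rw [← Matrix.diagonal_one, ← Matrix.diagonal_smul, Matrix.diagonal_add]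
      congr 1
      ext i
      simp
    rw [RicM_eq, this, Matrix.mul_add, Matrix.add_mul, ← hA, Matrix.mul_smul, Matrix.mul_one,
      Matrix.smul_mul, hU']
  have hsq : Ric0 R * Ric0 R = U * Matrix.diagonal (fun i => f i * f i) * Uᵀ := by
    conv_lhs => rw [hA]
    rw [← Matrix.diagonal_mul_diagonal]
    calc _ = U * Matrix.diagonal f * (Uᵀ * U) * Matrix.diagonal f * Uᵀ := by
          simp only [Matrix.mul_assoc]
      _ = _ := by rw [hU, Matrix.mul_one, Matrix.mul_assoc U]
  have htr : ∀ h : Fin n → ℝ, (U * Matrix.diagonal h * Uᵀ).trace = ∑ i, h i := by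
    intro h
    rw [Matrix.trace_mul_comm, ← Matrix.mul_assoc, hU, Matrix.one_mul, Matrix.trace_diagonal]
  have hf0 : ∑ i, f i = 0 := by rw [← htr, ← hA, trace_Ric0 hn]
  have hf2 : ∑ i, f i ^ 2 = n * sigmaR R := by
    rw [← trace_Ric0_sq hn, hsq, htr]
    simp only [sq]
  have hfl : ∀ i, (q - 1) * lamb R ≤ f i := by
    intro k
    have h1 := hq fun i => U i k
    rw [hric, qf_diag hU] at h1
    have h2 : ∑ i, U i k ^ 2 = 1 := by
      have := congrFun (congrFun hU k) k
      rw [Matrix.mul_apply, Matrix.one_apply_eq] at this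
      simpa only [Matrix.transpose_apply, ← sq] using this
    rw [h2] at h1
    linarith
  have hdij := hd f hf0 hf2 hfl
  intro X hX
  set Y := Uᵀ * (X : Mat n) * U with hY
  have hXY : (X : Mat n) = U * Y * Uᵀ := by
    calc (X : Mat n) = (U * Uᵀ) * (X : Mat n) * (U * Uᵀ) := by rw [hU', Matrix.one_mul, Matrix.mul_one]
      _ = _ := by simp only [hY, Matrix.mul_assoc]
  have hYs : ∀ i j, Y j i ^ 2 = Y i j ^ 2 := by
    intro i j
    have hX : (X : Mat n)ᵀ = -(X : Mat n) := X.2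
    have : Yᵀ = -Y := by
      rw [hY, Matrix.transpose_mul, Matrix.transpose_mul, Matrix.transpose_transpose, hX]
      simp [Matrix.mul_assoc]
    rw [← Matrix.transpose_apply Y, this, Matrix.neg_apply, neg_sq]
  obtain ⟨i0, j0, hij⟩ : ∃ i j, Y i j ≠ 0 := by
    by_contra hc
    push Not at hc
    have : Y = 0 := by ext i j; exact hc i j
    apply hX
    apply Subtype.ext
    rw [hXY, this]
    simp
  have hval : ip (Dop c a b g R X) X = (1/2) * ∑ i, ∑ j, (c * (f i * f j)
      + 2 * a * ((f i + lamb R) * (f j + lamb R)) + b ^ 2 * (f i ^ 2 + f j ^ 2) + g) * Y i j ^ 2 := by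
    have e1 := ip_wedge_diag (U := U) f f X
    have e2 := ip_wedge_diag (U := U) (fun i => f i + lamb R) (fun i => f i + lamb R) X
    have e3 := ip_wedge_diag (U := U) (fun i => f i * f i) (fun _ => 1) X
    have e4 := ip_wedge_diag (U := U) (fun _ => 1) (fun _ => 1) X
    rw [← hA] at e1
    rw [← hric] at e2
    rw [← hsq, ← hone] at e3
    rw [← hone] at e4
    have e5 : ∑ i, ∑ j, f j ^ 2 * Y i j ^ 2 = ∑ i, ∑ j, f i * f i * 1 * Y i j ^ 2 := by
      rw [Finset.sum_comm]
      refine Finset.sum_congr rfl fun i _ => Finset.sum_congr rfl fun j _ => ?_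
      rw [hYs i j]
      ring
    simp only [Dop, LinearMap.add_apply, LinearMap.smul_apply, ip_add_left, ip_smul_left]
    rw [e1, e2, e3, e4, ← hY]
    have e6 : ∑ i, ∑ j, (c * (f i * f j)
      + 2 * a * ((f i + lamb R) * (f j + lamb R)) + b ^ 2 * (f i ^ 2 + f j ^ 2) + g) * Y i j ^ 2 =
      c * ∑ i, ∑ j, f i * f j * Y i j ^ 2 +
      2 * a * ∑ i, ∑ j, (f i + lamb R) * (f j + lamb R) * Y i j ^ 2 +
      b ^ 2 * (∑ i, ∑ j, f i * f i * 1 * Y i j ^ 2 + ∑ i, ∑ j, f j ^ 2 * Y i j ^ 2) +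
      g * ∑ i, ∑ j, 1 * 1 * Y i j ^ 2 := by
      simp only [Finset.mul_sum, ← Finset.sum_add_distrib, mul_add]
      exact Finset.sum_congr rfl fun i _ => Finset.sum_congr rfl fun j _ => by ring
    rw [e6, e5]
    ring
  rw [hval]
  refine mul_pos (by norm_num) ?_
  have hterm : ∀ i j, 0 ≤ (c * (f i * f j)
      + 2 * a * ((f i + lamb R) * (f j + lamb R)) + b ^ 2 * (f i ^ 2 + f j ^ 2) + g) * Y i j ^ 2 :=
    fun i j => mul_nonneg (hdij i j).le (sq_nonneg _)
  refine Finset.sum_pos' (fun i _ => Finset.sum_nonneg fun j _ => hterm i j)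
    ⟨i0, Finset.mem_univ _, Finset.sum_pos' (fun j _ => hterm i0 j)
      ⟨j0, Finset.mem_univ _, mul_pos (hdij i0 j0) (by positivity)⟩⟩

/-- Parameters `(a, b, q)` for which the cone `ℓ_{a,b}(B(q))` is strictly preserved. -/
structure GoodParam (N a b q p r : ℝ) : Prop where
  b_pos : 0 < b
  b_le : b ≤ 1 / 2
  r_eq : r = N * b ^ 2 * (1 + 2 * b)
  p_mul : p * (1 + r) = r
  q_le : q ≤ p
  q_cases : (1 ≤ N * b ∧ q = p) ∨ N * b ≤ 1
  a_cases : 2 * (a - b) = p * (1 - 2 * b) ∨ (b = 1 / 2 ∧ 1 / 2 ≤ a)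

namespace GoodParam
variable {N a b q p r : ℝ} (h : GoodParam N a b q p r)
include h

lemma r_pos (hN : 3 ≤ N) : 0 < r := by
  rw [h.r_eq]
  have := h.b_pos
  positivity

lemma p_pos (hN : 3 ≤ N) : 0 < p := by
  have h1 := h.r_pos hN
  have h2 := h.p_mul
  by_contra hc
  push Not at hc
  nlinarith

lemma p_lt_one (hN : 3 ≤ N) : p < 1 := by
  have h1 := h.r_pos hN
  have h2 := h.p_mul
  by_contra hc
  push Not at hc
  nlinarith

lemma b_le_a (hN : 3 ≤ N) : b ≤ a := by
  have hp := h.p_pos hN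
  have hb := h.b_le
  rcases h.a_cases with h1 | ⟨h1, h2⟩
  · nlinarith [mul_nonneg hp.le (show 0 ≤ 1 - 2 * b by linarith)]
  · linarith

lemma A_pos (hN : 3 ≤ N) : 0 < 1 + 2 * (N - 1) * a := by
  have := h.b_le_a hN
  have := h.b_pos
  have : 0 ≤ (N - 1) * a := mul_nonneg (by linarith) (by linarith)
  linarith

lemma g_nonneg (hN : 3 ≤ N) (ha : 2 * (a - b) = p * (1 - 2 * b)) {g σ : ℝ} (hσ : 0 ≤ σ)
    (hg : g * (1 + 2 * (N - 1) * a) =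
      (N * b ^ 2 * (1 - 2 * b) - 2 * (a - b) * (1 - 2 * b + N * b ^ 2)) * σ) :
    0 ≤ g ∧ (b < 1 / 2 → 0 < σ → 0 < g) := by
  have hA := h.A_pos hN
  have hr := h.r_pos hN
  have hb := h.b_pos
  have key : g * (1 + 2 * (N - 1) * a) * (1 + r) = 4 * N * b ^ 4 * (1 - 2 * b) * σ := by
    rw [hg, ha]
    have e := h.p_mul
    have e' := h.r_eq
    linear_combination (-(1 - 2 * b) * (1 - 2 * b + N * b ^ 2) * σ) * e
      + (N * b ^ 2 * (1 - 2 * b) * σ - (1 - 2 * b) * (1 - 2 * b + N * b ^ 2) * σ) * e'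
  have hpos : 0 < (1 + 2 * (N - 1) * a) * (1 + r) := by positivity
  have hβ : 0 ≤ 1 - 2 * b := by linarith [h.b_le]
  refine ⟨?_, fun hb' hσ' => ?_⟩
  · have h0 : 0 ≤ 4 * N * b ^ 4 * (1 - 2 * b) * σ := by positivity
    by_contra hc
    push Not at hc
    nlinarith [mul_neg_of_neg_of_pos hc hpos]
  · have hβ' : 0 < 1 - 2 * b := by linarith
    have h0 : 0 < 4 * N * b ^ 4 * (1 - 2 * b) * σ := by positivity
    by_contra hc
    push Not at hc
    nlinarith [mul_nonpos_of_nonpos_of_nonneg hc hpos.le]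

lemma c_lower (hN : 3 ≤ N) (ha : 2 * (a - b) = p * (1 - 2 * b)) :
    -(2 * b ^ 2) ≤ (N - 2) * b ^ 2 - 2 * (a - b) := by
  have hb := h.b_pos
  have hr := h.r_pos hN
  have hp := h.p_pos hN
  have e := h.p_mul
  have hβ : 0 ≤ 1 - 2 * b := by linarith [h.b_le]
  have h1 : p ≤ r := by
    have := mul_pos hp hr
    linarith
  have h3 : p * (1 - 2 * b) ≤ r * (1 - 2 * b) := mul_le_mul_of_nonneg_right h1 hβ
  have h4 : r * (1 - 2 * b) = N * b ^ 2 - 4 * (N * b ^ 4) := by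
    rw [h.r_eq]; ring
  have h5 : 0 ≤ N * b ^ 4 := by positivity
  linarith

lemma c_upper (hN : 3 ≤ N) (hNb : N * b ≤ 1) (ha : 2 * (a - b) = p * (1 - 2 * b)) :
    (N - 2) * b ^ 2 - 2 * (a - b) ≤ 2 * b ^ 2 := by
  have hb := h.b_pos
  have hr := h.r_pos hN
  have e := h.p_mul
  have e' := h.r_eq
  have hb3 : b ≤ 1 / 3 := by nlinarith
  have h4 : (N - 4) * (1 + r) ≤ N * (1 - 4 * b ^ 2) := by
    have hNb2 : N * b ^ 2 ≤ b := by
      have := mul_le_mul_of_nonneg_right hNb hb.le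
      linarith
    have hNb2' : 4 * (N * b ^ 2) ≤ 4 / 3 := by linarith
    rcases le_or_gt N 4 with h5 | h5
    · have : (N - 4) * r ≤ 0 := mul_nonpos_of_nonpos_of_nonneg (by linarith) hr.le
      linarith
    · have h6 : r ≤ b * (1 + 2 * b) := by
        have := mul_le_mul_of_nonneg_right hNb2 (show 0 ≤ 1 + 2 * b by linarith)
        rw [e']; linarith
      have h7 : (N - 4) * r ≤ (N - 4) * (b * (1 + 2 * b)) :=
        mul_le_mul_of_nonneg_left h6 (by linarith)
      have h8 : N * b * (1 + 2 * b) ≤ 1 * (1 + 2 * b) :=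
        mul_le_mul_of_nonneg_right hNb (by linarith)
      nlinarith
  have h3 : (N - 4) * b ^ 2 * (1 + r) ≤ p * (1 - 2 * b) * (1 + r) := by
    have h8 : (N - 4) * (1 + r) * b ^ 2 ≤ N * (1 - 4 * b ^ 2) * b ^ 2 :=
      mul_le_mul_of_nonneg_right h4 (by positivity)
    have h9 : p * (1 - 2 * b) * (1 + r) = N * (1 - 4 * b ^ 2) * b ^ 2 := by
      linear_combination (1 - 2 * b) * e + (1 - 2 * b) * e'
    linarith
  have h5 := le_of_mul_le_mul_right h3 (show 0 < 1 + r by linarith)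
  linarith

lemma d_pos_of_le (hN : 3 ≤ N) (hNb : N * b ≤ 1) {g σ L x y : ℝ} (hL : 0 < L)
    (hσ : 0 ≤ σ) (hx : x ^ 2 ≤ N * σ) (hy : y ^ 2 ≤ N * σ) (hxL : -L ≤ x) (hyL : -L ≤ y)
    (hg : g * (1 + 2 * (N - 1) * a) =
      (N * b ^ 2 * (1 - 2 * b) - 2 * (a - b) * (1 - 2 * b + N * b ^ 2)) * σ) :
    0 < ((N - 2) * b ^ 2 - 2 * (a - b)) * (x * y) + 2 * a * ((x + L) * (y + L))
        + b ^ 2 * (x ^ 2 + y ^ 2) + g := by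
  have hb := h.b_pos
  have hb2 : b < 1 / 2 := by nlinarith
  have ha : 2 * (a - b) = p * (1 - 2 * b) := by
    rcases h.a_cases with h1 | ⟨h1, h2⟩
    · exact h1
    · linarith
  obtain ⟨g0, g1⟩ := h.g_nonneg hN ha hσ hg
  have hr := h.r_pos hN
  have hp := h.p_pos hN
  have hp1 := h.p_lt_one hN
  have hab := h.b_le_a hN
  have e := h.p_mul
  have e' := h.r_eq
  have hβ : 0 < 1 - 2 * b := by linarith
  have c1 := h.c_lower hN ha
  have c2 := h.c_upper hN hNb ha
  set c := (N - 2) * b ^ 2 - 2 * (a - b)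
  have k1 : 0 ≤ c * (x * y) + b ^ 2 * (x ^ 2 + y ^ 2) := by
    have : c * (x * y) + b ^ 2 * (x ^ 2 + y ^ 2) =
      ((2 * b ^ 2 + c) * (x + y) ^ 2 + (2 * b ^ 2 - c) * (x - y) ^ 2) / 4 := by ring
    rw [this]
    have := mul_nonneg (show 0 ≤ 2 * b ^ 2 + c by linarith) (sq_nonneg (x + y))
    have := mul_nonneg (show 0 ≤ 2 * b ^ 2 - c by linarith) (sq_nonneg (x - y))
    linarith
  have ha0 : 0 < a := by linarith
  have k2 : 0 ≤ 2 * a * ((x + L) * (y + L)) :=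
    mul_nonneg (by linarith) (mul_nonneg (by linarith) (by linarith))
  rcases hσ.eq_or_lt with h0 | h0
  · have hx0 : x = 0 := by
      rw [← h0, mul_zero] at hx
      exact pow_eq_zero_iff two_ne_zero |>.mp (le_antisymm hx (sq_nonneg x))
    have hy0 : y = 0 := by
      rw [← h0, mul_zero] at hy
      exact pow_eq_zero_iff two_ne_zero |>.mp (le_antisymm hy (sq_nonneg y))
    subst hx0 hy0
    have : 0 < 2 * a * ((0 + L) * (0 + L)) := by positivity
    linarith
  · have := g1 hb2 h0
    linarith

lemma d_pos_of_ge (hN : 3 ≤ N) (ha : 2 * (a - b) = p * (1 - 2 * b)) {g σ L x y : ℝ}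
    (hL : 0 < L) (hσ : 0 ≤ σ) (hxL : (p - 1) * L ≤ x) (hyL : (p - 1) * L ≤ y)
    (hg : g * (1 + 2 * (N - 1) * a) =
      (N * b ^ 2 * (1 - 2 * b) - 2 * (a - b) * (1 - 2 * b + N * b ^ 2)) * σ) :
    0 < ((N - 2) * b ^ 2 - 2 * (a - b)) * (x * y) + 2 * a * ((x + L) * (y + L))
        + b ^ 2 * (x ^ 2 + y ^ 2) + g := by
  have hb := h.b_pos
  obtain ⟨g0, -⟩ := h.g_nonneg hN ha hσ hg
  have hr := h.r_pos hN
  have hp := h.p_pos hN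
  have hp1 := h.p_lt_one hN
  have hab := h.b_le_a hN
  have e := h.p_mul
  have e' := h.r_eq
  have hβ : 0 ≤ 1 - 2 * b := by linarith [h.b_le]
  have ha0 : 0 < a := by linarith
  have c1 := h.c_lower hN ha
  have c2 : (N - 2) * b ^ 2 - 2 * (a - b) - 2 * b ^ 2 ≤ 2 * a * r := by
    have h2a : 2 * a = 2 * b + p * (1 - 2 * b) := by linarith
    rw [ha, h2a]
    have : (2 * b + p * (1 - 2 * b)) * r + p * (1 - 2 * b) = r := by
      linear_combination (1 - 2 * b) * e
    have : (N - 4) * b ^ 2 ≤ r := by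
      rw [e']
      have : 0 ≤ N * b ^ 3 := by positivity
      nlinarith
    linarith
  set c := (N - 2) * b ^ 2 - 2 * (a - b)
  set m := (1 - p) * L with hm
  have hm0 : 0 < m := mul_pos (by linarith) hL
  have hmr : m * r = p * L := by
    rw [hm]; linear_combination (-L) * e
  have hxm : 0 ≤ x + m := by rw [hm]; linarith
  have hym : 0 ≤ y + m := by rw [hm]; linarith
  have hxym := mul_nonneg hxm hym
  have hLm : L = m + p * L := by rw [hm]; ring
  have hRic : p * L * (x + y + m + L) ≤ (x + L) * (y + L) := by
    have : (x + L) * (y + L) = (x + m) * (y + m) + p * L * (x + y + m + L) := by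
      rw [hm]; ring
    linarith
  have hpL : 0 < p * L := by positivity
  have hd2 : 2 * a * (p * L * (x + y + m + L)) ≤ 2 * a * ((x + L) * (y + L)) :=
    mul_le_mul_of_nonneg_left hRic (by linarith)
  rcases le_or_gt c (2 * b ^ 2) with hc | hc
  · have k1 : 0 ≤ c * (x * y) + b ^ 2 * (x ^ 2 + y ^ 2) := by
      have : c * (x * y) + b ^ 2 * (x ^ 2 + y ^ 2) =
        ((2 * b ^ 2 + c) * (x + y) ^ 2 + (2 * b ^ 2 - c) * (x - y) ^ 2) / 4 := by ring
      rw [this]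
      have := mul_nonneg (show 0 ≤ 2 * b ^ 2 + c by linarith) (sq_nonneg (x + y))
      have := mul_nonneg (show 0 ≤ 2 * b ^ 2 - c by linarith) (sq_nonneg (x - y))
      linarith
    have : 0 < 2 * a * (p * L * (x + y + m + L)) :=
      mul_pos (by linarith) (mul_pos hpL (by linarith))
    linarith
  · have hc' : 0 < c - 2 * b ^ 2 := by linarith
    have k1 : -((c - 2 * b ^ 2) * (m * (x + y + m))) ≤ c * (x * y) + b ^ 2 * (x ^ 2 + y ^ 2) := by
      have h1 : -(m * (x + y + m)) ≤ x * y := by nlinarith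
      have h2 := mul_le_mul_of_nonneg_left h1 hc'.le
      nlinarith [mul_nonneg (sq_nonneg b) (sq_nonneg (x + y))]
    rcases le_or_gt 0 (x + y + m) with hT | hT
    · have h1 : (c - 2 * b ^ 2) * (m * (x + y + m)) ≤ 2 * a * r * (m * (x + y + m)) :=
        mul_le_mul_of_nonneg_right c2 (mul_nonneg hm0.le hT)
      have h2 : 2 * a * r * (m * (x + y + m)) = 2 * a * (p * L * (x + y + m)) := by
        linear_combination (2 * a * (x + y + m)) * hmr
      have h3 : 0 < 2 * a * (p * L * L) := by positivity
      have h4 : 2 * a * (p * L * (x + y + m + L)) =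
        2 * a * (p * L * (x + y + m)) + 2 * a * (p * L * L) := by ring
      linarith
    · have h1 : 0 ≤ -((c - 2 * b ^ 2) * (m * (x + y + m))) := by
        have := mul_nonneg hc'.le (mul_nonneg hm0.le (show 0 ≤ -(x + y + m) by linarith))
        linarith
      have : 0 < 2 * a * (p * L * (x + y + m + L)) :=
        mul_pos (by linarith) (mul_pos hpL (by linarith))
      linarith

lemma d_pos_of_half (hN : 3 ≤ N) (hb : b = 1 / 2) (ha : 1 / 2 ≤ a) {g σ L x y : ℝ}
    (hL : 0 < L) (hσ0 : 0 ≤ σ) (hσ : σ ≤ (N - 1) * ((1 - p) * L) ^ 2)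
    (hxL : (p - 1) * L ≤ x) (hyL : (p - 1) * L ≤ y)
    (hg : g * (1 + 2 * (N - 1) * a) =
      (N * b ^ 2 * (1 - 2 * b) - 2 * (a - b) * (1 - 2 * b + N * b ^ 2)) * σ) :
    0 < ((N - 2) * b ^ 2 - 2 * (a - b)) * (x * y) + 2 * a * ((x + L) * (y + L))
        + b ^ 2 * (x ^ 2 + y ^ 2) + g := by
  have e := h.p_mul
  have e' := h.r_eq
  have hA := h.A_pos hN
  subst hb
  have hr2 : r = N / 2 := by rw [e']; ring
  rw [hr2] at e
  set m := (1 - p) * L with hm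
  have hmL : m * (N + 2) = 2 * L := by rw [hm]; linear_combination (-2 * L) * e
  have hm0 : 0 < m := by
    have : 0 < m * (N + 2) := by rw [hmL]; linarith
    exact (mul_pos_iff_of_pos_right (by linarith)).mp this
  have hxm : 0 ≤ x + m := by rw [hm]; linarith
  have hym : 0 ≤ y + m := by rw [hm]; linarith
  have hg2 : -(N / 4 * m ^ 2) ≤ g := by
    have h1 : g * (1 + 2 * (N - 1) * a) = -((2 * a - 1) * (N / 4) * σ) := by rw [hg]; ring
    have h2 : (2 * a - 1) * (N / 4) * σ ≤ (2 * a - 1) * (N / 4) * ((N - 1) * m ^ 2) :=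
      mul_le_mul_of_nonneg_left hσ (mul_nonneg (by linarith) (by linarith))
    have h3 : (2 * a - 1) * (N - 1) ≤ 1 + 2 * (N - 1) * a := by linarith
    have h4 : (2 * a - 1) * (N - 1) * (N / 4 * m ^ 2) ≤ (1 + 2 * (N - 1) * a) * (N / 4 * m ^ 2) :=
      mul_le_mul_of_nonneg_right h3 (mul_nonneg (by linarith) (sq_nonneg m))
    have h5 : -(N / 4 * m ^ 2) * (1 + 2 * (N - 1) * a) ≤ g * (1 + 2 * (N - 1) * a) := by linarith
    exact le_of_mul_le_mul_right h5 hA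
  have hxy : -(m * (x + y)) - m ^ 2 ≤ x * y := by linarith [mul_nonneg hxm hym]
  have hS : -(2 * m) ≤ x + y := by linarith
  have h5 : ((N - 2) * (1 / 2) ^ 2 - 2 * (a - 1 / 2)) * (x * y) + 2 * a * ((x + L) * (y + L))
        + (1 / 2) ^ 2 * (x ^ 2 + y ^ 2) + g =
      N / 4 * (x * y) + 2 * a * (L * (x + y + L)) + (x + y) ^ 2 / 4 + g := by ring
  rw [h5]
  have hNm : 3 * m ≤ N * m := mul_le_mul_of_nonneg_right hN hm0.le
  have hL2 : 0 < L - 2 * m := by linarith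
  have hL4 : 0 < L - N / 4 * m := by linarith
  have hSL : 0 < x + y + L := by linarith
  have h6 : L * (x + y + L) ≤ 2 * a * (L * (x + y + L)) := by
    have := mul_le_mul_of_nonneg_right (show 1 ≤ 2 * a by linarith) (mul_pos hL hSL).le
    linarith
  have h7 : N / 4 * (-(m * (x + y)) - m ^ 2) ≤ N / 4 * (x * y) :=
    mul_le_mul_of_nonneg_left hxy (by linarith)
  have h8 : 0 < N / 4 * (-(m * (x + y)) - m ^ 2) + L * (x + y + L) - N / 4 * m ^ 2 := by
    have e1 : N / 4 * (-(m * (x + y)) - m ^ 2) + L * (x + y + L) - N / 4 * m ^ 2 =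
        (L - N / 4 * m) * (x + y + 2 * m) + L * (L - 2 * m) := by ring
    rw [e1]
    have := mul_nonneg hL4.le (show 0 ≤ x + y + 2 * m by linarith)
    have := mul_pos hL hL2
    linarith
  linarith [sq_nonneg (x + y)]

lemma ric_pos (hN : 3 ≤ N) {g σ L : ℝ} (hL : 0 < L) (hσ : 0 < σ)
    (hg : g * (1 + 2 * (N - 1) * a) =
      (N * b ^ 2 * (1 - 2 * b) - 2 * (a - b) * (1 - 2 * b + N * b ^ 2)) * σ) :
    0 < q ^ 2 * L ^ 2 + (-2 * b * ((1 - q) * L) ^ 2 + 2 * a * L * (N - 2) * ((q - 1) * L)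
      + (2 * a * (N - 1) * L ^ 2 + N * b ^ 2 * σ + (N - 1) * g))
      - q * (L ^ 2 + σ + (-2 * b * σ + 2 * a * (N - 1) * L ^ 2 + N * b ^ 2 * σ + (N - 1) * g)) := by
  have hb := h.b_pos
  have hr := h.r_pos hN
  have hp := h.p_pos hN
  have hp1 := h.p_lt_one hN
  have hab := h.b_le_a hN
  have hA := h.A_pos hN
  have e := h.p_mul
  have e' := h.r_eq
  have hq := h.q_le
  have hβ : 0 ≤ 1 - 2 * b := by linarith [h.b_le]
  have key : ((1 - q) * (N ^ 2 * b ^ 2 - (N - 1) * (2 * (a - b)) * (1 - 2 * b))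
      - q * (1 - 2 * b) * (1 + 2 * (N - 1) * a)) > 0 ∧ 0 ≤ 2 * (a - b) - q * (1 - 2 * b) := by
    rcases h.a_cases with ha | ⟨hb2, ha⟩
    · rw [ha]
      set X := N ^ 2 * b ^ 2 - (N - 1) * (p * (1 - 2 * b)) * (1 - 2 * b) with hX
      have h1 : ((1 - p) * X - p * (1 - 2 * b) * (1 + 2 * (N - 1) * a)) * (1 + r) =
          4 * N ^ 2 * b ^ 4 := by
        have h2a : 2 * (N - 1) * a = (N - 1) * (2 * b + p * (1 - 2 * b)) := by
          linear_combination (N - 1) * ha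
        rw [hX, h2a]
        linear_combination (-(N ^ 2 * b ^ 2 - (N - 1) * (p * (1 - 2 * b)) * (1 - 2 * b)
          + (1 - 2 * b) * (1 + (N - 1) * (2 * b + p * (1 - 2 * b))))
          - (N - 1) * (1 - 2 * b) ^ 2) * e - (1 - 2 * b) * N * e'
      have h2 : 0 < (1 - p) * X - p * (1 - 2 * b) * (1 + 2 * (N - 1) * a) := by
        have : 0 < 4 * N ^ 2 * b ^ 4 := by positivity
        by_contra hc
        push Not at hc
        nlinarith [mul_nonpos_of_nonpos_of_nonneg hc (show 0 ≤ 1 + r by linarith)]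
      have h3 : 0 ≤ p * (1 - 2 * b) * (1 + 2 * (N - 1) * a) := by positivity
      have hX0 : 0 < X := by
        by_contra hc
        push Not at hc
        nlinarith [mul_nonneg (show 0 ≤ 1 - p by linarith) (show 0 ≤ -X by linarith)]
      have h4 : 0 ≤ (p - q) * X := mul_nonneg (by linarith) hX0.le
      have h5 : 0 ≤ (p - q) * ((1 - 2 * b) * (1 + 2 * (N - 1) * a)) :=
        mul_nonneg (by linarith) (mul_nonneg hβ hA.le)
      refine ⟨?_, ?_⟩
      · linarith
      · nlinarith
    · subst hb2
      refine ⟨?_, by linarith⟩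
      have : 0 < (1 - q) * (N ^ 2 * (1 / 2) ^ 2) := mul_pos (by linarith) (by positivity)
      nlinarith
  obtain ⟨k1, k2⟩ := key
  have hid : (q ^ 2 * L ^ 2 + (-2 * b * ((1 - q) * L) ^ 2 + 2 * a * L * (N - 2) * ((q - 1) * L)
      + (2 * a * (N - 1) * L ^ 2 + N * b ^ 2 * σ + (N - 1) * g))
      - q * (L ^ 2 + σ + (-2 * b * σ + 2 * a * (N - 1) * L ^ 2 + N * b ^ 2 * σ + (N - 1) * g)))
      * (1 + 2 * (N - 1) * a) =
      (1 - q) * L ^ 2 * (2 * (a - b) - q * (1 - 2 * b)) * (1 + 2 * (N - 1) * a) +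
      σ * ((1 - q) * (N ^ 2 * b ^ 2 - (N - 1) * (2 * (a - b)) * (1 - 2 * b))
      - q * (1 - 2 * b) * (1 + 2 * (N - 1) * a)) := by
    linear_combination (1 - q) * (N - 1) * hg
  have h6 : 0 ≤ (1 - q) * L ^ 2 * (2 * (a - b) - q * (1 - 2 * b)) * (1 + 2 * (N - 1) * a) :=
    mul_nonneg (mul_nonneg (mul_nonneg (by linarith) (sq_nonneg L)) k2) hA.le
  have h7 := mul_pos hσ k1
  by_contra hc
  push Not at hc
  have := mul_nonpos_of_nonpos_of_nonneg hc hA.le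
  rw [hid] at this
  linarith

end GoodParam

lemma sigmaR_nonneg {R : Module.End ℝ (so n)} (hR : selfAdjEnd R) : 0 ≤ sigmaR R := by
  have h0 : ∀ i j, Ric0 R j i = Ric0 R i j := fun i j => congrFun (congrFun (Ric0_symm hR) i) j
  refine div_nonneg ?_ (Nat.cast_nonneg n)
  simp only [Matrix.trace, Matrix.diag_apply, Matrix.mul_apply]
  refine Finset.sum_nonneg fun i _ => Finset.sum_nonneg fun j _ => ?_
  rw [h0 i j]
  exact mul_self_nonneg _

lemma Ric0_eq_zero_of_sigmaR (hn : 3 ≤ n) {R : Module.End ℝ (so n)} (hR : selfAdjEnd R)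
    (h : sigmaR R = 0) : Ric0 R = 0 := by
  have h0 : ∀ i j, Ric0 R j i = Ric0 R i j := fun i j => congrFun (congrFun (Ric0_symm hR) i) j
  have h1 := trace_Ric0_sq hn R
  rw [h, mul_zero] at h1
  simp only [Matrix.trace, Matrix.diag_apply, Matrix.mul_apply] at h1
  have h2 : ∀ i, ∀ j, 0 ≤ Ric0 R i j * Ric0 R j i := fun i j => by
    rw [h0 i j]; exact mul_self_nonneg _
  ext i j
  have h3 := (Finset.sum_eq_zero_iff_of_nonneg
    (fun i _ => Finset.sum_nonneg fun j _ => h2 i j)).mp h1 i (Finset.mem_univ i)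
  have h4 := (Finset.sum_eq_zero_iff_of_nonneg (fun j _ => h2 i j)).mp h3 j (Finset.mem_univ j)
  rw [h0 i j] at h4
  simpa using h4

lemma qf_smul_vec (M : Mat n) (c : ℝ) (v : Fin n → ℝ) :
    qf M (fun i => c * v i) = c ^ 2 * qf M v := by
  simp only [qf, Finset.mul_sum]
  exact Finset.sum_congr rfl fun i _ => Finset.sum_congr rfl fun j _ => by ring

lemma forall_qf_of_unit {M : Mat n} {c : ℝ}
    (h : ∀ v : Fin n → ℝ, ∑ i, v i ^ 2 = 1 → c ≤ qf M v) (v : Fin n → ℝ) :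
    c * ∑ i, v i ^ 2 ≤ qf M v := by
  have h0 : 0 ≤ ∑ i, v i ^ 2 := Finset.sum_nonneg fun i _ => sq_nonneg _
  rcases h0.eq_or_lt with h1 | h1
  · have hv : v = 0 := by
      funext i
      have := (Finset.sum_eq_zero_iff_of_nonneg (fun i _ => sq_nonneg (v i))).mp h1.symm i
        (Finset.mem_univ i)
      simpa using this
    subst hv
    simp [qf]
  · set t := ∑ i, v i ^ 2 with ht
    have hs : Real.sqrt t ^ 2 = t := Real.sq_sqrt h0
    have hs0 : 0 < Real.sqrt t := Real.sqrt_pos.mpr h1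
    have h2 := h (fun i => (Real.sqrt t)⁻¹ * v i) (by
      simp only [mul_pow]
      rw [← Finset.mul_sum, ← ht, inv_pow, hs]
      exact inv_mul_cancel₀ h1.ne')
    rw [qf_smul_vec, inv_pow, hs] at h2
    have := mul_le_mul_of_nonneg_left h2 h0
    rw [mul_inv_cancel_left₀ h1.ne'] at this
    linarith

lemma forall_ip_of_unit {R : Module.End ℝ (so n)} {c : ℝ}
    (h : ∀ X : so n, ip X X = 1 → c ≤ ip (R X) X) (Z : so n) :
    c * ip Z Z ≤ ip (R Z) Z := by
  by_cases hZ : Z = 0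
  · subst hZ
    simp [ip_zero_left]
  · obtain ⟨t, W, ht, hW, rfl, hc⟩ := exists_unit_smul hZ
    rw [← hc, map_smul, ip_smul_left, ip_smul_right]
    have := mul_le_mul_of_nonneg_left (h W hW) (sq_nonneg t)
    nlinarith

lemma qf_mul_self_of_qf_eq_zero {P : Mat n} (hP : Pᵀ = P) (h : ∀ v, 0 ≤ qf P v)
    {v : Fin n → ℝ} (hv : qf P v = 0) : qf (P * P) v = 0 := by
  have hs : ∀ i j, P j i = P i j := fun i j => congrFun (congrFun hP i) j
  have h1 : qf (P * P) v = ∑ k, (P *ᵥ v) k * (P *ᵥ v) k := by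
    simp only [qf, Matrix.mul_apply, Matrix.mulVec, dotProduct]
    have : ∀ g : Fin n → Fin n → ℝ, ∑ i, ∑ t, g i t = ∑ t, ∑ i, g i t :=
      fun g => Finset.sum_comm
    simp only [Finset.mul_sum, Finset.sum_mul]
    calc _ = ∑ i, ∑ k, ∑ j, v i * v j * (P i k * P k j) :=
          Finset.sum_congr rfl fun i _ => Finset.sum_comm
      _ = ∑ k, ∑ i, ∑ j, v i * v j * (P i k * P k j) := Finset.sum_comm
      _ = _ := ?_
    refine Finset.sum_congr rfl fun k _ => ?_
    rw [Finset.sum_comm]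
    refine Finset.sum_congr rfl fun i _ => Finset.sum_congr rfl fun j _ => ?_
    rw [hs k j]; ring
  set w := P *ᵥ v with hw
  have h2 : ∀ t : ℝ, qf P (fun i => v i + t * w i) =
      qf P v + 2 * t * (∑ k, w k * w k) + t ^ 2 * qf P w := by
    intro t
    have e1 : ∑ k, w k * w k = ∑ i, ∑ j, w i * v j * P i j := by
      refine Finset.sum_congr rfl fun i _ => ?_
      have hwi : w i = ∑ j, P i j * v j := rfl
      calc w i * w i = w i * ∑ j, P i j * v j := by rw [← hwi]
        _ = _ := by
          rw [Finset.mul_sum]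
          exact Finset.sum_congr rfl fun j _ => by ring
    have e2 : ∑ i, ∑ j, v i * w j * P i j = ∑ i, ∑ j, w i * v j * P i j := by
      rw [Finset.sum_comm]
      refine Finset.sum_congr rfl fun i _ => Finset.sum_congr rfl fun j _ => ?_
      rw [hs i j]; ring
    have e3 : qf P (fun i => v i + t * w i) = qf P v + t * (∑ i, ∑ j, v i * w j * P i j)
        + t * (∑ i, ∑ j, w i * v j * P i j) + t ^ 2 * qf P w := by
      simp only [qf, Finset.mul_sum, ← Finset.sum_add_distrib]
      exact Finset.sum_congr rfl fun i _ => Finset.sum_congr rfl fun j _ => by ring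
    rw [e3, e2, e1]; ring
  rw [h1]
  refine eq_zero_of_forall_quadratic_nonneg (α := qf P w) fun t => ?_
  have := h (fun i => v i + t * w i)
  rw [h2, hv] at this
  linarith

/-- Membership in the base cone `B(q)`, with lower bound `-μ λ̄` on the eigenvalues. -/
structure InBase (q μ : ℝ) (R : Module.End ℝ (so n)) : Prop where
  curvOp : isCurvOp R
  two : twoNonneg R
  low : ∀ X : so n, ip X X = 1 → 0 ≤ ip (R X) X + μ * lamb R
  ric : ∀ v : Fin n → ℝ, ∑ i, v i ^ 2 = 1 → 0 ≤ qf (RicM R) v - q * lamb R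

lemma posDef_Dop_of_goodParam (hn : 3 ≤ n) {a b q μ p r g : ℝ}
    (h : GoodParam (n : ℝ) a b q p r) {R : Module.End ℝ (so n)} (hB : InBase q μ R)
    (hL : 0 < lamb R)
    (hg : g * (1 + 2 * ((n : ℝ) - 1) * a) = ((n : ℝ) * b ^ 2 * (1 - 2 * b)
      - 2 * (a - b) * (1 - 2 * b + (n : ℝ) * b ^ 2)) * sigmaR R) :
    posDefEnd (Dop (((n : ℝ) - 2) * b ^ 2 - 2 * (a - b)) a b g R) := by
  have hN : (3 : ℝ) ≤ n := by exact_mod_cast hn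
  have hR := hB.curvOp.1
  have hσ := sigmaR_nonneg hR
  by_cases hNb : (n : ℝ) * b ≤ 1
  · refine posDef_Dop hn hR (q := 0) (fun v => ?_) fun f _ hf2 hf i j => ?_
    · rw [zero_mul, zero_mul]
      exact qf_RicM_nonneg hn hR hB.two v
    · have hle : ∀ i, f i ^ 2 ≤ n * sigmaR R := fun i => by
        rw [← hf2]
        exact Finset.single_le_sum (f := fun i => f i ^ 2) (fun i _ => sq_nonneg (f i))
          (Finset.mem_univ i)
      exact h.d_pos_of_le hN hNb hL hσ (hle i) (hle j) (by linarith [hf i]) (by linarith [hf j]) hg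
  · obtain ⟨-, rfl⟩ := h.q_cases.resolve_right hNb
    refine posDef_Dop hn hR (q := q) (fun v => ?_) fun f hf1 hf2 hf i j => ?_
    · exact forall_qf_of_unit (fun v hv => by linarith [hB.ric v hv]) v
    · rcases h.a_cases with ha | ⟨hb, ha⟩
      · exact h.d_pos_of_ge hN ha hL hσ (hf i) (hf j) hg
      · refine h.d_pos_of_half hN hb ha hL hσ ?_ (hf i) (hf j) hg
        set m := (1 - q) * lamb R with hm
        have hfm : ∀ i, 0 ≤ f i + m := fun i => by rw [hm]; linarith [hf i]
        have hub : ∀ i, f i ≤ (n - 1) * m := fun i => by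
          have h1 : f i + m ≤ ∑ j, (f j + m) :=
            Finset.single_le_sum (f := fun j => f j + m) (fun j _ => hfm j) (Finset.mem_univ i)
          rw [Finset.sum_add_distrib, hf1] at h1
          simp at h1
          linarith
        have h2 : 0 ≤ ∑ i, (f i + m) * ((n - 1) * m - f i) :=
          Finset.sum_nonneg fun i _ => mul_nonneg (hfm i) (by linarith [hub i])
        have h3 : ∑ i, (f i + m) * ((n - 1) * m - f i) =
            ((n - 1) * m - m) * ∑ i, f i - ∑ i, f i ^ 2 + n * ((n - 1) * m ^ 2) := by
          have : (n : ℝ) * ((n - 1) * m ^ 2) = ∑ i : Fin n, (((n : ℝ) - 1) * m ^ 2) := by simp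
          rw [this, Finset.mul_sum, ← Finset.sum_sub_distrib, ← Finset.sum_add_distrib]
          exact Finset.sum_congr rfl fun i _ => by ring
        rw [h3, hf1, hf2] at h2
        have h4 : 0 ≤ (n : ℝ) * ((n - 1) * m ^ 2 - sigmaR R) := by linarith
        have := nonneg_of_mul_nonneg_right h4 (by linarith)
        linarith

lemma lamb_nonneg_of_posDef (hn : 3 ≤ n) {R : Module.End ℝ (so n)} (h : posDefEnd R) :
    0 ≤ lamb R := by
  have h1 := sum_quad_bvec hn R
  have hp : ∀ X, 0 ≤ ip (R X) X := fun X => by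
    by_cases hX : X = 0
    · subst hX; simp [ip_zero_left]
    · exact (h X hX).le
  have h2 : 0 ≤ (n : ℝ) * lamb R := by
    rw [← h1]
    exact Finset.sum_nonneg fun i _ => Finset.sum_nonneg fun j _ => hp _
  exact nonneg_of_mul_nonneg_right h2 (by positivity)

/-- Strict positivity of the derivatives of the active constraints of the base cone. -/
lemma InBase.strict (hn : 3 ≤ n) {a b q p r : ℝ} (h : GoodParam (n : ℝ) a b q p r)
    {μ : ℝ} (hμ : 0 ≤ μ) (hμq : 0 ≤ q → μ = 0)
    {R : Module.End ℝ (so n)} (hB : InBase q μ R) (hL : 0 < lamb R) :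
    ∃ V, isCurvOp V ∧ Qode (lab a b R) = lab a b V ∧
      (∀ X Y : so n, ip X X = 1 → ip Y Y = 1 → ip X Y = 0 → ip (R X) X + ip (R Y) Y = 0 →
        0 < ip (V X) X + ip (V Y) Y) ∧
      (∀ X : so n, ip X X = 1 → ip (R X) X + μ * lamb R = 0 →
        0 < ip (V X) X + μ * lamb V) ∧
      (∀ v : Fin n → ℝ, ∑ i, v i ^ 2 = 1 → qf (RicM R) v - q * lamb R = 0 →
        0 < qf (RicM V) v - q * lamb V) := by
  have hN : (3 : ℝ) ≤ n := by exact_mod_cast hn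
  have hR := hB.curvOp.1
  have hσ := sigmaR_nonneg hR
  have hA := h.A_pos hN
  obtain ⟨g, hg⟩ : ∃ g : ℝ, g * (1 + 2 * ((n : ℝ) - 1) * a) = ((n : ℝ) * b ^ 2 * (1 - 2 * b)
      - 2 * (a - b) * (1 - 2 * b + (n : ℝ) * b ^ 2)) * sigmaR R :=
    ⟨_ / (1 + 2 * ((n : ℝ) - 1) * a), div_mul_cancel₀ _ hA.ne'⟩
  have hD := posDef_Dop_of_goodParam hn h hB hL hg
  have hne : ∀ X : so n, ip X X = 1 → X ≠ 0 := fun X hX h0 => by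
    rw [h0, ip_zero_left] at hX; exact zero_ne_one hX
  refine ⟨_, (isCurvOp_Qode hB.curvOp).add (isCurvOp_Dop hR _ _ _ _),
    Qode_lab hn hB.curvOp hg, ?_, ?_, ?_⟩
  · intro X Y hX hY hXY h0
    have h1 := hB.two.Qode_pair_nonneg hR hX hY hXY h0
    have h2 := hD X (hne X hX)
    have h3 := hD Y (hne Y hY)
    rw [LinearMap.add_apply, LinearMap.add_apply, ip_add_left, ip_add_left]
    linarith
  · intro X hX h0
    have hle : ip (R X) X ≤ 0 := by linarith [mul_nonneg hμ hL.le]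
    have h1 := hB.two.Qode_min_nonneg hR hX hle
      (forall_ip_of_unit fun Z hZ => by linarith [hB.low Z hZ])
    have h2 := hD X (hne X hX)
    have h3 := lamb_nonneg_of_posDef hn hD
    rw [LinearMap.add_apply, ip_add_left, lamb_add, lamb_Qode hn hB.curvOp]
    have : 0 ≤ μ * (lamb R ^ 2 + sigmaR R
        + lamb (Dop (((n : ℝ) - 2) * b ^ 2 - 2 * (a - b)) a b g R)) :=
      mul_nonneg hμ (by positivity)
    linarith
  · intro v hv h0
    have hq : 0 ≤ q := by
      by_contra hc
      push Not at hc
      have := qf_RicM_nonneg hn hR hB.two v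
      nlinarith [mul_neg_of_neg_of_pos hc hL]
    have hpsd : posSemidefEnd R := fun X => by
      have := forall_ip_of_unit (R := R) (c := 0)
        (fun Z hZ => by have := hB.low Z hZ; rw [hμq hq] at this; linarith) X
      linarith
    have hq1 : q < 1 := h.q_le.trans_lt (h.p_lt_one hN)
    set P := RicM R - (q * lamb R) • (1 : Mat n) with hPdef
    have hRicP : RicM R = P + (q * lamb R) • 1 := by rw [hPdef]; abel
    have hPs : Pᵀ = P := by
      rw [hPdef, Matrix.transpose_sub, RicM_symm hR, Matrix.transpose_smul, Matrix.transpose_one]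
    have hqfP : ∀ w, qf P w = qf (RicM R) w - q * lamb R * ∑ i, w i ^ 2 := fun w => by
      rw [hRicP, qf_add, qf_smul, qf_one]; ring
    have hP0 : ∀ w, 0 ≤ qf P w := fun w => by
      have := forall_qf_of_unit (M := RicM R) (c := q * lamb R)
        (fun v hv => by linarith [hB.ric v hv]) w
      rw [hqfP]; linarith
    have hPv : qf P v = 0 := by rw [hqfP, hv]; linarith
    have hPPv := qf_mul_self_of_qf_eq_zero hPs hP0 hPv
    have hRic0 : Ric0 R = P + ((q - 1) * lamb R) • 1 := by
      have := RicM_eq R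
      rw [hRicP] at this
      have h2 : Ric0 R = P + (q * lamb R) • 1 - lamb R • 1 := by rw [this]; abel
      rw [h2]
      module
    have hR0v : qf (Ric0 R) v = (q - 1) * lamb R := by
      rw [hRic0, qf_add, qf_smul, qf_one, hv, hPv]; ring
    have hR00v : qf (Ric0 R * Ric0 R) v = ((1 - q) * lamb R) ^ 2 := by
      have : Ric0 R * Ric0 R = P * P + (2 * ((q - 1) * lamb R)) • P
          + ((q - 1) * lamb R) ^ 2 • 1 := by
        rw [hRic0]
        simp only [add_mul, mul_add, Matrix.mul_smul, Matrix.smul_mul, Matrix.mul_one,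
          Matrix.one_mul]
        module
      rw [this, qf_add, qf_add, qf_smul, qf_smul, qf_one, hv, hPv, hPPv]; ring
    have hσ0 : 0 < sigmaR R := by
      refine hσ.lt_of_ne fun h1 => ?_
      rw [Ric0_eq_zero_of_sigmaR hn hR h1.symm] at hR0v
      have : qf (0 : Mat n) v = 0 := by simp [qf]
      rw [this] at hR0v
      nlinarith
    have hcontr : q ^ 2 * lamb R ^ 2 ≤ qf (contr R (RicM R)) v := by
      have h1 := qf_contr_nonneg hpsd hPs hP0 v
      have h2 : qf (contr R (RicM R)) v = qf (contr R P) v + q * lamb R * qf (RicM R) v := by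
        conv_lhs => rw [hRicP, contr_add, contr_smul, contr_one]
        rw [qf_add, qf_smul]
      rw [h2, show qf (RicM R) v = q * lamb R by linarith]
      nlinarith
    have hfin := h.ric_pos hN hL hσ0 hg
    rw [lamb_add, lamb_Qode hn hB.curvOp, lamb_Dop hn hR, RicM_add, RicM_Qode hB.curvOp,
      RicM_Dop hn hR, qf_add, qf_add, qf_add, qf_smul, qf_smul, qf_smul, qf_one, hv, hR0v, hR00v]
    linarith

/-! ### The path of parameters -/

def pathB (s : ℝ) : ℝ := max 0 (min s (1 / 2))

def pathR (N s : ℝ) : ℝ := N * pathB s ^ 2 * (1 + 2 * pathB s)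

def pathP (N s : ℝ) : ℝ := pathR N s / (1 + pathR N s)

def pathQ (N s : ℝ) : ℝ := pathP N s - max 0 (1 - N * pathB s)

def pathMu (N s : ℝ) : ℝ := N * max 0 (-pathQ N s)

/-- The scaling factor `1 + 2(N-1)a'` of `ℓ_{a',b'} = ℓ_{a,b}⁻¹` on `⟨I⟩`. -/
def pathScale (N s : ℝ) : ℝ :=
  min 1 (2 * (1 - s)) / (1 + (N - 1) * (2 * pathB s + pathP N s * (1 - 2 * pathB s)))

def pathA (N s : ℝ) : ℝ := ((pathScale N s)⁻¹ - 1) / (2 * (N - 1))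

def pathA' (N s : ℝ) : ℝ := (pathScale N s - 1) / (2 * (N - 1))

def pathB' (N s : ℝ) : ℝ := ((1 + (N - 2) * pathB s)⁻¹ - 1) / (N - 2)

lemma pathB_nonneg (s : ℝ) : 0 ≤ pathB s := le_max_left _ _

lemma pathB_le (s : ℝ) : pathB s ≤ 1 / 2 := max_le (by norm_num) (min_le_right _ _)

section
variable {N : ℝ} (hN : 3 ≤ N) (s : ℝ)
include hN

lemma pathR_nonneg : 0 ≤ pathR N s := by
  have := pathB_nonneg s
  unfold pathR
  positivity

lemma pathP_nonneg : 0 ≤ pathP N s := by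
  have := pathR_nonneg hN s
  unfold pathP
  positivity

lemma pathP_lt_one : pathP N s < 1 := by
  have := pathR_nonneg hN s
  unfold pathP
  rw [div_lt_one (by linarith)]
  linarith

lemma pathQ_lt_one : pathQ N s < 1 := by
  have := pathP_lt_one hN s
  have := le_max_left 0 (1 - N * pathB s)
  unfold pathQ
  linarith

lemma pathMu_nonneg : 0 ≤ pathMu N s := mul_nonneg (by linarith) (le_max_left _ _)

lemma pathScale_denom_pos :
    1 ≤ 1 + (N - 1) * (2 * pathB s + pathP N s * (1 - 2 * pathB s)) := by
  have h1 := pathP_nonneg hN s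
  have h2 := pathB_nonneg s
  have h3 := pathB_le s
  have : 0 ≤ (N - 1) * (2 * pathB s + pathP N s * (1 - 2 * pathB s)) :=
    mul_nonneg (by linarith) (add_nonneg (by linarith) (mul_nonneg h1 (by linarith)))
  linarith

lemma pathScale_pos (hs : s < 1) : 0 < pathScale N s :=
  div_pos (lt_min one_pos (by linarith)) (by linarith [pathScale_denom_pos hN s])

lemma pathScale_le (hs : s < 1) : pathScale N s ≤ 2 * (1 - s) := by
  have h := pathScale_denom_pos hN s
  unfold pathScale
  rw [div_le_iff₀ (by linarith)]
  have : 0 ≤ 2 * (1 - s) := by linarith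
  nlinarith [min_le_right 1 (2 * (1 - s))]

lemma pathA'_eq : 1 + 2 * (N - 1) * pathA' N s = pathScale N s := by
  unfold pathA'
  have : 2 * (N - 1) ≠ 0 := by
    have : 0 < 2 * (N - 1) := by linarith
    exact this.ne'
  rw [mul_div_cancel₀ _ this]
  ring

lemma pathA_eq : 1 + 2 * (N - 1) * pathA N s = (pathScale N s)⁻¹ := by
  unfold pathA
  have : 2 * (N - 1) ≠ 0 := by
    have : 0 < 2 * (N - 1) := by linarith
    exact this.ne'
  rw [mul_div_cancel₀ _ this]
  ring

lemma pathB_denom_pos : 0 < 1 + (N - 2) * pathB s := by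
  have := mul_nonneg (show 0 ≤ N - 2 by linarith) (pathB_nonneg s)
  linarith

lemma pathB'_eq : 1 + (N - 2) * pathB' N s = (1 + (N - 2) * pathB s)⁻¹ := by
  unfold pathB'
  have : N - 2 ≠ 0 := by
    have : 0 < N - 2 := by linarith
    exact this.ne'
  rw [mul_div_cancel₀ _ this]
  ring

lemma path_inv_A (hs : s < 1) :
    (1 + 2 * (N - 1) * pathA N s) * (1 + 2 * (N - 1) * pathA' N s) = 1 := by
  rw [pathA_eq hN, pathA'_eq hN]
  exact inv_mul_cancel₀ (pathScale_pos hN s hs).ne'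

lemma path_inv_B : (1 + (N - 2) * pathB s) * (1 + (N - 2) * pathB' N s) = 1 := by
  rw [pathB'_eq hN]
  exact mul_inv_cancel₀ (pathB_denom_pos hN s).ne'

lemma goodParam_path (hs0 : 0 < s) (hs1 : s < 1) :
    GoodParam N (pathA N s) (pathB s) (pathQ N s) (pathP N s) (pathR N s) where
  b_pos := lt_max_of_lt_right (lt_min hs0 (by norm_num))
  b_le := pathB_le s
  r_eq := rfl
  p_mul := div_mul_cancel₀ _ (by linarith [pathR_nonneg hN s])
  q_le := by
    have := le_max_left 0 (1 - N * pathB s)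
    unfold pathQ
    linarith
  q_cases := by
    rcases le_or_gt 1 (N * pathB s) with h | h
    · refine Or.inl ⟨h, ?_⟩
      unfold pathQ
      rw [max_eq_left (by linarith), sub_zero]
    · exact Or.inr h.le
  a_cases := by
    have hA := pathA_eq hN s
    have hd := pathScale_denom_pos hN s
    rcases le_or_gt s (1 / 2) with h | h
    · left
      unfold pathScale at hA
      rw [min_eq_left (by linarith), one_div, inv_inv] at hA
      have h2 : (N - 1) * (2 * (pathA N s - pathB s) - pathP N s * (1 - 2 * pathB s)) = 0 := by
        linarith
      rcases mul_eq_zero.mp h2 with h3 | h3 <;> linarith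
    · right
      have hb : pathB s = 1 / 2 := by
        unfold pathB
        rw [min_eq_right h.le, max_eq_right (by norm_num)]
      refine ⟨hb, ?_⟩
      have h1 : N ≤ (pathScale N s)⁻¹ := by
        have h2 : pathScale N s ≤ N⁻¹ := by
          unfold pathScale
          rw [hb]
          have h3 : 1 + (N - 1) * (2 * (1 / 2) + pathP N s * (1 - 2 * (1 / 2))) = N := by ring
          rw [h3, ← one_div]
          exact div_le_div_of_nonneg_right (min_le_left _ _) (by linarith)
        have := inv_anti₀ (pathScale_pos hN s hs1) h2
        rwa [inv_inv] at this
      rw [← hA] at h1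
      have h2 : 0 ≤ (N - 1) * (2 * pathA N s - 1) := by linarith
      have := nonneg_of_mul_nonneg_right h2 (by linarith)
      linarith

lemma pathMu_eq_zero (h : 0 ≤ pathQ N s) : pathMu N s = 0 := by
  unfold pathMu
  rw [max_eq_left (by linarith), mul_zero]

lemma continuous_pathB : Continuous pathB := by
  unfold pathB
  fun_prop

lemma continuous_pathP : Continuous (pathP N) := by
  unfold pathP
  have h : Continuous (pathR N) := by
    have := continuous_pathB hN
    unfold pathR
    fun_prop
  exact h.div (by fun_prop) fun s => by
    have := pathR_nonneg hN s
    positivity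

lemma continuous_pathQ : Continuous (pathQ N) := by
  have := continuous_pathB hN
  have := continuous_pathP hN
  unfold pathQ
  fun_prop

lemma continuous_pathMu : Continuous (pathMu N) := by
  have := continuous_pathQ hN
  unfold pathMu
  fun_prop

lemma continuous_pathA' : Continuous (pathA' N) := by
  have := continuous_pathB hN
  have := continuous_pathP hN
  have h : Continuous (pathScale N) := by
    unfold pathScale
    exact Continuous.div (by fun_prop) (by fun_prop) fun s => by
      have := pathScale_denom_pos hN s
      positivity
  unfold pathA'
  fun_prop

lemma continuous_pathB' : Continuous (pathB' N) := by
  have := continuous_pathB hN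
  have h : Continuous fun s => (1 + (N - 2) * pathB s)⁻¹ :=
    Continuous.inv₀ (by fun_prop) fun s => (pathB_denom_pos hN s).ne'
  unfold pathB'
  fun_prop

omit hN in
lemma pathB_zero : pathB 0 = 0 := by
  unfold pathB; norm_num

omit hN in
lemma pathP_zero : pathP N 0 = 0 := by
  unfold pathP pathR; rw [pathB_zero]; norm_num

omit hN in
lemma pathQ_zero : pathQ N 0 = -1 := by
  unfold pathQ; rw [pathP_zero, pathB_zero]; norm_num

omit hN in
lemma pathMu_zero : pathMu N 0 = N := by
  unfold pathMu; rw [pathQ_zero]; norm_num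

omit hN in
lemma pathA'_zero : pathA' N 0 = 0 := by
  unfold pathA' pathScale; rw [pathP_zero, pathB_zero]; norm_num

omit hN in
lemma pathB'_zero : pathB' N 0 = 0 := by
  unfold pathB'; rw [pathB_zero]; norm_num

end

section Constraints
open Filter Topology
variable {E Θ : Type*} [NormedAddCommGroup E] [NormedSpace ℝ E] [TopologicalSpace Θ] {K : Set Θ}

lemma eventually_add_smul_nonneg (hK : IsCompact K) {ψ : Θ → E →ₗ[ℝ] ℝ}
    (hψ : Continuous fun p : Θ × E => ψ p.1 p.2) {X Q : E} (h0 : ∀ θ ∈ K, 0 ≤ ψ θ X)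
    (h1 : ∀ θ ∈ K, ψ θ X = 0 → 0 < ψ θ Q) :
    ∀ᶠ p : ℝ × E in 𝓝 (0, Q), 0 < p.1 → ∀ θ ∈ K, 0 ≤ ψ θ (X + p.1 • p.2) := by
  have key : ∀ᶠ p : ℝ × E in 𝓝 (0, Q), ∀ θ ∈ K, θ ∈ K → 0 < p.1 → 0 ≤ ψ θ (X + p.1 • p.2) := by
    refine hK.eventually_forall_of_forall_eventually fun θ hθ => ?_
    rcases (h0 θ hθ).eq_or_lt with h | h
    · have h2 := h1 θ hθ h.symm
      have hc : Continuous fun z : (ℝ × E) × Θ => ψ z.2 z.1.2 :=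
        hψ.comp (by fun_prop : Continuous fun z : (ℝ × E) × Θ => (z.2, z.1.2))
      have h3 : ∀ᶠ z : (ℝ × E) × Θ in 𝓝 ((0, Q), θ), 0 < ψ z.2 z.1.2 :=
        hc.continuousAt.eventually_const_lt h2
      filter_upwards [h3] with z hz hzK hz0
      rw [map_add, map_smul, smul_eq_mul]
      have := mul_pos hz0 hz
      linarith [h0 _ hzK]
    · have hc : Continuous fun z : (ℝ × E) × Θ => ψ z.2 (X + z.1.1 • z.1.2) :=
        hψ.comp (by fun_prop : Continuous fun z : (ℝ × E) × Θ => (z.2, X + z.1.1 • z.1.2))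
      have h3 : ∀ᶠ z : (ℝ × E) × Θ in 𝓝 ((0, Q), θ), 0 < ψ z.2 (X + z.1.1 • z.1.2) :=
        hc.continuousAt.eventually_const_lt (by simpa using h)
      filter_upwards [h3] with z hz _ _
      exact hz.le
  filter_upwards [key] with p hp hp0 θ hθ
  exact hp θ hθ hθ hp0

lemma eventually_nhds_nonneg (hK : IsCompact K) {ψ : Θ → E →ₗ[ℝ] ℝ}
    (hψ : Continuous fun p : Θ × E => ψ p.1 p.2) {J : E} (h : ∀ θ ∈ K, 0 < ψ θ J) :
    ∀ᶠ Y in 𝓝 J, ∀ θ ∈ K, 0 ≤ ψ θ Y := by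
  refine hK.eventually_forall_of_forall_eventually fun θ hθ => ?_
  have hc : Continuous fun z : E × Θ => ψ z.2 z.1 := hψ.comp continuous_swap
  have h3 : ∀ᶠ z : E × Θ in 𝓝 (J, θ), 0 < ψ z.2 z.1 :=
    hc.continuousAt.eventually_const_lt (h θ hθ)
  filter_upwards [h3] with z hz using hz.le

lemma eventually_shift [ProperSpace E] (hK : IsCompact K) {ψ : ℝ → Θ → E →ₗ[ℝ] ℝ}
    (hψ : Continuous fun p : ℝ × Θ × E => ψ p.1 p.2.1 p.2.2) {J : E} {s₀ : ℝ}
    (hJ : ∀ θ ∈ K, 0 < ψ s₀ θ J) {ε : ℝ} (hε : 0 < ε) :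
    ∀ᶠ s in 𝓝 s₀, ∀ X : E, ‖X‖ ≤ 1 →
      ((∀ θ ∈ K, 0 ≤ ψ s θ X) → ∀ θ ∈ K, 0 ≤ ψ s₀ θ (X + ε • J)) ∧
      ((∀ θ ∈ K, 0 ≤ ψ s₀ θ X) → ∀ θ ∈ K, 0 ≤ ψ s θ (X + ε • J)) := by
  have hB : IsCompact (Metric.closedBall (0 : E) 1) := isCompact_closedBall 0 1
  have key : ∀ᶠ s in 𝓝 s₀, ∀ y ∈ K ×ˢ Metric.closedBall (0 : E) 1,
      |ψ s y.1 y.2 - ψ s₀ y.1 y.2| < ε * ψ s₀ y.1 J ∧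
      |ψ s y.1 y.2 - ψ s₀ y.1 y.2| < ε * ψ s y.1 J := by
    refine (hK.prod hB).eventually_forall_of_forall_eventually fun y hy => ?_
    have c1 : Continuous fun z : ℝ × Θ × E => ψ s₀ z.2.1 z.2.2 :=
      hψ.comp (by fun_prop : Continuous fun z : ℝ × Θ × E => (s₀, z.2.1, z.2.2))
    have c2 : Continuous fun z : ℝ × Θ × E => ψ s₀ z.2.1 J :=
      hψ.comp (by fun_prop : Continuous fun z : ℝ × Θ × E => (s₀, z.2.1, J))
    have c3 : Continuous fun z : ℝ × Θ × E => ψ z.1 z.2.1 J :=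
      hψ.comp (by fun_prop : Continuous fun z : ℝ × Θ × E => (z.1, z.2.1, J))
    have c4 : Continuous fun z : ℝ × Θ × E => |ψ z.1 z.2.1 z.2.2 - ψ s₀ z.2.1 z.2.2| :=
      (hψ.sub c1).abs
    have hpos : 0 < ε * ψ s₀ y.1 J := mul_pos hε (hJ _ hy.1)
    have e1 : ∀ᶠ z : ℝ × Θ × E in 𝓝 (s₀, y),
        |ψ z.1 z.2.1 z.2.2 - ψ s₀ z.2.1 z.2.2| < ε * ψ s₀ z.2.1 J :=
      c4.continuousAt.eventually_lt (continuous_const.mul c2).continuousAt (by simpa using hpos)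
    have e2 : ∀ᶠ z : ℝ × Θ × E in 𝓝 (s₀, y),
        |ψ z.1 z.2.1 z.2.2 - ψ s₀ z.2.1 z.2.2| < ε * ψ z.1 z.2.1 J :=
      c4.continuousAt.eventually_lt (continuous_const.mul c3).continuousAt (by simpa using hpos)
    exact e1.and e2
  filter_upwards [key] with s hs X hX
  have hX' : X ∈ Metric.closedBall (0 : E) 1 := by simpa using hX
  refine ⟨fun h θ hθ => ?_, fun h θ hθ => ?_⟩
  · have h1 := (abs_lt.mp (hs (θ, X) ⟨hθ, hX'⟩).1).2
    have h2 := h θ hθ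
    rw [map_add, map_smul, smul_eq_mul]
    simp only at h1
    linarith
  · have h1 := (abs_lt.mp (hs (θ, X) ⟨hθ, hX'⟩).2).1
    have h2 := h θ hθ
    rw [map_add, map_smul, smul_eq_mul]
    simp only at h1
    linarith

end Constraints

/-! ### The norm on the space of endomorphisms -/

/-- Half of the coordinates, as a vector of Euclidean space. -/
def coordVec : Module.End ℝ (so n) →ₗ[ℝ] EuclideanSpace ℝ (Fin n × Fin n × Fin n × Fin n) where
  toFun R := WithLp.toLp 2 fun p => (1 / 2 : ℝ) * Rcoord R p.1 p.2.1 p.2.2.1 p.2.2.2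
  map_add' R S := by
    ext p
    simp only [Rcoord_add, PiLp.add_apply]
    ring
  map_smul' c R := by
    ext p
    simp only [Rcoord_smul, PiLp.smul_apply, smul_eq_mul, RingHom.id_apply]
    ring

lemma coordVec_injective : Function.Injective (coordVec (n := n)) := by
  intro R S h
  refine End_ext fun i j k l => ?_
  have := congrFun (congrArg (fun v => (WithLp.ofLp v)) h) (i, j, k, l)
  simp only [coordVec, LinearMap.coe_mk, AddHom.coe_mk] at this
  linarith

instance endNormedAddCommGroup : NormedAddCommGroup (Module.End ℝ (so n)) :=
  NormedAddCommGroup.induced _ _ coordVec coordVec_injective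

instance endNormedSpace : NormedSpace ℝ (Module.End ℝ (so n)) :=
  NormedSpace.induced ℝ (Module.End ℝ (so n)) _ coordVec

lemma norm_sq_eq (R : Module.End ℝ (so n)) :
    ‖R‖ ^ 2 = (1 / 4) * ∑ i, ∑ j, ∑ k, ∑ l, Rcoord R i j k l ^ 2 := by
  have h : ‖R‖ = ‖coordVec R‖ := rfl
  rw [h, EuclideanSpace.norm_sq_eq]
  simp only [Fintype.sum_prod_type, coordVec, LinearMap.coe_mk, AddHom.coe_mk, Real.norm_eq_abs,
    sq_abs, mul_pow, Finset.mul_sum]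
  norm_num

lemma endNorm_eq (R : Module.End ℝ (so n)) : endNorm R = ‖R‖ := by
  unfold endNorm
  rw [← Real.sqrt_sq (norm_nonneg R), norm_sq_eq]
  congr 1
  rw [sum_pairs (fun i j => ip (R (bvec i j)) (R (bvec i j)))]
  · simp only [ip_eq_sum, ← Rcoord_eq, Finset.mul_sum]
    refine Finset.sum_congr rfl fun i _ => Finset.sum_congr rfl fun j _ =>
      Finset.sum_congr rfl fun k _ => Finset.sum_congr rfl fun l _ => by ring
  · intro i j
    simp only [ip_eq_sum, ← Rcoord_eq]
    simp only [Rcoord_swap_left R j i, neg_mul_neg]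
  · intro i
    simp only [ip_eq_sum, ← Rcoord_eq, Rcoord_self_left, mul_zero, Finset.sum_const_zero]

lemma norm_le_of_abs_Rcoord_le {R : Module.End ℝ (so n)} {c : ℝ} (hc : 0 ≤ c)
    (h : ∀ i j k l, |Rcoord R i j k l| ≤ c) : ‖R‖ ≤ (n : ℝ) ^ 2 * c := by
  have h0 : 0 ≤ (n : ℝ) ^ 2 * c := by positivity
  refine abs_le_of_sq_le_sq' ?_ h0 |>.2
  rw [norm_sq_eq]
  have h1 : ∑ i, ∑ j, ∑ k, ∑ l, Rcoord R i j k l ^ 2 ≤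
      ∑ i : Fin n, ∑ j : Fin n, ∑ k : Fin n, ∑ l : Fin n, c ^ 2 :=
    Finset.sum_le_sum fun i _ => Finset.sum_le_sum fun j _ => Finset.sum_le_sum fun k _ =>
      Finset.sum_le_sum fun l _ => sq_le_sq' (abs_le.mp (h i j k l)).1 (abs_le.mp (h i j k l)).2
  simp only [Finset.sum_const, Finset.card_univ, Fintype.card_fin, nsmul_eq_mul] at h1
  have h2 : 0 ≤ (n : ℝ) ^ 4 * c ^ 2 := by positivity
  nlinarith

lemma continuous_Rcoord (i j k l : Fin n) :
    Continuous fun R : Module.End ℝ (so n) => Rcoord R i j k l := by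
  have h : Continuous fun R : Module.End ℝ (so n) => coordVec R :=
    (coordVec (n := n)).continuous_of_finiteDimensional
  have h2 : Continuous fun R : Module.End ℝ (so n) => 2 * (coordVec R).ofLp (i, j, k, l) :=
    continuous_const.mul ((EuclideanSpace.proj (𝕜 := ℝ) (i, j, k, l)).continuous.comp h)
  refine h2.congr fun R => ?_
  simp only [coordVec, LinearMap.coe_mk, AddHom.coe_mk]
  ring

lemma continuous_ip_apply {ι : Type*} [TopologicalSpace ι] {f : ι → Module.End ℝ (so n)}
    {x y : ι → so n} (hf : Continuous f) (hx : Continuous x) (hy : Continuous y) :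
    Continuous fun t => ip (f t (x t)) (y t) := by
  have h : ∀ i j k l, Continuous fun t => Rcoord (f t) i j k l :=
    fun i j k l => (continuous_Rcoord i j k l).comp hf
  have hx' : ∀ i j, Continuous fun t => (x t : Mat n) i j :=
    fun i j => (continuous_so_apply i j).comp hx
  have hy' : ∀ i j, Continuous fun t => (y t : Mat n) i j :=
    fun i j => (continuous_so_apply i j).comp hy
  simp only [ip_apply_eq_sum]
  refine continuous_const.mul (continuous_finsetSum _ fun i _ => continuous_finsetSum _ fun j _ =>
    continuous_finsetSum _ fun k _ => continuous_finsetSum _ fun l _ => ?_)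
  exact ((hx' i j).mul (hy' k l)).mul (h i j k l)

lemma continuous_qf_RicM {ι : Type*} [TopologicalSpace ι] {f : ι → Module.End ℝ (so n)}
    {v : ι → Fin n → ℝ} (hf : Continuous f) (hv : Continuous v) :
    Continuous fun t => qf (RicM (f t)) (v t) := by
  have h : ∀ i j, Continuous fun t => RicM (f t) i j := by
    intro i j
    let L : Module.End ℝ (so n) →ₗ[ℝ] ℝ :=
      { toFun := fun R => RicM R i j
        map_add' := fun R S => by rw [RicM_add]; rfl
        map_smul' := fun c R => by rw [RicM_smul]; rfl }
    exact L.continuous_of_finiteDimensional.comp hf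
  have hv' : ∀ i, Continuous fun t => v t i := fun i => (continuous_apply i).comp hv
  unfold qf
  exact continuous_finsetSum _ fun i _ => continuous_finsetSum _ fun j _ =>
    ((hv' i).mul (hv' j)).mul (h i j)

lemma continuous_lamb : Continuous (lamb : Module.End ℝ (so n) → ℝ) := by
  let L : Module.End ℝ (so n) →ₗ[ℝ] ℝ :=
    { toFun := lamb, map_add' := lamb_add, map_smul' := lamb_smul }
  exact L.continuous_of_finiteDimensional

/-- `ℓ_{a,b}` as a linear map. -/
def labL (hn : 3 ≤ n) (a b : ℝ) : Module.End ℝ (so n) →ₗ[ℝ] Module.End ℝ (so n) where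
  toFun := lab a b
  map_add' := lab_add hn a b
  map_smul' c R := lab_smul hn a b c R

lemma lab_eq_combination (a b : ℝ) (R : Module.End ℝ (so n)) :
    lab a b R = R + a • (lab 1 0 R - R) + b • (lab 0 1 R - R) := by
  simp only [lab]
  module

lemma continuous_lab (hn : 3 ≤ n) {ι : Type*} [TopologicalSpace ι]
    {f : ι → Module.End ℝ (so n)} {a b : ι → ℝ} (ha : Continuous a) (hb : Continuous b)
    (hf : Continuous f) : Continuous fun t => lab (a t) (b t) (f t) := by
  have h1 : ∀ a b, Continuous fun t => lab a b (f t) := fun a b =>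
    ((labL hn a b).continuous_of_finiteDimensional).comp hf
  have h2 := h1 1 0
  have h3 := h1 0 1
  simp only [lab_eq_combination (a _) (b _) (f _)]
  exact (hf.add (ha.smul (h2.sub hf))).add (hb.smul (h3.sub hf))

lemma isClosed_isCurvOp : IsClosed {R : Module.End ℝ (so n) | isCurvOp R} := by
  let G : Submodule ℝ (Module.End ℝ (so n)) :=
    { carrier := {R | isCurvOp R}
      add_mem' := fun h1 h2 => h1.add h2
      zero_mem' := by
        refine ⟨fun X Y => ?_, fun i j k l => ?_⟩
        · simp [ip_comm X, ip_zero_left]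
        · simp [Rcoord, ip_zero_left]
      smul_mem' := fun c R h => h.smul c }
  exact G.closed_of_finiteDimensional

/-! ### The three families of linear inequalities defining the base cone -/

def onPairs (n : ℕ) : Set (so n × so n) :=
  {p | ip p.1 p.1 = 1 ∧ ip p.2 p.2 = 1 ∧ ip p.1 p.2 = 0}

lemma isCompact_onPairs : IsCompact (onPairs n) := by
  refine (isCompact_unit_so.prod isCompact_unit_so).of_isClosed_subset ?_
    fun p hp => ⟨hp.1, hp.2.1⟩
  have h : ∀ f g : so n × so n → so n, Continuous f → Continuous g →
      Continuous fun p => ip (f p) (g p) := fun f g hf hg => continuous_ip.comp (hf.prodMk hg)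
  exact (isClosed_eq (h _ _ continuous_fst continuous_fst) continuous_const).inter
    ((isClosed_eq (h _ _ continuous_snd continuous_snd) continuous_const).inter
      (isClosed_eq (h _ _ continuous_fst continuous_snd) continuous_const))

lemma isCompact_unit_vec : IsCompact {v : Fin n → ℝ | ∑ i, v i ^ 2 = 1} := by
  refine (isCompact_Icc (a := fun _ : Fin n => (-1 : ℝ)) (b := fun _ => 1)).of_isClosed_subset
    (isClosed_eq (by fun_prop) continuous_const) fun v hv => ?_
  have h : ∀ i, v i ^ 2 ≤ 1 := fun i => by
    have hv' : ∑ i, v i ^ 2 = 1 := hv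
    rw [← hv']
    exact Finset.single_le_sum (f := fun i => v i ^ 2) (fun i _ => sq_nonneg (v i))
      (Finset.mem_univ i)
  exact ⟨fun i => (abs_le.mp ((sq_le_one_iff_abs_le_one _).mp (h i))).1,
    fun i => (abs_le.mp ((sq_le_one_iff_abs_le_one _).mp (h i))).2⟩

def pairForm (p : so n × so n) : Module.End ℝ (so n) →ₗ[ℝ] ℝ where
  toFun R := ip (R p.1) p.1 + ip (R p.2) p.2
  map_add' R S := by simp only [LinearMap.add_apply, ip_add_left]; ring
  map_smul' c R := by
    simp only [LinearMap.smul_apply, ip_smul_left, RingHom.id_apply, smul_eq_mul]; ring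

def lowForm (μ : ℝ) (X : so n) : Module.End ℝ (so n) →ₗ[ℝ] ℝ where
  toFun R := ip (R X) X + μ * lamb R
  map_add' R S := by simp only [LinearMap.add_apply, ip_add_left, lamb_add]; ring
  map_smul' c R := by
    simp only [LinearMap.smul_apply, ip_smul_left, lamb_smul, RingHom.id_apply, smul_eq_mul]; ring

def ricForm (q : ℝ) (v : Fin n → ℝ) : Module.End ℝ (so n) →ₗ[ℝ] ℝ where
  toFun R := qf (RicM R) v - q * lamb R
  map_add' R S := by simp only [RicM_add, qf_add, lamb_add]; ring
  map_smul' c R := by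
    simp only [RicM_smul, qf_smul, lamb_smul, RingHom.id_apply, smul_eq_mul]; ring

/-- `ℓ_{a',b'} = ℓ_{a,b}⁻¹` at the parameter `s`. -/
def pathL (hn : 3 ≤ n) (s : ℝ) : Module.End ℝ (so n) →ₗ[ℝ] Module.End ℝ (so n) :=
  labL hn (pathA' n s) (pathB' n s)

lemma pathL_apply (hn : 3 ≤ n) (s : ℝ) (R : Module.End ℝ (so n)) :
    pathL hn s R = lab (pathA' n s) (pathB' n s) R := rfl

/-- The pinching cones. -/
def pinchCone (hn : 3 ≤ n) (s : ℝ) : Set (Module.End ℝ (so n)) :=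
  {S | isCurvOp S ∧ InBase (pathQ n s) (pathMu n s) (pathL hn s S)}

def pairPath (hn : 3 ≤ n) (s : ℝ) (p : so n × so n) : Module.End ℝ (so n) →ₗ[ℝ] ℝ :=
  pairForm p ∘ₗ pathL hn s

def lowPath (hn : 3 ≤ n) (s : ℝ) (X : so n) : Module.End ℝ (so n) →ₗ[ℝ] ℝ :=
  lowForm (pathMu n s) X ∘ₗ pathL hn s

def ricPath (hn : 3 ≤ n) (s : ℝ) (v : Fin n → ℝ) : Module.End ℝ (so n) →ₗ[ℝ] ℝ :=
  ricForm (pathQ n s) v ∘ₗ pathL hn s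

lemma mem_pinchCone_iff (hn : 3 ≤ n) (s : ℝ) (S : Module.End ℝ (so n)) :
    S ∈ pinchCone hn s ↔ isCurvOp S ∧ (∀ p ∈ onPairs n, 0 ≤ pairPath hn s p S) ∧
      (∀ X ∈ {X : so n | ip X X = 1}, 0 ≤ lowPath hn s X S) ∧
      ∀ v ∈ {v : Fin n → ℝ | ∑ i, v i ^ 2 = 1}, 0 ≤ ricPath hn s v S := by
  constructor
  · rintro ⟨h1, h2⟩
    exact ⟨h1, fun p hp => h2.two _ _ hp.1 hp.2.1 hp.2.2, fun X hX => h2.low X hX,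
      fun v hv => h2.ric v hv⟩
  · rintro ⟨h1, h2, h3, h4⟩
    exact ⟨h1, h1.lab hn _ _, fun X Y hX hY hXY => h2 (X, Y) ⟨hX, hY, hXY⟩,
      fun X hX => h3 X hX, fun v hv => h4 v hv⟩

section
variable (hn : 3 ≤ n)
include hn

lemma three_le_cast : (3 : ℝ) ≤ n := by exact_mod_cast hn

section
variable {ι : Type*} [TopologicalSpace ι] {s : ι → ℝ} {f : ι → Module.End ℝ (so n)}

lemma continuous_pathL (hs : Continuous s) (hf : Continuous f) :
    Continuous fun t => pathL hn (s t) (f t) :=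
  continuous_lab hn (a := fun t => pathA' n (s t)) (b := fun t => pathB' n (s t))
    ((continuous_pathA' (three_le_cast hn)).comp hs)
    ((continuous_pathB' (three_le_cast hn)).comp hs) hf

lemma continuous_pairPath {p : ι → so n × so n} (hs : Continuous s) (hp : Continuous p)
    (hf : Continuous f) : Continuous fun t => pairPath hn (s t) (p t) (f t) := by
  have h := continuous_pathL hn hs hf
  exact (continuous_ip_apply h hp.fst hp.fst).add (continuous_ip_apply h hp.snd hp.snd)

lemma continuous_lowPath {X : ι → so n} (hs : Continuous s) (hX : Continuous X)
    (hf : Continuous f) : Continuous fun t => lowPath hn (s t) (X t) (f t) := by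
  have h := continuous_pathL hn hs hf
  exact (continuous_ip_apply h hX hX).add
    (((continuous_pathMu (three_le_cast hn)).comp hs).mul (continuous_lamb.comp h))

lemma continuous_ricPath {v : ι → Fin n → ℝ} (hs : Continuous s) (hv : Continuous v)
    (hf : Continuous f) : Continuous fun t => ricPath hn (s t) (v t) (f t) := by
  have h := continuous_pathL hn hs hf
  exact (continuous_qf_RicM h hv).sub
    (((continuous_pathQ (three_le_cast hn)).comp hs).mul (continuous_lamb.comp h))

end

lemma RicM_one_wedge_one : RicM (wedge (1 : Mat n) 1) = ((n : ℝ) - 1) • (1 : Mat n) := by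
  rw [RicM_wedge_one Matrix.transpose_one, Matrix.trace_one, Fintype.card_fin]
  module

lemma lamb_one_wedge_one : lamb (wedge (1 : Mat n) 1) = (n : ℝ) - 1 := by
  have h := trace_RicM hn (wedge (1 : Mat n) 1)
  rw [RicM_one_wedge_one hn, Matrix.trace_smul, Matrix.trace_one, Fintype.card_fin,
    smul_eq_mul] at h
  have : (n : ℝ) ≠ 0 := by positivity
  exact mul_left_cancel₀ this (by linarith)

omit hn in
lemma wedge_one_one_apply (X : so n) : wedge (1 : Mat n) 1 X = X := by
  refine Subtype.ext ?_
  change (1 / 2 : ℝ) • ((1 : Mat n) * (X : Mat n) * (1 : Mat n)ᵀ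
    + (1 : Mat n) * (X : Mat n) * (1 : Mat n)ᵀ) = (X : Mat n)
  simp only [Matrix.transpose_one, Matrix.mul_one, Matrix.one_mul]
  module

omit hn in
lemma isCurvOp_one_wedge_one : isCurvOp (wedge (1 : Mat n) 1) :=
  isCurvOp_wedge_one Matrix.transpose_one

lemma pathL_one_wedge_one (s : ℝ) :
    pathL hn s (wedge (1 : Mat n) 1) = pathScale n s • wedge (1 : Mat n) 1 := by
  have hN := three_le_cast hn
  have h0 : Ric0 (wedge (1 : Mat n) 1) = 0 := by
    rw [Ric0, RicM_one_wedge_one hn, lamb_one_wedge_one hn, sub_self]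
  have hne : (n : ℝ) - 1 ≠ 0 := by
    have : (0 : ℝ) < n - 1 := by linarith
    exact this.ne'
  have h1 : wedge (0 : Mat n) (1 : Mat n) = 0 := by
    refine LinearMap.ext fun X => Subtype.ext ?_
    change (1 / 2 : ℝ) • ((0 : Mat n) * (X : Mat n) * (1 : Mat n)ᵀ
      + (1 : Mat n) * (X : Mat n) * (0 : Mat n)ᵀ) = 0
    simp
  rw [pathL_apply, lab, RI, RRic0, h0, lamb_one_wedge_one hn, div_self hne, h1,
    ← pathA'_eq hN s]
  module

lemma pairPath_one_pos {s : ℝ} (hs : s < 1) :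
    ∀ p ∈ onPairs n, 0 < pairPath hn s p (wedge (1 : Mat n) 1) := by
  rintro p ⟨h1, h2, -⟩
  change 0 < pairForm p (pathL hn s (wedge (1 : Mat n) 1))
  rw [pathL_one_wedge_one, map_smul]
  refine mul_pos (pathScale_pos (three_le_cast hn) s hs) ?_
  change 0 < ip (wedge (1 : Mat n) 1 p.1) p.1 + ip (wedge (1 : Mat n) 1 p.2) p.2
  rw [wedge_one_one_apply, wedge_one_one_apply, h1, h2]
  norm_num

lemma lowPath_one_pos {s : ℝ} (hs : s < 1) :
    ∀ X ∈ {X : so n | ip X X = 1}, 0 < lowPath hn s X (wedge (1 : Mat n) 1) := by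
  intro X hX
  change ip X X = 1 at hX
  have hN := three_le_cast hn
  change 0 < lowForm (pathMu n s) X (pathL hn s (wedge (1 : Mat n) 1))
  rw [pathL_one_wedge_one, map_smul]
  refine mul_pos (pathScale_pos hN s hs) ?_
  change 0 < ip (wedge (1 : Mat n) 1 X) X + pathMu n s * lamb (wedge (1 : Mat n) 1)
  rw [wedge_one_one_apply, hX, lamb_one_wedge_one hn]
  have := mul_nonneg (pathMu_nonneg hN s) (show (0 : ℝ) ≤ n - 1 by linarith)
  linarith

lemma ricPath_one_pos {s : ℝ} (hs : s < 1) :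
    ∀ v ∈ {v : Fin n → ℝ | ∑ i, v i ^ 2 = 1}, 0 < ricPath hn s v (wedge (1 : Mat n) 1) := by
  intro v hv
  change ∑ i, v i ^ 2 = 1 at hv
  have hN := three_le_cast hn
  change 0 < ricForm (pathQ n s) v (pathL hn s (wedge (1 : Mat n) 1))
  rw [pathL_one_wedge_one, map_smul]
  refine mul_pos (pathScale_pos hN s hs) ?_
  change 0 < qf (RicM (wedge (1 : Mat n) 1)) v - pathQ n s * lamb (wedge (1 : Mat n) 1)
  rw [RicM_one_wedge_one hn, lamb_one_wedge_one hn, qf_smul, qf_one, hv]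
  have := mul_pos (show 0 < 1 - pathQ n s by linarith [pathQ_lt_one hN s])
    (show (0 : ℝ) < n - 1 by linarith)
  linarith

lemma isClosed_pinchCone (s : ℝ) : IsClosed (pinchCone hn s) := by
  have h : pinchCone hn s = {S | isCurvOp S} ∩ ((⋂ p ∈ onPairs n, {S | 0 ≤ pairPath hn s p S}) ∩
      ((⋂ X ∈ {X : so n | ip X X = 1}, {S | 0 ≤ lowPath hn s X S}) ∩
      ⋂ v ∈ {v : Fin n → ℝ | ∑ i, v i ^ 2 = 1}, {S | 0 ≤ ricPath hn s v S})) := by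
    ext S
    rw [mem_pinchCone_iff]
    simp only [Set.mem_inter_iff, Set.mem_iInter]
    rfl
  have hc : ∀ f : Module.End ℝ (so n) →ₗ[ℝ] ℝ, IsClosed {S | 0 ≤ f S} := fun f =>
    isClosed_le continuous_const f.continuous_of_finiteDimensional
  rw [h]
  exact isClosed_isCurvOp.inter ((isClosed_biInter fun p _ => hc _).inter
    ((isClosed_biInter fun X _ => hc _).inter (isClosed_biInter fun v _ => hc _)))

lemma smul_mem_pinchCone {s : ℝ} {S : Module.End ℝ (so n)} (hS : S ∈ pinchCone hn s) {t : ℝ}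
    (ht : 0 ≤ t) : t • S ∈ pinchCone hn s := by
  rw [mem_pinchCone_iff] at hS ⊢
  obtain ⟨h1, h2, h3, h4⟩ := hS
  refine ⟨h1.smul t, fun p hp => ?_, fun X hX => ?_, fun v hv => ?_⟩ <;>
    rw [map_smul]
  exacts [mul_nonneg ht (h2 p hp), mul_nonneg ht (h3 X hX), mul_nonneg ht (h4 v hv)]

lemma add_mem_pinchCone {s : ℝ} {S T : Module.End ℝ (so n)} (hS : S ∈ pinchCone hn s)
    (hT : T ∈ pinchCone hn s) : S + T ∈ pinchCone hn s := by
  rw [mem_pinchCone_iff] at hS hT ⊢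
  obtain ⟨h1, h2, h3, h4⟩ := hS
  obtain ⟨k1, k2, k3, k4⟩ := hT
  refine ⟨h1.add k1, fun p hp => ?_, fun X hX => ?_, fun v hv => ?_⟩ <;>
    rw [map_add]
  exacts [add_nonneg (h2 p hp) (k2 p hp), add_nonneg (h3 X hX) (k3 X hX),
    add_nonneg (h4 v hv) (k4 v hv)]

lemma one_wedge_one_mem_interiorCurv {s : ℝ} (hs : s < 1) :
    wedge (1 : Mat n) 1 ∈ interiorCurv (pinchCone hn s) := by
  refine ⟨isCurvOp_one_wedge_one, ?_⟩
  have e1 := eventually_nhds_nonneg isCompact_onPairs (ψ := pairPath hn s)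
    (continuous_pairPath hn continuous_const continuous_fst continuous_snd) (pairPath_one_pos hn hs)
  have e2 := eventually_nhds_nonneg isCompact_unit_so (ψ := lowPath hn s)
    (continuous_lowPath hn continuous_const continuous_fst continuous_snd) (lowPath_one_pos hn hs)
  have e3 := eventually_nhds_nonneg isCompact_unit_vec (ψ := ricPath hn s)
    (continuous_ricPath hn continuous_const continuous_fst continuous_snd) (ricPath_one_pos hn hs)
  obtain ⟨ε, hε, h⟩ := Metric.eventually_nhds_iff.mp (e1.and (e2.and e3))
  refine ⟨ε, hε, fun Y hY hYε => ?_⟩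
  rw [endNorm_eq] at hYε
  have := h (y := Y) (by rw [dist_eq_norm]; exact hYε)
  exact (mem_pinchCone_iff hn s Y).2 ⟨hY, this.1, this.2.1, this.2.2⟩

omit hn in
lemma exists_truncSet_close {B : Set (Module.End ℝ (so n))}
    (hB : ∀ R ∈ B, ∀ t : ℝ, 0 ≤ t → t • R ∈ B) {X J : Module.End ℝ (so n)} {η : ℝ} (hη : 0 ≤ η)
    (hX : ‖X‖ ≤ 1) (h : X + η • J ∈ B) :
    ∃ Y ∈ truncSet B, endNorm (X - Y) ≤ 2 * (η * ‖J‖) := by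
  set k := η * ‖J‖ with hk
  have hk0 : 0 ≤ k := by positivity
  have hJ : ‖η • J‖ = k := by rw [norm_smul, Real.norm_eq_abs, abs_of_nonneg hη]
  have h1 : 0 < (1 + k)⁻¹ := by positivity
  refine ⟨(1 + k)⁻¹ • (X + η • J), ⟨hB _ h _ h1.le, ?_⟩, ?_⟩
  · rw [endNorm_eq, norm_smul, Real.norm_eq_abs, abs_of_pos h1, inv_mul_le_iff₀ (by positivity)]
    have := norm_add_le X (η • J)
    linarith
  · have e : X - (1 + k)⁻¹ • (X + η • J) = (1 + k)⁻¹ • (k • X - η • J) := by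
      have h2 : (1 + k)⁻¹ * (1 + k) = 1 := inv_mul_cancel₀ (by positivity)
      have h3 : X = ((1 + k)⁻¹ * (1 + k)) • X := by rw [h2, one_smul]
      calc _ = ((1 + k)⁻¹ * (1 + k)) • X - (1 + k)⁻¹ • (X + η • J) := by rw [← h3]
        _ = _ := by module
    rw [endNorm_eq, e, norm_smul, Real.norm_eq_abs, abs_of_pos h1,
      inv_mul_le_iff₀ (by positivity)]
    have h2 := norm_sub_le (k • X) (η • J)
    rw [hJ, norm_smul, Real.norm_eq_abs, abs_of_nonneg hk0] at h2
    have h3 : k * ‖X‖ ≤ k := mul_le_of_le_one_right hk0 hX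
    nlinarith [mul_nonneg hk0 hk0]

lemma hdClose_pinchCone {s₀ : ℝ} (hs₀ : s₀ < 1) {ε : ℝ} (hε : 0 < ε) :
    ∃ δ > (0 : ℝ), ∀ s, |s - s₀| < δ →
      hdClose (truncSet (pinchCone hn s)) (truncSet (pinchCone hn s₀)) ε := by
  set J := wedge (1 : Mat n) 1 with hJ
  set η := ε / (2 * (‖J‖ + 1)) with hη
  have hη0 : 0 < η := by positivity
  have hηε : 2 * (η * ‖J‖) ≤ ε := by
    have : η * (2 * (‖J‖ + 1)) = ε := div_mul_cancel₀ _ (by positivity)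
    linarith
  have e1 := eventually_shift isCompact_onPairs (ψ := pairPath hn)
    (continuous_pairPath hn continuous_fst continuous_snd.fst continuous_snd.snd) (pairPath_one_pos hn hs₀) hη0
  have e2 := eventually_shift isCompact_unit_so (ψ := lowPath hn)
    (continuous_lowPath hn continuous_fst continuous_snd.fst continuous_snd.snd) (lowPath_one_pos hn hs₀) hη0
  have e3 := eventually_shift isCompact_unit_vec (ψ := ricPath hn)
    (continuous_ricPath hn continuous_fst continuous_snd.fst continuous_snd.snd) (ricPath_one_pos hn hs₀) hη0
  obtain ⟨δ, hδ, h⟩ := Metric.eventually_nhds_iff.mp (e1.and (e2.and e3))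
  refine ⟨δ, hδ, fun s hs => ?_⟩
  obtain ⟨h1, h2, h3⟩ := h (y := s) (by rw [Real.dist_eq]; exact hs)
  have hcone : ∀ s, ∀ R ∈ pinchCone hn s, ∀ t : ℝ, 0 ≤ t → t • R ∈ pinchCone hn s :=
    fun s R hR t ht => smul_mem_pinchCone hn hR ht
  constructor
  · rintro X ⟨hX, hX1⟩
    rw [endNorm_eq] at hX1
    have hX' := (mem_pinchCone_iff hn s X).1 hX
    have hm : X + η • J ∈ pinchCone hn s₀ := (mem_pinchCone_iff hn s₀ _).2
      ⟨hX'.1.add (isCurvOp_one_wedge_one.smul η), (h1 X hX1).1 hX'.2.1, (h2 X hX1).1 hX'.2.2.1,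
        (h3 X hX1).1 hX'.2.2.2⟩
    obtain ⟨Y, hY, hXY⟩ := exists_truncSet_close (hcone s₀) hη0.le hX1 hm
    exact ⟨Y, hY, hXY.trans hηε⟩
  · rintro X ⟨hX, hX1⟩
    rw [endNorm_eq] at hX1
    have hX' := (mem_pinchCone_iff hn s₀ X).1 hX
    have hm : X + η • J ∈ pinchCone hn s := (mem_pinchCone_iff hn s _).2
      ⟨hX'.1.add (isCurvOp_one_wedge_one.smul η), (h1 X hX1).2 hX'.2.1, (h2 X hX1).2 hX'.2.2.1,
        (h3 X hX1).2 hX'.2.2.2⟩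
    obtain ⟨Y, hY, hXY⟩ := exists_truncSet_close (hcone s) hη0.le hX1 hm
    refine ⟨Y, hY, ?_⟩
    rw [endNorm_eq, norm_sub_rev, ← endNorm_eq]
    exact hXY.trans hηε

lemma lab_pathL {s : ℝ} (hs : s < 1) {S : Module.End ℝ (so n)} (hS : isCurvOp S) :
    lab (pathA n s) (pathB s) (pathL hn s S) = S :=
  lab_lab hn hS.1 (path_inv_A (three_le_cast hn) s hs) (path_inv_B (three_le_cast hn) s)

lemma pathL_lab {s : ℝ} (hs : s < 1) {R : Module.End ℝ (so n)} (hR : isCurvOp R) :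
    pathL hn s (lab (pathA n s) (pathB s) R) = R :=
  lab_lab hn hR.1 (by rw [mul_comm]; exact path_inv_A (three_le_cast hn) s hs)
    (by rw [mul_comm]; exact path_inv_B (three_le_cast hn) s)

lemma lamb_pathL (s : ℝ) {S : Module.End ℝ (so n)} (hS : isCurvOp S) :
    lamb (pathL hn s S) = pathScale n s * lamb S := by
  rw [pathL_apply, lamb_lab hn hS.1, pathA'_eq (three_le_cast hn)]

lemma lamb_pathL_pos {s : ℝ} (hs : s < 1) {S : Module.End ℝ (so n)} (hS : S ∈ pinchCone hn s)
    (h0 : S ≠ 0) : 0 < lamb (pathL hn s S) := by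
  have hB := hS.2
  refine (hB.two.lamb_nonneg hn hB.curvOp.1).lt_of_ne fun h => h0 ?_
  have h1 := hB.two.eq_zero_of_lamb hn hB.curvOp.1 h.symm
  rw [← lab_pathL hn hs hS.1, h1]
  exact map_zero (labL hn (pathA n s) (pathB s))

lemma Qode_mem_interiorCurv {s : ℝ} (hs0 : 0 < s) (hs : s < 1) {S : Module.End ℝ (so n)}
    (hS : S ∈ pinchCone hn s) (h0 : S ≠ 0) :
    Qode S ∈ interiorCurv (tangCone (pinchCone hn s) S) := by
  have hN := three_le_cast hn
  obtain ⟨V, hV, hQ, k1, k2, k3⟩ := hS.2.strict hn (goodParam_path hN s hs0 hs)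
    (pathMu_nonneg hN s) (pathMu_eq_zero hN s) (lamb_pathL_pos hn hs hS h0)
  rw [lab_pathL hn hs hS.1] at hQ
  have hQV : pathL hn s (Qode S) = V := by rw [hQ, pathL_lab hn hs hV]
  obtain ⟨hS1, hS2, hS3, hS4⟩ := (mem_pinchCone_iff hn s S).1 hS
  have e1 := eventually_add_smul_nonneg isCompact_onPairs (ψ := pairPath hn s)
    (continuous_pairPath hn continuous_const continuous_fst continuous_snd) (Q := Qode S) hS2
    (fun p hp h => by
      change 0 < pairForm p (pathL hn s (Qode S))
      rw [hQV]
      exact k1 p.1 p.2 hp.1 hp.2.1 hp.2.2 h)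
  have e2 := eventually_add_smul_nonneg isCompact_unit_so (ψ := lowPath hn s)
    (continuous_lowPath hn continuous_const continuous_fst continuous_snd) (Q := Qode S) hS3
    (fun X hX h => by
      change 0 < lowForm (pathMu n s) X (pathL hn s (Qode S))
      rw [hQV]
      exact k2 X hX h)
  have e3 := eventually_add_smul_nonneg isCompact_unit_vec (ψ := ricPath hn s)
    (continuous_ricPath hn continuous_const continuous_fst continuous_snd) (Q := Qode S) hS4
    (fun v hv h => by
      change 0 < ricForm (pathQ n s) v (pathL hn s (Qode S))
      rw [hQV]
      exact k3 v hv h)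
  obtain ⟨δ, hδ, h⟩ := Metric.eventually_nhds_iff.mp (e1.and (e2.and e3))
  refine ⟨isCurvOp_Qode hS1, δ, hδ, fun Y hY hYδ ε hε => ?_⟩
  rw [endNorm_eq] at hYδ
  have hd2 : 0 < δ / 2 := by positivity
  obtain ⟨h1, h2, h3⟩ := h (y := (δ / 2, Y)) (by
    rw [Prod.dist_eq, max_lt_iff]
    constructor
    · rw [dist_zero_right, Real.norm_eq_abs, abs_of_pos hd2]; linarith
    · rw [dist_eq_norm]; exact hYδ)
  refine ⟨S + (δ / 2) • Y, (mem_pinchCone_iff hn s _).2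
    ⟨hS1.add (hY.smul _), h1 hd2, h2 hd2, h3 hd2⟩, (δ / 2)⁻¹, by positivity, ?_⟩
  rw [add_sub_cancel_left, smul_smul, inv_mul_cancel₀ hd2.ne', one_smul, sub_self, endNorm_eq,
    norm_zero]
  exact hε

end

/-! ### Equivariance under the orthogonal group -/

lemma conjSo_coe (g : Mat n) (X : so n) : ((conjSo g X : so n) : Mat n) = g * (X : Mat n) * gᵀ :=
  rfl

lemma conjSo_transpose_bvec (g : Mat n) (i j a b : Fin n) :
    ((conjSo gᵀ (bvec i j) : so n) : Mat n) a b = g i a * g j b - g j a * g i b := by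
  rw [conjSo_coe, Matrix.transpose_transpose]
  simp only [Matrix.mul_apply, Matrix.transpose_apply, bvec, vwedge, evec, Matrix.of_apply]
  simp [mul_sub, sub_mul, Finset.sum_sub_distrib, mul_ite, ite_mul]

lemma Rcoord_onAct (g : Mat n) (R : Module.End ℝ (so n)) (i j k l : Fin n) :
    Rcoord (onAct g R) i j k l =
      ∑ a, ∑ b, ∑ c, ∑ d, g i a * g j b * g k c * g l d * Rcoord R a b c d := by
  have h1 : ∀ c d, ((R (conjSo gᵀ (bvec i j)) : so n) : Mat n) c d =
      ∑ a, ∑ b, g i a * g j b * Rcoord R a b c d := by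
    intro c d
    rw [End_apply]
    simp only [conjSo_transpose_bvec, sub_mul, Finset.sum_sub_distrib]
    have h : ∑ a, ∑ b, g j a * g i b * Rcoord R a b c d =
        -∑ a, ∑ b, g i a * g j b * Rcoord R a b c d := by
      rw [Finset.sum_comm, ← Finset.sum_neg_distrib]
      refine Finset.sum_congr rfl fun a _ => ?_
      rw [← Finset.sum_neg_distrib]
      refine Finset.sum_congr rfl fun b _ => ?_
      rw [Rcoord_swap_left R a b]
      ring
    rw [h]
    ring
  have h2 : Rcoord (onAct g R) i j k l =
      ∑ d, ∑ c, g k c * ((R (conjSo gᵀ (bvec i j)) : so n) : Mat n) c d * g l d := by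
    rw [Rcoord_eq]
    change (g * ((R (conjSo gᵀ (bvec i j)) : so n) : Mat n) * gᵀ) k l = _
    simp only [Matrix.mul_apply, Matrix.transpose_apply, Finset.sum_mul]
  rw [h2]
  simp only [h1, Finset.mul_sum, Finset.sum_mul]
  rw [Finset.sum_comm]
  rw [Finset.sum_comm_cycle]
  refine Finset.sum_congr rfl fun a _ => ?_
  rw [Finset.sum_comm_cycle]
  exact Finset.sum_congr rfl fun b _ => Finset.sum_congr rfl fun c _ =>
    Finset.sum_congr rfl fun d _ => by ring

lemma ip_conjSo {g : Mat n} (hg : gᵀ * g = 1) (X Y : so n) :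
    ip (conjSo g X) (conjSo g Y) = ip X Y := by
  unfold ip
  rw [conjSo_coe, conjSo_coe]
  congr 1
  calc (g * (X : Mat n) * gᵀ * (g * (Y : Mat n) * gᵀ)).trace
      = (g * ((X : Mat n) * (gᵀ * g) * (Y : Mat n) * gᵀ)).trace := by
        simp only [Matrix.mul_assoc]
    _ = _ := by
        rw [Matrix.trace_mul_comm, hg, Matrix.mul_one, Matrix.mul_assoc, hg, Matrix.mul_one]

lemma conjSo_conjSo {g h : Mat n} (hg : g * h = 1) (X : so n) :
    conjSo g (conjSo h X) = X := by
  refine Subtype.ext ?_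
  rw [conjSo_coe, conjSo_coe]
  calc g * (h * (X : Mat n) * hᵀ) * gᵀ = (g * h) * (X : Mat n) * (g * h)ᵀ := by
        rw [Matrix.transpose_mul]; simp only [Matrix.mul_assoc]
    _ = _ := by rw [hg, Matrix.transpose_one, Matrix.mul_one, Matrix.one_mul]

section
variable {g : Mat n} (hg : g * gᵀ = 1)
include hg

lemma ip_onAct (R : Module.End ℝ (so n)) (X Y : so n) :
    ip (onAct g R X) Y = ip (R (conjSo gᵀ X)) (conjSo gᵀ Y) := by
  have hg' : gᵀ * g = 1 := mul_eq_one_comm.mp hg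
  change ip (conjSo g (R (conjSo gᵀ X))) Y = _
  conv_lhs => rw [← conjSo_conjSo hg Y]
  exact ip_conjSo hg' _ _

lemma isCurvOp.onAct {R : Module.End ℝ (so n)} (hR : isCurvOp R) : isCurvOp (onAct g R) := by
  refine ⟨fun X Y => ?_, fun i j k l => ?_⟩
  · rw [ip_onAct hg, ip_comm X, ip_onAct hg, ip_comm (R (conjSo gᵀ Y)), hR.1]
  · simp only [Rcoord_onAct]
    have h1 : ∑ a, ∑ b, ∑ c, ∑ d, g j a * g k b * g i c * g l d * Rcoord R a b c d =
        ∑ a, ∑ b, ∑ c, ∑ d, g i a * g j b * g k c * g l d * Rcoord R b c a d := by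
      rw [Finset.sum_comm_cycle]
      refine Finset.sum_congr rfl fun a _ => Finset.sum_congr rfl fun b _ =>
        Finset.sum_congr rfl fun c _ => Finset.sum_congr rfl fun d _ => by ring
    have h2 : ∑ a, ∑ b, ∑ c, ∑ d, g k a * g i b * g j c * g l d * Rcoord R a b c d =
        ∑ a, ∑ b, ∑ c, ∑ d, g i a * g j b * g k c * g l d * Rcoord R c a b d := by
      rw [← Finset.sum_comm_cycle]
      refine Finset.sum_congr rfl fun a _ => Finset.sum_congr rfl fun b _ =>
        Finset.sum_congr rfl fun c _ => Finset.sum_congr rfl fun d _ => by ring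
    rw [h1, h2]
    simp only [← Finset.sum_add_distrib, ← mul_add, hR.2, mul_zero, Finset.sum_const_zero]

lemma RicM_onAct (R : Module.End ℝ (so n)) : RicM (onAct g R) = g * RicM R * gᵀ := by
  have hg' : gᵀ * g = 1 := mul_eq_one_comm.mp hg
  ext i j
  have h1 : ∀ b d, ∑ k, g k b * g k d = if b = d then 1 else 0 := fun b d => by
    have := congrFun (congrFun hg' b) d
    rwa [Matrix.mul_apply, Matrix.one_apply] at this
  have h2 : RicM (onAct g R) i j =
      ∑ a, ∑ b, ∑ c, ∑ d, g i a * g j c * Rcoord R a b c d * ∑ k, g k b * g k d := by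
    simp only [RicM_apply, Rcoord_onAct, Finset.mul_sum]
    rw [Finset.sum_comm]
    refine Finset.sum_congr rfl fun a _ => ?_
    rw [Finset.sum_comm]
    refine Finset.sum_congr rfl fun b _ => ?_
    rw [Finset.sum_comm]
    refine Finset.sum_congr rfl fun c _ => ?_
    rw [Finset.sum_comm]
    exact Finset.sum_congr rfl fun d _ => Finset.sum_congr rfl fun k _ => by ring
  rw [h2]
  simp only [h1, mul_ite, mul_one, mul_zero, Finset.sum_ite_eq, Finset.mem_univ, if_true]
  simp only [Matrix.mul_apply, Matrix.transpose_apply, RicM_apply, Finset.sum_mul, Finset.mul_sum]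
  rw [Finset.sum_comm_cycle]
  exact Finset.sum_congr rfl fun c _ => Finset.sum_congr rfl fun a _ =>
    Finset.sum_congr rfl fun b _ => by ring

lemma lamb_onAct (R : Module.End ℝ (so n)) : lamb (onAct g R) = lamb R := by
  have hg' : gᵀ * g = 1 := mul_eq_one_comm.mp hg
  rw [lamb, lamb, RicM_onAct hg, Matrix.trace_mul_comm, ← Matrix.mul_assoc, hg', Matrix.one_mul]

lemma Ric0_onAct (R : Module.End ℝ (so n)) : Ric0 (onAct g R) = g * Ric0 R * gᵀ := by
  rw [Ric0, Ric0, RicM_onAct hg, lamb_onAct hg, Matrix.mul_sub, Matrix.sub_mul, Matrix.mul_smul,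
    Matrix.smul_mul, Matrix.mul_one, hg]

lemma onAct_wedge_one (A : Mat n) : onAct g (wedge A 1) = wedge (g * A * gᵀ) 1 := by
  refine LinearMap.ext fun X => Subtype.ext ?_
  change g * ((1 / 2 : ℝ) • (A * (gᵀ * (X : Mat n) * gᵀᵀ) * (1 : Mat n)ᵀ
    + (1 : Mat n) * (gᵀ * (X : Mat n) * gᵀᵀ) * Aᵀ)) * gᵀ =
    (1 / 2 : ℝ) • (g * A * gᵀ * (X : Mat n) * (1 : Mat n)ᵀ
    + (1 : Mat n) * (X : Mat n) * (g * A * gᵀ)ᵀ)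
  simp only [Matrix.transpose_one, Matrix.mul_one, Matrix.one_mul, Matrix.transpose_transpose,
    Matrix.transpose_mul, Matrix.mul_smul, Matrix.smul_mul, Matrix.mul_add, Matrix.add_mul]
  congr 2
  · simp only [Matrix.mul_assoc, hg, Matrix.mul_one]
  · simp only [← Matrix.mul_assoc, hg, Matrix.one_mul]

omit hg in
lemma onAct_add (R S : Module.End ℝ (so n)) : onAct g (R + S) = onAct g R + onAct g S := by
  simp only [onAct, mul_add, add_mul]

lemma lab_onAct (hn : 3 ≤ n) (a b : ℝ) (R : Module.End ℝ (so n)) :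
    lab a b (onAct g R) = onAct g (lab a b R) := by
  rw [lab_eq hn, lab_eq hn, onAct_add, onAct_wedge_one hg, labM, labM, Ric0_onAct hg,
    lamb_onAct hg]
  simp only [Matrix.mul_add, Matrix.add_mul, Matrix.mul_smul, Matrix.smul_mul, Matrix.mul_one, hg]

lemma qf_conj (M : Mat n) (v : Fin n → ℝ) : qf (g * M * gᵀ) v = qf M (gᵀ *ᵥ v) := by
  have h : ∀ (M : Mat n) v, qf M v = v ⬝ᵥ (M *ᵥ v) := fun M v => by
    simp only [qf, dotProduct, Matrix.mulVec, Finset.mul_sum]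
    exact Finset.sum_congr rfl fun i _ => Finset.sum_congr rfl fun j _ => by ring
  rw [h, h, ← Matrix.mulVec_mulVec, ← Matrix.mulVec_mulVec, Matrix.dotProduct_mulVec,
    ← Matrix.mulVec_transpose]

lemma InBase.onAct {q μ : ℝ} {R : Module.End ℝ (so n)} (h : InBase q μ R) :
    InBase q μ (onAct g R) := by
  have hi : ∀ X Y, ip (conjSo gᵀ X) (conjSo gᵀ Y) = ip X Y :=
    ip_conjSo (by rw [Matrix.transpose_transpose]; exact hg)
  refine ⟨h.curvOp.onAct hg, fun X Y hX hY hXY => ?_, fun X hX => ?_, fun v hv => ?_⟩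
  · rw [ip_onAct hg, ip_onAct hg]
    exact h.two _ _ (by rw [hi, hX]) (by rw [hi, hY]) (by rw [hi, hXY])
  · rw [ip_onAct hg, lamb_onAct hg]
    exact h.low _ (by rw [hi, hX])
  · rw [RicM_onAct hg, lamb_onAct hg, qf_conj hg]
    refine h.ric _ ?_
    rw [← qf_one, ← qf_conj hg, Matrix.mul_one, hg, qf_one, hv]

lemma onAct_mem_pinchCone (hn : 3 ≤ n) {s : ℝ} {R : Module.End ℝ (so n)}
    (h : R ∈ pinchCone hn s) : onAct g R ∈ pinchCone hn s := by
  refine ⟨h.1.onAct hg, ?_⟩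
  rw [pathL_apply, lab_onAct hg hn]
  exact h.2.onAct hg

end

/-! ### The limit `s → 1` and the initial cone -/

lemma exists_smul_close {X Z : Module.End ℝ (so n)} {η : ℝ} (hX : ‖X‖ ≤ 1) (h : ‖X - Z‖ ≤ η) :
    ‖(1 + η)⁻¹ • Z‖ ≤ 1 ∧ ‖X - (1 + η)⁻¹ • Z‖ ≤ 2 * η := by
  have hη : 0 ≤ η := (norm_nonneg _).trans h
  have h1 : 0 < (1 + η)⁻¹ := by positivity
  have hZ : ‖Z‖ ≤ 1 + η := by
    have := norm_sub_le X (X - Z)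
    rw [sub_sub_cancel] at this
    linarith
  constructor
  · rw [norm_smul, Real.norm_eq_abs, abs_of_pos h1, inv_mul_le_iff₀ (by positivity), mul_one]
    exact hZ
  · have e : X - (1 + η)⁻¹ • Z = (1 + η)⁻¹ • (η • X + (X - Z)) := by
      have h2 : (1 + η)⁻¹ * (1 + η) = 1 := inv_mul_cancel₀ (by positivity)
      have h3 : X = ((1 + η)⁻¹ * (1 + η)) • X := by rw [h2, one_smul]
      calc _ = ((1 + η)⁻¹ * (1 + η)) • X - (1 + η)⁻¹ • Z := by rw [← h3]
        _ = _ := by module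
    rw [e, norm_smul, Real.norm_eq_abs, abs_of_pos h1, inv_mul_le_iff₀ (by positivity)]
    have h2 := norm_add_le (η • X) (X - Z)
    rw [norm_smul, Real.norm_eq_abs, abs_of_nonneg hη] at h2
    have h3 : η * ‖X‖ ≤ η := mul_le_of_le_one_right hη hX
    nlinarith [mul_nonneg hη hη]

section
variable (hn : 3 ≤ n)
include hn

lemma one_wedge_one_mem_pinchCone {s : ℝ} (hs : s < 1) :
    wedge (1 : Mat n) 1 ∈ pinchCone hn s := by
  obtain ⟨-, ε, hε, h⟩ := one_wedge_one_mem_interiorCurv hn hs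
  refine h _ isCurvOp_one_wedge_one ?_
  rw [sub_self, endNorm_eq, norm_zero]
  exact hε

lemma sub_RI_eq_lab {s : ℝ} (hs : s < 1) {X : Module.End ℝ (so n)} (hX : isCurvOp X) :
    X - RI X = lab (-1 / (2 * ((n : ℝ) - 1))) (pathB s) (pathL hn s X) := by
  have hN := three_le_cast hn
  have hne : (n : ℝ) - 1 ≠ 0 := by
    have : (0 : ℝ) < n - 1 := by linarith
    exact this.ne'
  have hR : isCurvOp (pathL hn s X) := hX.lab hn _ _
  conv_lhs => rw [← lab_pathL hn hs hX]
  have h1 : RI (lab (pathA n s) (pathB s) (pathL hn s X)) =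
      (1 + 2 * ((n : ℝ) - 1) * pathA n s) • RI (pathL hn s X) := by
    rw [RI, lamb_lab hn hR.1, RI, smul_smul, mul_div_assoc]
  have h2 : 2 * ((n : ℝ) - 1) * (-1 / (2 * ((n : ℝ) - 1))) = -1 := by field_simp
  rw [h1, lab, lab, h2]
  module

lemma exists_norm_sub_RI_le : ∃ K : ℝ, 0 ≤ K ∧ ∀ s : ℝ, 1 / 2 ≤ s → s < 1 →
    ∀ X ∈ pinchCone hn s, ‖X‖ ≤ 1 → 0 ≤ lamb X ∧ ‖X - RI X‖ ≤ K * (1 - s) := by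
  have hN := three_le_cast hn
  let T := LinearMap.toContinuousLinearMap (labL hn (-1 / (2 * ((n : ℝ) - 1))) (1 / 2))
  let L := LinearMap.toContinuousLinearMap
    ({ toFun := lamb, map_add' := lamb_add, map_smul' := lamb_smul } :
      Module.End ℝ (so n) →ₗ[ℝ] ℝ)
  set k : ℝ := (n : ℝ) ^ 2 * (2 * n + n ^ 3) with hk
  have hk0 : 0 ≤ k := by positivity
  refine ⟨‖T‖ * (k * (2 * ‖L‖)), by positivity, fun s hs hs1 X hX hX1 => ?_⟩
  have hR := hX.2
  have hl := hR.two.lamb_nonneg hn hR.curvOp.1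
  have hl1 := lamb_pathL hn s hX.1
  have hp := pathScale_pos hN s hs1
  have hX0 : 0 ≤ lamb X := by
    rw [hl1] at hl
    exact nonneg_of_mul_nonneg_right hl hp
  have hXL : lamb X ≤ ‖L‖ := by
    have h1 : ‖L X‖ ≤ ‖L‖ * ‖X‖ := L.le_opNorm X
    have h2 : L X = lamb X := rfl
    rw [h2, Real.norm_eq_abs, abs_of_nonneg hX0] at h1
    exact h1.trans (mul_le_of_le_one_right (norm_nonneg _) hX1)
  have hlR : lamb (pathL hn s X) ≤ 2 * (1 - s) * ‖L‖ := by
    rw [hl1]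
    exact mul_le_mul (pathScale_le hN s hs1) hXL hX0 (by linarith)
  have hRn : ‖pathL hn s X‖ ≤ k * (2 * (1 - s) * ‖L‖) := by
    have h1 := norm_le_of_abs_Rcoord_le (R := pathL hn s X)
      (c := (2 * n + n ^ 3) * lamb (pathL hn s X)) (by positivity)
      fun i j k l => hR.two.abs_Rcoord_le hn hR.curvOp.1 i j k l
    rw [← mul_assoc] at h1
    exact h1.trans (mul_le_mul_of_nonneg_left hlR hk0)
  have hB : pathB s = 1 / 2 := by
    unfold pathB
    rw [min_eq_right hs, max_eq_right (by norm_num)]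
  refine ⟨hX0, ?_⟩
  rw [sub_RI_eq_lab hn hs1 hX.1, hB]
  have h1 : ‖lab (-1 / (2 * ((n : ℝ) - 1))) (1 / 2) (pathL hn s X)‖ ≤ ‖T‖ * ‖pathL hn s X‖ :=
    T.le_opNorm _
  have h2 := mul_le_mul_of_nonneg_left hRn (norm_nonneg T)
  linarith

lemma hdClose_pinchCone_ray {ε : ℝ} (hε : 0 < ε) : ∃ s₀ ∈ Set.Ico (0 : ℝ) 1,
    ∀ s ∈ Set.Ico s₀ 1, hdClose (truncSet (pinchCone hn s))
      (truncSet {R | ∃ t : ℝ, 0 ≤ t ∧ R = t • wedge (1 : Mat n) (1 : Mat n)}) ε := by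
  have hN := three_le_cast hn
  obtain ⟨K, hK, h⟩ := exists_norm_sub_RI_le hn
  have hd : 0 < ε / (2 * (K + 1)) := by positivity
  refine ⟨max (1 / 2) (1 - ε / (2 * (K + 1))), ⟨le_max_of_le_left (by norm_num),
    max_lt (by norm_num) (by linarith)⟩, fun s hs => ?_⟩
  have hs2 : 1 / 2 ≤ s := (le_max_left _ _).trans hs.1
  have hs3 : 1 - s ≤ ε / (2 * (K + 1)) := by linarith [(le_max_right _ _).trans hs.1]
  rw [le_div_iff₀ (by positivity)] at hs3
  constructor
  · rintro X ⟨hX, hX1⟩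
    rw [endNorm_eq] at hX1
    obtain ⟨h1, h2⟩ := h s hs2 hs.2 X hX hX1
    have hη : 0 ≤ K * (1 - s) := mul_nonneg hK (by linarith [hs.2])
    obtain ⟨h3, h4⟩ := exists_smul_close hX1 h2
    refine ⟨(1 + K * (1 - s))⁻¹ • RI X, ⟨⟨(1 + K * (1 - s))⁻¹ * (lamb X / ((n : ℝ) - 1)), ?_, ?_⟩,
      ?_⟩, ?_⟩
    · have : (0 : ℝ) ≤ n - 1 := by linarith
      positivity
    · rw [RI, smul_smul]
    · rw [endNorm_eq]; exact h3
    · rw [endNorm_eq]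
      have hs4 := hs.2
      linarith
  · rintro Y ⟨⟨t, ht, rfl⟩, hY⟩
    refine ⟨_, ⟨smul_mem_pinchCone hn (one_wedge_one_mem_pinchCone hn hs.2) ht, hY⟩, ?_⟩
    rw [sub_self, endNorm_eq, norm_zero]
    exact hε.le

lemma pinchCone_zero : pinchCone hn 0 = {R | isCurvOp R ∧ twoNonneg R} := by
  have hN := three_le_cast hn
  have hL : ∀ S : Module.End ℝ (so n), pathL hn 0 S = S := fun S => by
    rw [pathL_apply, pathA'_zero, pathB'_zero, lab]
    module
  ext S
  constructor
  · rintro ⟨h1, h2⟩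
    rw [hL] at h2
    exact ⟨h1, h2.two⟩
  · rintro ⟨h1, h2⟩
    refine ⟨h1, ?_⟩
    rw [hL, pathQ_zero, pathMu_zero]
    have hl := h2.lamb_nonneg hn h1.1
    refine ⟨h1, h2, fun X hX => ?_, fun v _ => ?_⟩
    · obtain ⟨x, hx, hx2, hxZ⟩ := h2.exists_shift hn h1.1
      have := hxZ X
      rw [hX] at this
      linarith
    · have := qf_RicM_nonneg hn h1.1 h2 v
      linarith

lemma pinchingFamily_pinchCone : PinchingFamily n (pinchCone hn) where
  curv s _ R hR := hR.1
  closed s _ X hX := by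
    refine (isClosed_pinchCone hn s).closure_subset (Metric.mem_closure_iff.2 fun ε hε => ?_)
    obtain ⟨Y, hY, h⟩ := hX ε hε
    rw [endNorm_eq] at h
    exact ⟨Y, hY, by rw [dist_eq_norm]; exact h⟩
  convex s _ X hX Y hY a b ha hb _ :=
    add_mem_pinchCone hn (smul_mem_pinchCone hn hX ha) (smul_mem_pinchCone hn hY hb)
  cone s _ R hR t ht := smul_mem_pinchCone hn hR ht
  oInv s _ g hg R hR := onAct_mem_pinchCone hg hn hR
  fullDim s hs := ⟨_, one_wedge_one_mem_interiorCurv hn hs.2⟩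
  cont s₀ hs₀ ε hε := by
    obtain ⟨δ, hδ, h⟩ := hdClose_pinchCone hn hs₀.2 hε
    exact ⟨δ, hδ, fun s _ hs => h s hs⟩
  posScal s hs R hR h0 := by
    have hN := three_le_cast hn
    have h1 := lamb_pathL_pos hn hs.2 hR h0
    rw [lamb_pathL hn s hR.1] at h1
    rw [trace_RicM hn]
    have h2 := pos_of_mul_pos_right h1 (pathScale_pos hN s hs.2).le
    positivity
  odeInterior s hs R hR h0 := Qode_mem_interiorCurv hn hs.1 hs.2 hR h0
  limit ε hε := hdClose_pinchCone_ray hn hε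

end

/-- Theorem: there is a pinching family starting at the cone of 2-nonnegative curvature
operators. -/
theorem stmt_17 {n : ℕ} (hn : 3 ≤ n) :
    ∃ C : ℝ → Set (Module.End ℝ (so n)),
      PinchingFamily n C ∧ C 0 = {R | isCurvOp R ∧ twoNonneg R} := by
  exact ⟨pinchCone hn, pinchingFamily_pinchCone hn, pinchCone_zero hn⟩

end BW
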